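/- Let n ≥ 2, γ = 1, α > 1, and let f : ℝⁿ → ℂ be a Schwartz function. For each ε ∈ (0,1] let u^ε be a solution of (H) with datum f, and let u^ε_free be a solution of the linear equation iε∂_t u + (ε²/2)Δu = (|x|²/2)u with u(0,·) = f (same regularity class). Then for every T > 0 and every δ > 0 with α − 1 − δ > 0 there exist C > 0 and ε₀ ∈ (0,1] such that for all ε ∈ (0,ε₀] and for A^ε equal to either of the operators J^ε or H^ε: sup_{0 ≤ t ≤ T} ‖A^ε(t)( u^ε(t,·) − u^ε_free(t,·) )‖_{L²(ℝⁿ)} ≤ C ε^{α−1−δ}. -/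

import Mathlib

open MeasureTheory Real Filter Topology
open scoped ENNReal NNReal ComplexConjugate

noncomputable section

/-- Euclidean space ℝⁿ. -/
abbrev Rn (n : ℕ) := EuclideanSpace ℝ (Fin n)

/-- The gradient of a complex-valued function on ℝⁿ, as a ℂⁿ-valued function. -/
def grad {n : ℕ} (φ : Rn n → ℂ) (x : Rn n) : Fin n → ℂ :=
  fun j => fderiv ℝ φ x (EuclideanSpace.single j 1)

/-- The gradient, valued in the Euclidean space ℂⁿ (so that its pointwise norm is the
Euclidean norm). -/
def gradE {n : ℕ} (φ : Rn n → ℂ) (x : Rn n) : EuclideanSpace ℂ (Fin n) :=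
  (WithLp.equiv 2 (Fin n → ℂ)).symm (grad φ x)

/-- The Laplacian of a complex-valued function on ℝⁿ. -/
def lap {n : ℕ} (φ : Rn n → ℂ) (x : Rn n) : ℂ :=
  ∑ j, fderiv ℝ (fun y => fderiv ℝ φ y (EuclideanSpace.single j 1)) x (EuclideanSpace.single j 1)

/-- The operator J^ε(t) = (x/ε) sin t − i cos t ∇ₓ. -/
def Jop {n : ℕ} (ε t : ℝ) (φ : Rn n → ℂ) (x : Rn n) : Fin n → ℂ :=
  fun j => ((x j / ε : ℝ) : ℂ) * ((Real.sin t : ℝ) : ℂ) * φ x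
    - Complex.I * ((Real.cos t : ℝ) : ℂ) * grad φ x j

/-- The operator H^ε(t) = x cos t + iε sin t ∇ₓ. -/
def Hop {n : ℕ} (ε t : ℝ) (φ : Rn n → ℂ) (x : Rn n) : Fin n → ℂ :=
  fun j => ((x j : ℝ) : ℂ) * ((Real.cos t : ℝ) : ℂ) * φ x
    + Complex.I * (ε : ℂ) * ((Real.sin t : ℝ) : ℂ) * grad φ x j

/-- J^ε(t)φ viewed as valued in Euclidean ℂⁿ. -/
def JopE {n : ℕ} (ε t : ℝ) (φ : Rn n → ℂ) (x : Rn n) : EuclideanSpace ℂ (Fin n) :=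
  (WithLp.equiv 2 (Fin n → ℂ)).symm (Jop ε t φ x)

/-- H^ε(t)φ viewed as valued in Euclidean ℂⁿ. -/
def HopE {n : ℕ} (ε t : ℝ) (φ : Rn n → ℂ) (x : Rn n) : EuclideanSpace ℂ (Fin n) :=
  (WithLp.equiv 2 (Fin n → ℂ)).symm (Hop ε t φ x)

/-- Convolution (|x|^{−γ} ∗ ψ)(x) of a real-valued ψ with the kernel |x|^{−γ}. -/
def conv {n : ℕ} (γ : ℝ) (ψ : Rn n → ℝ) (x : Rn n) : ℝ :=
  ∫ y : Rn n, ‖x - y‖ ^ (-γ) * ψ y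

/-- Convolution (|x|^{−γ} ∗ ψ)(x) of a complex-valued ψ with the kernel |x|^{−γ}. -/
def convC {n : ℕ} (γ : ℝ) (ψ : Rn n → ℂ) (x : Rn n) : ℂ :=
  ∫ y : Rn n, ((‖x - y‖ ^ (-γ) : ℝ) : ℂ) * ψ y

/-- The Hartree potential |x|^{−γ} ∗ |u|². -/
def hartree {n : ℕ} (γ : ℝ) (u : Rn n → ℂ) (x : Rn n) : ℝ :=
  conv γ (fun y => Complex.normSq (u y)) x

/-- `u` is a (smooth, Schwartz-in-x) solution of the semiclassical Hartree equation with
harmonic potential: iε∂ₜu + (ε²/2)Δu = (|x|²/2)u + ε^α(|x|^{−γ}∗|u|²)u, u(0) = f. -/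
structure IsSolutionH (n : ℕ) (α γ ε : ℝ) (f : Rn n → ℂ) (u : ℝ → Rn n → ℂ) : Prop where
  smooth : ContDiff ℝ (⊤ : ℕ∞) (fun p : ℝ × Rn n => u p.1 p.2)
  schwartz : ∀ t, ∃ φ : SchwartzMap (Rn n) ℂ, u t = ⇑φ
  init : u 0 = f
  eq : ∀ t x, Complex.I * (ε : ℂ) * deriv (fun s => u s x) t
      + ((ε ^ 2 / 2 : ℝ) : ℂ) * lap (u t) x
    = ((‖x‖ ^ 2 / 2 : ℝ) : ℂ) * u t x
      + ((ε ^ α : ℝ) : ℂ) * ((hartree γ (u t) x : ℝ) : ℂ) * u t x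

/-- `u` is a (smooth, Schwartz-in-x) solution of the linear equation
iε∂ₜu + (ε²/2)Δu = (|x|²/2)u. -/
structure IsLinSol (n : ℕ) (ε : ℝ) (u : ℝ → Rn n → ℂ) : Prop where
  smooth : ContDiff ℝ (⊤ : ℕ∞) (fun p : ℝ × Rn n => u p.1 p.2)
  schwartz : ∀ t, ∃ φ : SchwartzMap (Rn n) ℂ, u t = ⇑φ
  eq : ∀ t x, Complex.I * (ε : ℂ) * deriv (fun s => u s x) t
      + ((ε ^ 2 / 2 : ℝ) : ℂ) * lap (u t) x
    = ((‖x‖ ^ 2 / 2 : ℝ) : ℂ) * u t x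

/-- The semiclassical harmonic-oscillator propagator U^ε(t), via Mehler's formula
(for 0 < t < π). -/
def Uprop (n : ℕ) (ε t : ℝ) (φ : Rn n → ℂ) (x : Rn n) : ℂ :=
  Complex.exp (-Complex.I * (n : ℂ) * (π : ℂ) / 4) *
    ((2 * π * ε * Real.sin t : ℝ) : ℂ) ^ (-(n : ℂ) / 2) *
    ∫ y : Rn n, Complex.exp ((Complex.I / ((ε * Real.sin t : ℝ) : ℂ)) *
      (((‖x‖ ^ 2 + ‖y‖ ^ 2) / 2 * Real.cos t - ∑ j, x j * y j : ℝ) : ℂ)) * φ y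

/-- The WKB approximation operator V^ε(t) (for t ∈ (0,π/2) ∪ (π/2,π)). -/
def Vprop (n : ℕ) (ε t : ℝ) (φ : Rn n → ℂ) (x : Rn n) : ℂ :=
  if t < π / 2 then
    ((Real.cos t ^ (-(n : ℝ) / 2) : ℝ) : ℂ) * φ ((Real.cos t)⁻¹ • x) *
      Complex.exp (-Complex.I * ((‖x‖ ^ 2 * Real.tan t / (2 * ε) : ℝ) : ℂ))
  else
    Complex.exp (-Complex.I * (n : ℂ) * ((π / 2 : ℝ) : ℂ)) *
      ((|Real.cos t| ^ (-(n : ℝ) / 2) : ℝ) : ℂ) * φ ((Real.cos t)⁻¹ • x) *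
      Complex.exp (-Complex.I * ((‖x‖ ^ 2 * Real.tan t / (2 * ε) : ℝ) : ℂ))

/-- The Σ-norm ‖φ‖_Σ = ‖φ‖_{L²} + ‖|x|φ‖_{L²} + ‖∇φ‖_{L²}, with values in ℝ≥0∞. -/
def SigmaNorm {n : ℕ} (φ : Rn n → ℂ) : ℝ≥0∞ :=
  eLpNorm φ 2 volume + eLpNorm (fun x => (‖x‖ : ℂ) * φ x) 2 volume
    + eLpNorm (gradE φ) 2 volume

/-- The H¹-norm (‖φ‖_{L²}² + ‖∇φ‖_{L²}²)^{1/2}, with values in ℝ≥0∞. -/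
def H1norm {n : ℕ} (φ : Rn n → ℂ) : ℝ≥0∞ :=
  (eLpNorm φ 2 volume ^ (2 : ℝ) + eLpNorm (gradE φ) 2 volume ^ (2 : ℝ)) ^ ((1 : ℝ) / 2)

/-- The nonlinear WKB phase g(t,x) = −(|x|^{−γ}∗|f|²)(x) ∫₀ᵗ |cos τ|^{−γ} dτ. -/
def gphase {n : ℕ} (γ : ℝ) (f : Rn n → ℂ) (t : ℝ) (x : Rn n) : ℝ :=
  -(conv γ (fun y => Complex.normSq (f y)) x) * ∫ τ in (0 : ℝ)..t, |Real.cos τ| ^ (-γ)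

/-- The Fourier transform Fφ(ξ) = (2π)^{−n/2} ∫ e^{−ix·ξ} φ(x) dx. -/
def FT {n : ℕ} (φ : Rn n → ℂ) (ξ : Rn n) : ℂ :=
  (((2 * π : ℝ) ^ (-(n : ℝ) / 2) : ℝ) : ℂ) *
    ∫ x : Rn n, Complex.exp (-Complex.I * ((∑ j, x j * ξ j : ℝ) : ℂ)) * φ x

/-- The inverse Fourier transform. -/
def FTinv {n : ℕ} (φ : Rn n → ℂ) (ξ : Rn n) : ℂ :=
  (((2 * π : ℝ) ^ (-(n : ℝ) / 2) : ℝ) : ℂ) *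
    ∫ x : Rn n, Complex.exp (Complex.I * ((∑ j, x j * ξ j : ℝ) : ℂ)) * φ x

/-- Coordinate vector. -/
abbrev eb {n : ℕ} (j : Fin n) : Rn n := EuclideanSpace.single j 1

/-- Partial derivative. -/
def pd {n : ℕ} (j : Fin n) (φ : Rn n → ℂ) (x : Rn n) : ℂ := fderiv ℝ φ x (eb j)

/-- Real-valued L² norm. -/
def nL {n : ℕ} (g : Rn n → ℂ) : ℝ := (eLpNorm g 2 volume).toReal

section norms
variable {n : ℕ} {f g : Rn n → ℂ}

lemma nL_nonneg (g : Rn n → ℂ) : 0 ≤ nL g := ENNReal.toReal_nonneg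

lemma nL_ofReal (h : MemLp g 2 volume) : ENNReal.ofReal (nL g) = eLpNorm g 2 volume :=
  ENNReal.ofReal_toReal h.2.ne

lemma nL_le_of {c : ℝ} (hc : 0 ≤ c) (h : eLpNorm g 2 volume ≤ ENNReal.ofReal c) : nL g ≤ c :=
  ENNReal.toReal_le_of_le_ofReal hc h

lemma nL_sq_int (h : MemLp g 2 volume) : Integrable (fun x => ‖g x‖ ^ 2) volume :=
  (memLp_two_iff_integrable_sq_norm h.1).1 h

lemma nL_sq (h : MemLp g 2 volume) : nL g ^ 2 = ∫ x, ‖g x‖ ^ 2 := by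
  have h1 := h.eLpNorm_eq_integral_rpow_norm (by norm_num) (by norm_num)
  unfold nL
  rw [h1]
  have h0 : 0 ≤ ∫ x, ‖g x‖ ^ 2 := integral_nonneg fun x => by positivity
  simp only [ENNReal.toReal_ofNat, Real.rpow_two]
  rw [ENNReal.toReal_ofReal (by positivity), ← Real.rpow_natCast, ← Real.rpow_mul h0]
  norm_num

lemma nL_mul_int (hf : MemLp f 2 volume) (hg : MemLp g 2 volume) :
    Integrable (fun x => ‖f x‖ * ‖g x‖) volume :=
  MemLp.integrable_mul (p := 2) (q := 2) hf.norm hg.norm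

lemma nL_mul (hf : MemLp f 2 volume) (hg : MemLp g 2 volume) :
    ∫ x, ‖f x‖ * ‖g x‖ ≤ nL f * nL g := by
  have h := integral_mul_norm_le_Lp_mul_Lq (μ := volume) (f := f) (g := g)
    (p := 2) (q := 2) (by constructor <;> norm_num) (by simpa using hf) (by simpa using hg)
  refine h.trans (le_of_eq ?_)
  simp only [Real.rpow_two]
  rw [← nL_sq hf, ← nL_sq hg, ← Real.sqrt_eq_rpow, ← Real.sqrt_eq_rpow,
    Real.sqrt_sq (nL_nonneg _), Real.sqrt_sq (nL_nonneg _)]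

lemma nL_add_le (hf : MemLp f 2 volume) (hg : MemLp g 2 volume) :
    nL (fun x => f x + g x) ≤ nL f + nL g := by
  refine nL_le_of (add_nonneg (nL_nonneg _) (nL_nonneg _)) ?_
  rw [ENNReal.ofReal_add (nL_nonneg _) (nL_nonneg _), nL_ofReal hf, nL_ofReal hg]
  exact eLpNorm_add_le hf.1 hg.1 (by norm_num)

lemma nL_sub_le (hf : MemLp f 2 volume) (hg : MemLp g 2 volume) :
    nL (fun x => f x - g x) ≤ nL f + nL g := by
  refine nL_le_of (add_nonneg (nL_nonneg _) (nL_nonneg _)) ?_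
  rw [ENNReal.ofReal_add (nL_nonneg _) (nL_nonneg _), nL_ofReal hf, nL_ofReal hg]
  exact eLpNorm_sub_le hf.1 hg.1 (by norm_num)

lemma nL_const_mul (c : ℂ) : nL (fun x => c * g x) = ‖c‖ * nL g := by
  unfold nL
  have : eLpNorm (fun x => c * g x) 2 volume = ‖c‖ₑ * eLpNorm g 2 volume :=
    eLpNorm_const_smul c g 2 volume
  rw [this, ENNReal.toReal_mul]; simp

lemma nL_mono (hg : MemLp g 2 volume) (h : ∀ x, ‖f x‖ ≤ ‖g x‖) : nL f ≤ nL g :=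
  nL_le_of (nL_nonneg _) ((eLpNorm_mono h).trans (nL_ofReal hg).ge)

/-- Fatou. -/
lemma nL_fatou {f : ℕ → Rn n → ℂ} {g : Rn n → ℂ} {c : ℝ} (hc : 0 ≤ c)
    (hf : ∀ k, MemLp (f k) 2 volume) (hlim : ∀ x, Tendsto (fun k => f k x) atTop (𝓝 (g x)))
    (hb : ∃ᶠ k in atTop, nL (f k) ≤ c) : eLpNorm g 2 volume ≤ ENNReal.ofReal c := by
  refine (Lp.eLpNorm_lim_le_liminf_eLpNorm (fun k => (hf k).1) g (ae_of_all _ hlim)).trans ?_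
  refine liminf_le_of_frequently_le ?_
  refine hb.mono fun k hk => ?_
  rw [← nL_ofReal (hf k)]
  exact ENNReal.ofReal_le_ofReal hk

/-- Weak convergence: bounded in L² and pointwise convergent to zero. -/
lemma weak_lim {f : ℕ → Rn n → ℂ} {p : Rn n → ℂ} {M : ℝ}
    (hf : ∀ k, MemLp (f k) 2 volume) (hp : MemLp p 2 volume)
    (hlim : ∀ x, Tendsto (fun k => f k x) atTop (𝓝 0))
    (hb : ∀ k, nL (f k) ≤ M) :
    Tendsto (fun k => ∫ x, ‖f k x‖ * ‖p x‖) atTop (𝓝 0) := by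
  have key : ∀ L : ℝ, 0 < L → ∀ᶠ k in atTop, ∫ x, ‖f k x‖ * ‖p x‖ ≤ L⁻¹ + M ^ 2 / L := by
    intro L hL
    have hF : ∀ k, Integrable (fun x => min (‖f k x‖ * ‖p x‖) (L * ‖p x‖ ^ 2)) volume := by
      intro k
      exact (nL_mul_int (hf k) hp).inf ((nL_sq_int hp).const_mul L)
    have h1 : Tendsto (fun k => ∫ x, min (‖f k x‖ * ‖p x‖) (L * ‖p x‖ ^ 2)) atTop (𝓝 (∫ x : Rn n, (0:ℝ))) := by
      refine tendsto_integral_of_dominated_convergence (fun x => L * ‖p x‖ ^ 2)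
        (fun k => (hF k).1) ((nL_sq_int hp).const_mul L) ?_ ?_
      · intro k
        refine ae_of_all _ fun x => ?_
        rw [Real.norm_eq_abs, abs_of_nonneg (by positivity)]
        exact min_le_right _ _
      · refine ae_of_all _ fun x => ?_
        have h2 : Tendsto (fun k => ‖f k x‖ * ‖p x‖) atTop (𝓝 0) := by
          simpa using ((hlim x).norm).mul_const ‖p x‖
        refine squeeze_zero (fun k => by positivity) (fun k => min_le_left _ _) h2
    rw [integral_zero] at h1
    filter_upwards [h1.eventually (gt_mem_nhds (inv_pos.2 hL))] with k hk
    have h3 : ∫ x, ‖f k x‖ * ‖p x‖ ≤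
        ∫ x, (min (‖f k x‖ * ‖p x‖) (L * ‖p x‖ ^ 2) + L⁻¹ * ‖f k x‖ ^ 2) := by
      refine integral_mono (nL_mul_int (hf k) hp) ((hF k).add ((nL_sq_int (hf k)).const_mul _)) ?_
      intro x
      dsimp only
      rcases le_total (‖f k x‖) (L * ‖p x‖) with h | h
      · have : ‖f k x‖ * ‖p x‖ ≤ L * ‖p x‖ ^ 2 := by nlinarith [norm_nonneg (p x)]
        rw [min_eq_left this]
        have : 0 ≤ L⁻¹ * ‖f k x‖ ^ 2 := by positivity
        linarith
      · have h4 : ‖p x‖ ≤ L⁻¹ * ‖f k x‖ := by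
          rw [inv_mul_eq_div, le_div_iff₀ hL]; linarith
        have h5 : 0 ≤ min (‖f k x‖ * ‖p x‖) (L * ‖p x‖ ^ 2) := by positivity
        have : ‖f k x‖ * ‖p x‖ ≤ L⁻¹ * ‖f k x‖ ^ 2 := by nlinarith [norm_nonneg (f k x)]
        linarith
    rw [integral_add (hF k) ((nL_sq_int (hf k)).const_mul _), integral_const_mul, ← nL_sq (hf k)] at h3
    have h6 : nL (f k) ^ 2 ≤ M ^ 2 := pow_le_pow_left₀ (nL_nonneg _) (hb k) 2
    have h7 : L⁻¹ * nL (f k) ^ 2 ≤ M ^ 2 / L := by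
      rw [inv_mul_eq_div]; gcongr
    linarith
  rw [Metric.tendsto_atTop']
  intro e he
  have : ∃ L : ℝ, 0 < L ∧ L⁻¹ + M ^ 2 / L < e := by
    refine ⟨(2 + M ^ 2) / e, by positivity, ?_⟩
    have h0 : (0:ℝ) < 2 + M ^ 2 := by positivity
    have : ((2 + M ^ 2) / e)⁻¹ + M ^ 2 / ((2 + M ^ 2) / e) = e * ((1 + M ^ 2) / (2 + M ^ 2)) := by
      field_simp
    rw [this]
    have : (1 + M ^ 2) / (2 + M ^ 2) < 1 := by rw [div_lt_one h0]; linarith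
    nlinarith
  obtain ⟨L, hL, hLe⟩ := this
  obtain ⟨K, hK⟩ := (key L hL).exists_forall_of_atTop
  refine ⟨K, fun k hk => ?_⟩
  rw [Real.dist_eq, sub_zero, abs_of_nonneg (integral_nonneg fun x => by positivity)]
  exact (hK k hk.le).trans_lt hLe

end norms

/-- Gronwall in integral form. -/
lemma gron {L c0 c1 : ℝ → ℝ} {a b : ℝ} (hab : a ≤ b) (hL : ContinuousOn L (Set.Icc a b))
    (h0 : Continuous c0) (h1 : Continuous c1) (h0p : ∀ t, 0 ≤ c0 t) (h1p : ∀ t, 0 ≤ c1 t)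
    (h : ∀ t ∈ Set.Icc a b, L t ≤ L a + ∫ s in a..t, (c0 s + c1 s * L s)) :
    L b ≤ (L a + ∫ s in a..b, c0 s) * Real.exp (∫ s in a..b, c1 s) := by
  set M : ℝ → ℝ := Set.IccExtend hab (fun x : Set.Icc a b => L x) with hM
  have hMc : Continuous M := by
    rw [hM, continuous_IccExtend_iff]
    exact hL.domRestrict
  have hML : ∀ t ∈ Set.Icc a b, M t = L t := fun t ht => by
    rw [hM, Set.IccExtend_of_mem _ _ ht]
  have hcont : Continuous fun s => c0 s + c1 s * M s := by fun_prop
  set Y : ℝ → ℝ := fun t => L a + ∫ s in a..t, (c0 s + c1 s * M s) with hY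
  have hYd : ∀ t, HasDerivAt Y (c0 t + c1 t * M t) t := fun t =>
    (intervalIntegral.integral_hasDerivAt_right (hcont.intervalIntegrable _ _)
      (hcont.stronglyMeasurableAtFilter _ _) hcont.continuousAt).const_add _
  have hC1d : ∀ t, HasDerivAt (fun t => ∫ s in a..t, c1 s) (c1 t) t := fun t =>
    (intervalIntegral.integral_hasDerivAt_right (h1.intervalIntegrable _ _)
      (h1.stronglyMeasurableAtFilter _ _) h1.continuousAt)
  have hC0d : ∀ t, HasDerivAt (fun t => ∫ s in a..t, c0 s) (c0 t) t := fun t =>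
    (intervalIntegral.integral_hasDerivAt_right (h0.intervalIntegrable _ _)
      (h0.stronglyMeasurableAtFilter _ _) h0.continuousAt)
  have hLY : ∀ t ∈ Set.Icc a b, M t ≤ Y t := by
    intro t ht
    rw [hML t ht]
    refine (h t ht).trans (le_of_eq ?_)
    rw [hY]
    congr 1
    refine intervalIntegral.integral_congr fun s hs => ?_
    rw [Set.uIcc_of_le ht.1] at hs
    rw [hML s ⟨hs.1, hs.2.trans ht.2⟩]
  set Z : ℝ → ℝ := fun t => Y t * Real.exp (-∫ s in a..t, c1 s) - ∫ s in a..t, c0 s with hZ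
  have hZd : ∀ t, HasDerivAt Z ((c0 t + c1 t * M t) * Real.exp (-∫ s in a..t, c1 s) +
      Y t * (Real.exp (-∫ s in a..t, c1 s) * (-c1 t)) - c0 t) t := fun t =>
    ((hYd t).mul ((hC1d t).neg.exp)).sub (hC0d t)
  have hanti : AntitoneOn Z (Set.Icc a b) := by
    refine antitoneOn_of_deriv_nonpos (convex_Icc a b)
      (fun t _ => (hZd t).continuousAt.continuousWithinAt)
      (fun t _ => (hZd t).differentiableAt.differentiableWithinAt) ?_
    intro t ht
    rw [interior_Icc] at ht
    have ht' : t ∈ Set.Icc a b := Set.Ioo_subset_Icc_self ht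
    rw [(hZd t).deriv]
    have e1 : Real.exp (-∫ s in a..t, c1 s) ≤ 1 := by
      rw [Real.exp_le_one_iff]
      have : 0 ≤ ∫ s in a..t, c1 s := intervalIntegral.integral_nonneg ht'.1 fun s _ => h1p s
      linarith
    have e0 := Real.exp_pos (-∫ s in a..t, c1 s)
    set e := Real.exp (-∫ s in a..t, c1 s)
    have : c1 t * M t ≤ c1 t * Y t := mul_le_mul_of_nonneg_left (hLY t ht') (h1p t)
    nlinarith [h0p t]
  have hfin := hanti (Set.left_mem_Icc.2 hab) (Set.right_mem_Icc.2 hab) hab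
  simp only [hZ, hY, intervalIntegral.integral_same, neg_zero, Real.exp_zero, mul_one, add_zero,
    sub_zero] at hfin
  have hb := hLY b (Set.right_mem_Icc.2 hab)
  rw [hML b (Set.right_mem_Icc.2 hab)] at hb
  refine hb.trans ?_
  rw [Real.exp_neg] at hfin
  have e0 := Real.exp_pos (∫ s in a..b, c1 s)
  have : Y b * (Real.exp (∫ s in a..b, c1 s))⁻¹ ≤ L a + ∫ s in a..b, c0 s := by linarith
  rwa [← div_eq_mul_inv, div_le_iff₀ e0] at this

/-- Scalar lemma: square root of a function with derivative controlled. -/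
lemma sqrt_growth {y y' g : ℝ → ℝ} {η κ s t : ℝ} (hκ : 0 < κ) (hη : 0 ≤ η) (hst : s ≤ t)
    (hy0 : ∀ τ, 0 ≤ y τ) (hg : Continuous g) (hgp : ∀ τ, 0 ≤ g τ)
    (hy : ∀ τ ∈ Set.Icc s t, HasDerivAt y (y' τ) τ)
    (hb : ∀ τ ∈ Set.Icc s t, |y' τ| ≤ η + 2 * Real.sqrt (y τ) * g τ) :
    |Real.sqrt (y t + κ) - Real.sqrt (y s + κ)| ≤ (t - s) * (η / (2 * Real.sqrt κ)) +
      ∫ τ in s..t, g τ := by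
  have hd : ∀ τ ∈ Set.Icc s t, HasDerivAt (fun τ => Real.sqrt (y τ + κ))
      (y' τ / (2 * Real.sqrt (y τ + κ))) τ := fun τ hτ =>
    ((hy τ hτ).add_const κ).sqrt (by have := hy0 τ; positivity)
  have hGd : ∀ τ, HasDerivAt (fun τ => (τ - s) * (η / (2 * Real.sqrt κ)) + ∫ r in s..τ, g r)
      (η / (2 * Real.sqrt κ) + g τ) τ := fun τ => by
    have h1 := ((hasDerivAt_id τ).sub_const s).mul_const (η / (2 * Real.sqrt κ))
    have h2 := intervalIntegral.integral_hasDerivAt_right (hg.intervalIntegrable s τ)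
      (hg.stronglyMeasurableAtFilter _ _) hg.continuousAt
    have h3 := h1.add h2
    rw [one_mul] at h3
    exact h3
  have hk := Real.sqrt_pos.2 hκ
  have := image_norm_le_of_norm_deriv_right_le_deriv_boundary (a := s) (b := t)
    (f := fun τ => Real.sqrt (y τ + κ) - Real.sqrt (y s + κ))
    (f' := fun τ => y' τ / (2 * Real.sqrt (y τ + κ)))
    (B := fun τ => (τ - s) * (η / (2 * Real.sqrt κ)) + ∫ r in s..τ, g r)
    (B' := fun τ => η / (2 * Real.sqrt κ) + g τ)
    (fun τ hτ => ((hd τ hτ).continuousAt.sub continuousAt_const).continuousWithinAt)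
    (fun τ hτ => ((hd τ (Set.Ico_subset_Icc_self hτ)).sub_const _).hasDerivWithinAt)
    (by simp) hGd ?_
  · simpa using this (Set.right_mem_Icc.2 hst)
  · intro τ hτ
    have h1 := hb τ (Set.Ico_subset_Icc_self hτ)
    have hyk : Real.sqrt κ ≤ Real.sqrt (y τ + κ) := Real.sqrt_le_sqrt (by linarith [hy0 τ])
    have hyy : Real.sqrt (y τ) ≤ Real.sqrt (y τ + κ) := Real.sqrt_le_sqrt (by linarith)
    have hpos : 0 < Real.sqrt (y τ + κ) := hk.trans_le hyk
    rw [norm_div, Real.norm_eq_abs, Real.norm_eq_abs, abs_of_pos (by positivity : 0 < 2 * Real.sqrt (y τ + κ)),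
      div_le_iff₀ (by positivity)]
    have h2 : η ≤ η / (2 * Real.sqrt κ) * (2 * Real.sqrt (y τ + κ)) := by
      rw [div_mul_eq_mul_div, le_div_iff₀ (by positivity)]
      nlinarith
    nlinarith [hgp τ]


/-- Time derivative. -/
def dt {n : ℕ} (z : ℝ → Rn n → ℂ) (t : ℝ) (x : Rn n) : ℂ := deriv (fun s => z s x) t

/-- Joint smoothness. -/
def JS {n : ℕ} (z : ℝ → Rn n → ℂ) : Prop :=
  ContDiff ℝ (⊤ : ℕ∞) (fun p : ℝ × Rn n => z p.1 p.2)

lemma cutoff (n : ℕ) : ∃ C : ℝ, 0 ≤ C ∧ ∃ χ : ℕ → Rn n → ℝ, ∀ k : ℕ,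
    ContDiff ℝ (⊤ : ℕ∞) (χ k) ∧ HasCompactSupport (χ k) ∧ (∀ x, 0 ≤ χ k x ∧ χ k x ≤ 1) ∧
    (∀ x v, ‖fderiv ℝ (χ k) x v‖ ≤ C / (k + 1) * ‖v‖) ∧ (∀ x, ‖x‖ ≤ k + 1 → χ k x = 1) := by
  let b : ContDiffBump (0 : Rn n) := ⟨1, 2, by norm_num, by norm_num⟩
  have hb : ContDiff ℝ (⊤ : ℕ∞) (b : Rn n → ℝ) := b.contDiff
  obtain ⟨C, hC⟩ := (b.hasCompactSupport.fderiv (𝕜 := ℝ)).exists_bound_of_continuous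
    (hb.continuous_fderiv (by simp))
  refine ⟨C, (norm_nonneg _).trans (hC 0), fun k x => b (((k : ℝ) + 1)⁻¹ • x), fun k => ?_⟩
  have hk : (0 : ℝ) < (k : ℝ) + 1 := by positivity
  have hs : ContDiff ℝ (⊤ : ℕ∞) (fun x : Rn n => ((k : ℝ) + 1)⁻¹ • x) := contDiff_const_smul _
  refine ⟨hb.comp hs, ?_, fun x => ⟨b.nonneg, b.le_one⟩, ?_, ?_⟩
  · exact b.hasCompactSupport.comp_homeomorph (Homeomorph.smulOfNeZero ((k : ℝ) + 1)⁻¹ (by positivity))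
  · intro x v
    have h1 : HasFDerivAt (fun x : Rn n => ((k : ℝ) + 1)⁻¹ • x)
        (((k : ℝ) + 1)⁻¹ • ContinuousLinearMap.id ℝ (Rn n)) x :=
      (hasFDerivAt_id x).fun_const_smul _
    have h2 : HasFDerivAt (b : Rn n → ℝ) (fderiv ℝ (b : Rn n → ℝ) (((k : ℝ) + 1)⁻¹ • x))
        (((k : ℝ) + 1)⁻¹ • x) := (hb.differentiable (by simp) _).hasFDerivAt
    have h3 := h2.comp x h1
    have h4 : fderiv ℝ (fun x : Rn n => b (((k : ℝ) + 1)⁻¹ • x)) x = _ := h3.fderiv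
    rw [h4]
    simp only [ContinuousLinearMap.comp_apply, smul_apply,
      ContinuousLinearMap.id_apply, map_smul, norm_smul, norm_inv, Real.norm_eq_abs (_ + _),
      abs_of_pos hk]
    have h5 := (fderiv ℝ (b : Rn n → ℝ) (((k : ℝ) + 1)⁻¹ • x)).le_opNorm v
    have h6 := hC (((k : ℝ) + 1)⁻¹ • x)
    calc _ ≤ ((k : ℝ) + 1)⁻¹ * (C * ‖v‖) := by
          gcongr
          exact h5.trans (by gcongr)
      _ = _ := by field_simp
  · intro x hx
    apply b.one_of_mem_closedBall
    simp only [mem_closedBall_zero_iff, norm_smul, norm_inv, Real.norm_eq_abs, abs_of_pos hk]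
    rw [inv_mul_le_iff₀ hk]
    simpa [b] using hx

section js
variable {n : ℕ} {z w : ℝ → Rn n → ℂ}

lemma JS.cont (h : JS z) : Continuous (fun p : ℝ × Rn n => z p.1 p.2) := ContDiff.continuous h

lemma JS.slice (h : JS z) (t : ℝ) : ContDiff ℝ (⊤ : ℕ∞) (z t) :=
  ContDiff.comp (g := fun p : ℝ × Rn n => z p.1 p.2) h (contDiff_const.prodMk contDiff_id)

lemma JS.tslice (h : JS z) (x : Rn n) : ContDiff ℝ (⊤ : ℕ∞) (fun t => z t x) :=
  ContDiff.comp (g := fun p : ℝ × Rn n => z p.1 p.2) h (contDiff_id.prodMk contDiff_const)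

lemma JS.hasDerivAt (h : JS z) (t : ℝ) (x : Rn n) :
    HasDerivAt (fun s => z s x) (dt z t x) t :=
  ((h.tslice x).differentiable (by simp) t).hasDerivAt

lemma JS.dt_eq (h : JS z) (t : ℝ) (x : Rn n) :
    dt z t x = fderiv ℝ (fun p : ℝ × Rn n => z p.1 p.2) (t, x) (1, 0) := by
  have h1 : HasFDerivAt (fun p : ℝ × Rn n => z p.1 p.2)
      (fderiv ℝ (fun p : ℝ × Rn n => z p.1 p.2) (t, x)) (t, x) :=
    (h.differentiable (by simp) _).hasFDerivAt
  have h2 : HasDerivAt (fun s : ℝ => (s, x)) ((1 : ℝ), (0 : Rn n)) t :=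
    (hasDerivAt_id t).prodMk (hasDerivAt_const t x)
  exact (h1.comp_hasDerivAt t h2).deriv

lemma JS.dt (h : JS z) : JS (dt z) := by
  have h1 : ContDiff ℝ (⊤ : ℕ∞) (fun p : ℝ × Rn n =>
      fderiv ℝ (fun p : ℝ × Rn n => z p.1 p.2) p (1, 0)) :=
    (h.fderiv_right (m := (⊤ : ℕ∞)) (by simp)).clm_apply contDiff_const
  unfold JS
  convert h1 using 2 with p
  exact h.dt_eq _ _

lemma JS.sub (h : JS z) (h' : JS w) : JS (fun t x => z t x - w t x) := ContDiff.sub h h'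

lemma dt_sub (h : JS z) (h' : JS w) (t : ℝ) (x : Rn n) :
    _root_.dt (fun t x => z t x - w t x) t x = _root_.dt z t x - _root_.dt w t x :=
  ((h.hasDerivAt t x).sub (h'.hasDerivAt t x)).deriv

end js

/-- Differentiation under the integral with a compactly supported weight. -/
lemma deriv_cut {n : ℕ} {χ : Rn n → ℝ} (hχ : Continuous χ) (hχc : HasCompactSupport χ)
    {F F' : ℝ → Rn n → ℝ} (hF : Continuous fun p : ℝ × Rn n => F p.1 p.2)
    (hF' : Continuous fun p : ℝ × Rn n => F' p.1 p.2)
    (hd : ∀ t x, HasDerivAt (fun s => F s x) (F' t x) t) (t : ℝ) :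
    HasDerivAt (fun s => ∫ x, χ x * F s x) (∫ x, χ x * F' t x) t := by
  have hFt : ∀ s, Continuous (F s) := fun s => hF.comp (by fun_prop : Continuous fun x : Rn n => (s, x))
  have hFt' : ∀ s, Continuous (F' s) := fun s => hF'.comp (by fun_prop : Continuous fun x : Rn n => (s, x))
  obtain ⟨B, hB⟩ := ((isCompact_Icc (a := t - 1) (b := t + 1)).prod hχc).exists_bound_of_continuousOn
    hF'.continuousOn
  refine (hasDerivAt_integral_of_dominated_loc_of_deriv_le (μ := volume) (s := Set.Icc (t - 1) (t + 1))
    (F := fun s x => χ x * F s x) (F' := fun s x => χ x * F' s x) (bound := fun x => ‖χ x‖ * B)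
    (Icc_mem_nhds (by linarith) (by linarith)) ?_ ?_ ?_ ?_ ?_ ?_).2
  · exact Eventually.of_forall fun s => (hχ.mul (hFt s)).aestronglyMeasurable
  · exact (hχ.mul (hFt t)).integrable_of_hasCompactSupport hχc.mul_right
  · exact (hχ.mul (hFt' t)).aestronglyMeasurable
  · refine ae_of_all _ fun x s hs => ?_
    rw [norm_mul]
    by_cases hx : x ∈ tsupport χ
    · gcongr
      exact hB (s, x) ⟨hs, hx⟩
    · rw [image_eq_zero_of_notMem_tsupport hx]; simp
  · exact (hχ.norm.mul continuous_const).integrable_of_hasCompactSupport hχc.norm.mul_right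
  · exact ae_of_all _ fun x s _ => (hd s x).const_mul _


lemma pd_smooth {n : ℕ} {φ : Rn n → ℂ} (h : ContDiff ℝ (⊤ : ℕ∞) φ) (j : Fin n) :
    ContDiff ℝ (⊤ : ℕ∞) (pd j φ) :=
  (h.fderiv_right (m := (⊤ : ℕ∞)) (by simp)).clm_apply contDiff_const

lemma lap_eq {n : ℕ} (φ : Rn n → ℂ) (x : Rn n) : lap φ x = ∑ j, pd j (pd j φ) x := rfl

/-- Spatial integration by parts with cutoff. -/
lemma cut_ibp {n : ℕ} {χ : Rn n → ℝ} (hχ : ContDiff ℝ (⊤ : ℕ∞) χ) (hχc : HasCompactSupport χ)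
    {φ : Rn n → ℂ} (h : ContDiff ℝ (⊤ : ℕ∞) φ) (j : Fin n) :
    ∫ x, χ x ^ 2 * (conj (φ x) * pd j (pd j φ) x).im =
      - ∫ x, 2 * χ x * fderiv ℝ χ x (eb j) * (conj (φ x) * pd j φ x).im := by
  set F : Rn n → ℂ := fun x => ((χ x ^ 2 : ℝ) : ℂ) * conj (φ x) with hF
  have hFs : ContDiff ℝ (⊤ : ℕ∞) F := by
    have h1 : ContDiff ℝ (⊤ : ℕ∞) (fun x => ((χ x ^ 2 : ℝ) : ℂ)) :=
      Complex.ofRealCLM.contDiff.comp (hχ.pow 2)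
    have h2 : ContDiff ℝ (⊤ : ℕ∞) (fun x => conj (φ x)) := Complex.conjCLE.contDiff.comp h
    exact h1.mul h2
  have hFc : HasCompactSupport F := by
    refine HasCompactSupport.mul_right ?_
    exact hχc.comp_left (g := fun r : ℝ => ((r ^ 2 : ℝ) : ℂ)) (by simp)
  have hp := pd_smooth h j
  have hpp := pd_smooth hp j
  have hF' : ∀ x, fderiv ℝ F x (eb j) = ((2 * χ x * fderiv ℝ χ x (eb j) : ℝ) : ℂ) * conj (φ x)
      + ((χ x ^ 2 : ℝ) : ℂ) * conj (pd j φ x) := by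
    intro x
    have e1 : HasFDerivAt χ (fderiv ℝ χ x) x := (hχ.differentiable (by simp) x).hasFDerivAt
    have e2 : HasFDerivAt φ (fderiv ℝ φ x) x := (h.differentiable (by simp) x).hasFDerivAt
    have e3 : HasFDerivAt (fun x => ((χ x ^ 2 : ℝ) : ℂ)) _ x :=
      Complex.ofRealCLM.hasFDerivAt.comp x (e1.pow 2)
    have e4 : HasFDerivAt (fun x => conj (φ x)) _ x :=
      (Complex.conjCLE : ℂ ≃L[ℝ] ℂ).hasFDerivAt.comp x e2
    have e5 : fderiv ℝ F x = _ := (e3.mul e4).fderiv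
    rw [e5]
    simp [pd]
    ring
  have hI : ∀ {f g : Rn n → ℂ}, Continuous f → Continuous g → HasCompactSupport f →
      Integrable (fun x => f x * g x) volume := fun hf hg hc =>
    (hf.mul hg).integrable_of_hasCompactSupport hc.mul_right
  have hFd : Continuous fun x => fderiv ℝ F x (eb j) :=
    ((hFs.continuous_fderiv (by simp))).clm_apply continuous_const
  have key : ∫ x, F x * pd j (pd j φ) x = - ∫ x, fderiv ℝ F x (eb j) * pd j φ x :=
    integral_mul_fderiv_eq_neg_fderiv_mul_of_integrable (μ := volume) (𝕜 := ℂ) (f := F)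
    (g := pd j φ) (v := eb j)
    (hI hFd hp.continuous (hFc.fderiv_apply (𝕜 := ℝ) _))
    (hI hFs.continuous hpp.continuous hFc)
    (hI hFs.continuous hp.continuous hFc)
    (fun x _ => hFs.differentiable (by simp) x) (fun x _ => hp.differentiable (by simp) x)
  have k2 := congrArg Complex.im key
  rw [Complex.neg_im] at k2
  have im_int : ∀ {f : Rn n → ℂ}, Integrable f volume → (∫ x, f x).im = ∫ x, (f x).im :=
    fun hf => (integral_im hf).symm
  rw [im_int (hI hFs.continuous hpp.continuous hFc),
    im_int (hI hFd hp.continuous (hFc.fderiv_apply (𝕜 := ℝ) _))] at k2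
  convert k2 using 2
  · ext x
    rw [hF, mul_assoc, Complex.im_ofReal_mul]
  · congr 1
    ext x
    rw [hF', add_mul, Complex.add_im, mul_assoc (Complex.ofReal _), Complex.im_ofReal_mul,
      mul_assoc (Complex.ofReal _), Complex.im_ofReal_mul]
    have : (conj (pd j φ x) * pd j φ x).im = 0 := by
      rw [mul_comm, Complex.mul_conj]; exact Complex.ofReal_im _
    rw [this]; ring

set_option maxHeartbeats 1000000 in
/-- The L² growth lemma. -/
lemma l2_diff {n : ℕ} {z : ℝ → Rn n → ℂ} (hz : JS z) {ε a b M : ℝ} (hε : 0 < ε)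
    {P : ℝ → Rn n → ℝ} {G : ℝ → Rn n → ℂ} {g : ℝ → ℝ}
    (heq : ∀ t ∈ Set.Icc a b, ∀ x, Complex.I * (ε : ℂ) * dt z t x
      + ((ε ^ 2 / 2 : ℝ) : ℂ) * lap (z t) x = (P t x : ℂ) * z t x + G t x)
    (hzL : ∀ t ∈ Set.Icc a b, MemLp (z t) 2 volume)
    (hdz : ∀ t ∈ Set.Icc a b, ∀ j, MemLp (pd j (z t)) 2 volume)
    (hzM : ∀ t ∈ Set.Icc a b, nL (z t) ≤ M) (hdM : ∀ t ∈ Set.Icc a b, ∀ j, nL (pd j (z t)) ≤ M)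
    (hGL : ∀ t ∈ Set.Icc a b, MemLp (G t) 2 volume) (hg : Continuous g) (hgp : ∀ t, 0 ≤ g t)
    (hGg : ∀ t ∈ Set.Icc a b, nL (G t) ≤ g t) {s t : ℝ} (has : a ≤ s) (hst : s ≤ t) (htb : t ≤ b) :
    |nL (z t) - nL (z s)| ≤ ε⁻¹ * ∫ τ in s..t, g τ := by
  obtain ⟨C, hC, χ, hχ⟩ := cutoff n
  have hsub : ∀ τ ∈ Set.Icc s t, τ ∈ Set.Icc a b := fun τ hτ => ⟨has.trans hτ.1, hτ.2.trans htb⟩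
  have hsI : s ∈ Set.Icc s t := ⟨le_rfl, hst⟩
  have htI : t ∈ Set.Icc s t := ⟨hst, le_rfl⟩
  have hM : 0 ≤ M := (nL_nonneg _).trans (hzM s (hsub s hsI))
  set y : ℕ → ℝ → ℝ := fun k τ => ∫ x, χ k x ^ 2 * ‖z τ x‖ ^ 2 with hy
  have hχz : ∀ k, ∀ τ ∈ Set.Icc s t, MemLp (fun x => (χ k x : ℂ) * z τ x) 2 volume := by
    intro k τ hτ
    refine (hzL τ (hsub τ hτ)).mono ?_ (ae_of_all _ fun x => ?_)
    · exact ((Complex.continuous_ofReal.comp (hχ k).1.continuous).mul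
        (hz.slice τ).continuous).aestronglyMeasurable
    · rw [norm_mul, Complex.norm_real, Real.norm_eq_abs, abs_of_nonneg ((hχ k).2.2.1 x).1]
      exact mul_le_of_le_one_left (norm_nonneg _) ((hχ k).2.2.1 x).2
  have hynL : ∀ k, ∀ τ ∈ Set.Icc s t, y k τ = nL (fun x => (χ k x : ℂ) * z τ x) ^ 2 := by
    intro k τ hτ
    rw [nL_sq (hχz k τ hτ)]
    refine integral_congr_ae (ae_of_all _ fun x => ?_)
    simp [mul_pow]
  have hy0 : ∀ k τ, 0 ≤ y k τ := fun k τ => integral_nonneg fun x => by positivity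
  have hcF : Continuous (fun p : ℝ × Rn n => ‖z p.1 p.2‖ ^ 2) := by
    have := hz.cont
    fun_prop
  have hcF' : Continuous (fun p : ℝ × Rn n => 2 * (conj (z p.1 p.2) * dt z p.1 p.2).re) := by
    have h1 := hz.cont
    have h2 := hz.dt.cont
    fun_prop
  have hdF : ∀ τ x, HasDerivAt (fun τ => ‖z τ x‖ ^ 2) (2 * (conj (z τ x) * dt z τ x).re) τ := by
    intro τ x
    have := (hz.hasDerivAt τ x).norm_sq
    convert this using 1
    rw [Complex.inner, mul_comm (dt z τ x)]
  have hccs : ∀ k, HasCompactSupport (fun x => χ k x ^ 2) := fun k =>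
    (hχ k).2.1.comp_left (g := fun r : ℝ => r ^ 2) (by simp)
  have hcq : ∀ k, Continuous (fun x => χ k x ^ 2) := fun k => (hχ k).1.continuous.pow 2
  have hyd : ∀ k τ, HasDerivAt (y k)
      (∫ x, χ k x ^ 2 * (2 * (conj (z τ x) * dt z τ x).re)) τ := by
    intro k τ
    have := deriv_cut (χ := fun x => χ k x ^ 2) (hcq k) (hccs k)
      (F := fun τ x => ‖z τ x‖ ^ 2) (F' := fun τ x => 2 * (conj (z τ x) * dt z τ x).re)
      hcF hcF' hdF τ
    exact this
  have hpt : ∀ τ ∈ Set.Icc s t, ∀ x, 2 * (conj (z τ x) * dt z τ x).re =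
      -ε * (∑ j, (conj (z τ x) * pd j (pd j (z τ)) x).im) + 2 / ε * (conj (z τ x) * G τ x).im := by
    intro τ hτ x
    have h1 := heq τ (hsub τ hτ) x
    rw [lap_eq] at h1
    set L := ∑ j, pd j (pd j (z τ)) x with hL
    have h2 : (conj (z τ x) * (Complex.I * (ε : ℂ) * dt z τ x + ((ε ^ 2 / 2 : ℝ) : ℂ) * L)).im =
      (conj (z τ x) * ((P τ x : ℂ) * z τ x + G τ x)).im := by rw [h1]
    have h3 : ∑ j, (conj (z τ x) * pd j (pd j (z τ)) x).im = (conj (z τ x) * L).im := by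
      rw [hL, Finset.mul_sum, Complex.im_sum]
    rw [h3]
    have h4 : ε * (conj (z τ x) * dt z τ x).re + ε ^ 2 / 2 * (conj (z τ x) * L).im
        = (conj (z τ x) * G τ x).im := by
      simp only [Complex.mul_im, Complex.mul_re, Complex.add_im, Complex.add_re, Complex.I_re,
        Complex.I_im, Complex.ofReal_re, Complex.ofReal_im, Complex.conj_re, Complex.conj_im] at h2 ⊢
      linear_combination h2
    field_simp
    linear_combination 2 * h4
  have hbd : ∀ k, ∀ τ ∈ Set.Icc s t, |∫ x, χ k x ^ 2 * (2 * (conj (z τ x) * dt z τ x).re)| ≤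
      (ε * (n * (2 * (C / (k + 1)) * M ^ 2))) + 2 * Real.sqrt (y k τ) * (ε⁻¹ * g τ) := by
    intro k τ hτ
    have hτ' := hsub τ hτ
    have hzc := (hz.slice τ).continuous
    have hχk := (hχ k).1.continuous
    have hcc : HasCompactSupport (fun x => χ k x ^ 2) :=
      (hχ k).2.1.comp_left (g := fun r : ℝ => r ^ 2) (by simp)
    have i1 : ∀ j, Integrable (fun x => χ k x ^ 2 * (conj (z τ x) * pd j (pd j (z τ)) x).im)
        volume := by
      intro j
      refine Continuous.integrable_of_hasCompactSupport ?_ hcc.mul_right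
      exact (hχk.pow 2).mul (Complex.continuous_im.comp ((Complex.continuous_conj.comp hzc).mul
        (pd_smooth (pd_smooth (hz.slice τ) j) j).continuous))
    have iG0 : Integrable (fun x => ‖(χ k x : ℂ) * z τ x‖ * ‖G τ x‖) volume :=
      nL_mul_int (hχz k τ hτ) (hGL τ hτ')
    have bG : ∀ x, ‖χ k x ^ 2 * (conj (z τ x) * G τ x).im‖ ≤ ‖(χ k x : ℂ) * z τ x‖ * ‖G τ x‖ := by
      intro x
      have c0 := ((hχ k).2.2.1 x).1
      have c1 := ((hχ k).2.2.1 x).2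
      rw [norm_mul, norm_mul, Complex.norm_real, norm_pow, Real.norm_eq_abs, Real.norm_eq_abs,
        abs_of_nonneg c0]
      have h1 : |(conj (z τ x) * G τ x).im| ≤ ‖z τ x‖ * ‖G τ x‖ := by
        refine (Complex.abs_im_le_norm _).trans ?_
        rw [norm_mul, Complex.norm_conj]
      have h2 : χ k x ^ 2 ≤ χ k x := by nlinarith
      calc _ ≤ χ k x * (‖z τ x‖ * ‖G τ x‖) := by gcongr
        _ = _ := by ring
    have mG : AEStronglyMeasurable (fun x => χ k x ^ 2 * (conj (z τ x) * G τ x).im) volume := by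
      refine (hχk.pow 2).aestronglyMeasurable.mul ?_
      exact Complex.continuous_im.comp_aestronglyMeasurable
        ((Complex.continuous_conj.comp hzc).aestronglyMeasurable.mul (hGL τ hτ').1)
    have iG : Integrable (fun x => χ k x ^ 2 * (conj (z τ x) * G τ x).im) volume :=
      iG0.mono' mG (ae_of_all _ bG)
    have hsplit : ∫ x, χ k x ^ 2 * (2 * (conj (z τ x) * dt z τ x).re) =
        -ε * (∑ j, ∫ x, χ k x ^ 2 * (conj (z τ x) * pd j (pd j (z τ)) x).im)
          + 2 / ε * ∫ x, χ k x ^ 2 * (conj (z τ x) * G τ x).im := by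
      rw [← integral_finsetSum _ fun j _ => i1 j, ← integral_const_mul, ← integral_const_mul,
        ← integral_add ((integrable_finsetSum _ fun j _ => i1 j).const_mul _) (iG.const_mul _)]
      refine integral_congr_ae (ae_of_all _ fun x => ?_)
      simp only
      rw [hpt τ hτ x, ← Finset.mul_sum]
      ring
    rw [hsplit]
    have hflux : ∀ j, |∫ x, χ k x ^ 2 * (conj (z τ x) * pd j (pd j (z τ)) x).im| ≤
        2 * (C / (k + 1)) * M ^ 2 := by
      intro j
      rw [cut_ibp (hχ k).1 (hχ k).2.1 (hz.slice τ) j, abs_neg]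
      have i2 : Integrable (fun x => 2 * (C / (k + 1)) * (‖z τ x‖ * ‖pd j (z τ) x‖)) volume :=
        (nL_mul_int (hzL τ hτ') (hdz τ hτ' j)).const_mul _
      rw [← Real.norm_eq_abs]
      refine (norm_integral_le_of_norm_le i2 (ae_of_all _ fun x => ?_)).trans ?_
      · have c0 := ((hχ k).2.2.1 x).1
        have c1 := ((hχ k).2.2.1 x).2
        have c2 := (hχ k).2.2.2.1 x (eb j)
        rw [EuclideanSpace.norm_single, norm_one, mul_one] at c2
        have h1 : |(conj (z τ x) * pd j (z τ) x).im| ≤ ‖z τ x‖ * ‖pd j (z τ) x‖ := by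
          refine (Complex.abs_im_le_norm _).trans ?_
          rw [norm_mul, Complex.norm_conj]
        rw [norm_mul, norm_mul, norm_mul, Real.norm_eq_abs (Complex.im _), Real.norm_eq_abs (χ k x),
          abs_of_nonneg c0, Real.norm_eq_abs 2, abs_two]
        have h2 : 2 * χ k x * ‖fderiv ℝ (χ k) x (eb j)‖ ≤ 2 * (C / (k + 1)) := by
          have := mul_le_mul c1 c2 (norm_nonneg _) zero_le_one
          linarith
        gcongr
      · rw [integral_const_mul]
        have := nL_mul (hzL τ hτ') (hdz τ hτ' j)
        have h2 : nL (z τ) * nL (pd j (z τ)) ≤ M ^ 2 := by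
          rw [sq]
          exact mul_le_mul (hzM τ hτ') (hdM τ hτ' j) (nL_nonneg _) hM
        gcongr
        exact this.trans h2
    have hGb : |∫ x, χ k x ^ 2 * (conj (z τ x) * G τ x).im| ≤ Real.sqrt (y k τ) * g τ := by
      rw [← Real.norm_eq_abs]
      refine (norm_integral_le_of_norm_le iG0 (ae_of_all _ bG)).trans ?_
      refine (nL_mul (hχz k τ hτ) (hGL τ hτ')).trans ?_
      rw [hynL k τ hτ, Real.sqrt_sq (nL_nonneg _)]
      exact mul_le_mul_of_nonneg_left (hGg τ hτ') (nL_nonneg _)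
    refine (abs_add_le _ _).trans (add_le_add ?_ ?_)
    · rw [abs_mul, abs_neg, abs_of_pos hε]
      refine mul_le_mul_of_nonneg_left ?_ hε.le
      refine (Finset.abs_sum_le_sum_abs _ _).trans ?_
      refine (Finset.sum_le_sum fun j _ => hflux j).trans (le_of_eq ?_)
      simp
    · rw [abs_mul, abs_of_pos (by positivity : 0 < 2 / ε)]
      calc _ ≤ 2 / ε * (Real.sqrt (y k τ) * g τ) := by gcongr
        _ = _ := by ring
  -- apply scalar lemma
  have hg' : Continuous fun τ => ε⁻¹ * g τ := continuous_const.mul hg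
  have step : ∀ κ : ℝ, 0 < κ → ∀ k : ℕ, |Real.sqrt (y k t + κ) - Real.sqrt (y k s + κ)| ≤
      (t - s) * ((ε * (n * (2 * (C / (k + 1)) * M ^ 2))) / (2 * Real.sqrt κ)) + ∫ τ in s..t, ε⁻¹ * g τ :=
    fun κ hκ k => sqrt_growth hκ (by positivity) hst (hy0 k) hg'
      (fun τ => mul_nonneg (inv_nonneg.2 hε.le) (hgp τ)) (fun τ _ => hyd k τ) (hbd k)
  have hylim : ∀ τ ∈ Set.Icc s t, Tendsto (fun k => y k τ) atTop (𝓝 (nL (z τ) ^ 2)) := by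
    intro τ hτ
    have hτ' := hsub τ hτ
    rw [nL_sq (hzL τ hτ')]
    refine tendsto_integral_of_dominated_convergence (fun x => ‖z τ x‖ ^ 2) ?_ (nL_sq_int (hzL τ hτ'))
      ?_ ?_
    · exact fun k => (((hχ k).1.continuous.pow 2).mul
        ((hz.slice τ).continuous.norm.pow 2)).aestronglyMeasurable
    · refine fun k => ae_of_all _ fun x => ?_
      have c0 := ((hχ k).2.2.1 x).1
      have c1 := ((hχ k).2.2.1 x).2
      rw [Real.norm_eq_abs, abs_of_nonneg (by positivity)]
      exact mul_le_of_le_one_left (by positivity) (pow_le_one₀ c0 c1)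
    · refine ae_of_all _ fun x => ?_
      refine tendsto_const_nhds.congr' ?_
      obtain ⟨K, hK⟩ := exists_nat_ge ‖x‖
      filter_upwards [eventually_ge_atTop K] with k hk
      rw [(hχ k).2.2.2.2 x (hK.trans (by have : (K : ℝ) ≤ k := by exact_mod_cast hk
                                         linarith))]
      simp
  have step2 : ∀ κ : ℝ, 0 < κ → |Real.sqrt (nL (z t) ^ 2 + κ) - Real.sqrt (nL (z s) ^ 2 + κ)| ≤
      ∫ τ in s..t, ε⁻¹ * g τ := by
    intro κ hκ
    have l1 := ((((hylim t htI).add_const κ).sqrt).sub (((hylim s hsI).add_const κ).sqrt)).abs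
    have l0 : Tendsto (fun k : ℕ => C / ((k : ℝ) + 1)) atTop (𝓝 0) :=
      tendsto_const_div_atTop_nhds_zero_nat C |>.comp (tendsto_add_atTop_nat 1) |>.congr fun k => by simp
    have l2 : Tendsto (fun k : ℕ => (t - s) * ((ε * (n * (2 * (C / (k + 1)) * M ^ 2))) / (2 * Real.sqrt κ))
        + ∫ τ in s..t, ε⁻¹ * g τ) atTop (𝓝 ((t - s) * ((ε * (n * (2 * 0 * M ^ 2))) / (2 * Real.sqrt κ))
        + ∫ τ in s..t, ε⁻¹ * g τ)) :=
      (((((l0.const_mul 2).mul_const _).const_mul _).const_mul _).div_const _ |>.const_mul _).add_const _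
    have := le_of_tendsto_of_tendsto' l1 l2 (step κ hκ)
    simpa using this
  rw [← intervalIntegral.integral_const_mul]
  have l3 : Tendsto (fun κ : ℝ => |Real.sqrt (nL (z t) ^ 2 + κ) - Real.sqrt (nL (z s) ^ 2 + κ)|)
      (𝓝[>] 0) (𝓝 |Real.sqrt (nL (z t) ^ 2 + 0) - Real.sqrt (nL (z s) ^ 2 + 0)|) := by
    refine (Continuous.tendsto ?_ 0).mono_left nhdsWithin_le_nhds
    fun_prop
  have := le_of_tendsto l3 (eventually_nhdsWithin_of_forall fun κ hκ => step2 κ hκ)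
  simpa [Real.sqrt_sq (nL_nonneg _)] using this

/-- Gronwall form, forward in time. -/
lemma l2_gron {n : ℕ} {z : ℝ → Rn n → ℂ} (hz : JS z) {ε a b M : ℝ} (hε : 0 < ε)
    {P : ℝ → Rn n → ℝ} {G : ℝ → Rn n → ℂ} {c0 c1 : ℝ → ℝ}
    (heq : ∀ t ∈ Set.Icc a b, ∀ x, Complex.I * (ε : ℂ) * dt z t x
      + ((ε ^ 2 / 2 : ℝ) : ℂ) * lap (z t) x = (P t x : ℂ) * z t x + G t x)
    (hzL : ∀ t ∈ Set.Icc a b, MemLp (z t) 2 volume)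
    (hdz : ∀ t ∈ Set.Icc a b, ∀ j, MemLp (pd j (z t)) 2 volume)
    (hzM : ∀ t ∈ Set.Icc a b, nL (z t) ≤ M) (hdM : ∀ t ∈ Set.Icc a b, ∀ j, nL (pd j (z t)) ≤ M)
    (hGL : ∀ t ∈ Set.Icc a b, MemLp (G t) 2 volume) (h0 : Continuous c0) (h0p : ∀ t, 0 ≤ c0 t)
    (h1 : Continuous c1) (h1p : ∀ t, 0 ≤ c1 t)
    (hGg : ∀ t ∈ Set.Icc a b, nL (G t) ≤ c0 t + c1 t * nL (z t)) {s t : ℝ} (hs : s ∈ Set.Icc a b)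
    (ht : t ∈ Set.Icc a b) :
    nL (z t) ≤ (nL (z s) + ε⁻¹ * |∫ τ in s..t, c0 τ|) * Real.exp (ε⁻¹ * |∫ τ in s..t, c1 τ|) := by
  have hab : a ≤ b := hs.1.trans hs.2
  -- step 1: continuity
  have hcont : ContinuousOn (fun τ => nL (z τ)) (Set.Icc a b) := by
    set g : ℝ → ℝ := fun τ => c0 τ + c1 τ * |M| with hg
    have hgc : Continuous g := h0.add (h1.mul continuous_const)
    have hgp : ∀ τ, 0 ≤ g τ := fun τ => add_nonneg (h0p τ) (mul_nonneg (h1p τ) (abs_nonneg _))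
    obtain ⟨K, hK⟩ := (isCompact_Icc (a := a) (b := b)).exists_bound_of_continuousOn hgc.continuousOn
    have hK' : ∀ τ ∈ Set.Icc a b, g τ ≤ K := fun τ hτ => (le_abs_self _).trans (hK τ hτ)
    have hK0 : 0 ≤ K := (hgp a).trans (hK' a ⟨le_rfl, hab⟩)
    have main : ∀ s ∈ Set.Icc a b, ∀ t ∈ Set.Icc a b, s ≤ t → |nL (z t) - nL (z s)| ≤ ε⁻¹ * (K * (t - s)) := by
      intro s hs t ht hst
      refine (l2_diff hz hε heq hzL hdz hzM hdM hGL (g := fun _ => K) continuous_const (fun _ => hK0)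
        (fun τ hτ => ?_) hs.1 hst ht.2).trans (le_of_eq ?_)
      · refine ((hGg τ hτ).trans ?_).trans (hK' τ hτ)
        have := (hzM τ hτ).trans (le_abs_self M)
        have := mul_le_mul_of_nonneg_left this (h1p τ)
        simp only [hg]; linarith
      · rw [intervalIntegral.integral_const, smul_eq_mul]; ring
    have : LipschitzOnWith (Real.toNNReal (ε⁻¹ * K)) (fun τ => nL (z τ)) (Set.Icc a b) := by
      refine LipschitzOnWith.of_dist_le_mul fun x hx y hy => ?_
      rw [Real.coe_toNNReal _ (by positivity), Real.dist_eq, Real.dist_eq]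
      rcases le_total x y with h | h
      · rw [abs_sub_comm, abs_sub_comm x y, abs_of_nonneg (sub_nonneg.2 h), mul_assoc]
        exact main x hx y hy h
      · rw [abs_of_nonneg (sub_nonneg.2 h), mul_assoc]
        exact main y hy x hx h
    exact this.continuousOn
  set L : ℝ → ℝ := Set.IccExtend hab (fun x : Set.Icc a b => nL (z x)) with hLdef
  have hLc : Continuous L := by
    rw [hLdef, continuous_IccExtend_iff]
    exact hcont.domRestrict
  have hLe : ∀ τ ∈ Set.Icc a b, L τ = nL (z τ) := fun τ hτ => Set.IccExtend_of_mem _ _ hτ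
  have hL0 : ∀ τ, 0 ≤ L τ := fun τ => nL_nonneg _
  have hgc : Continuous fun τ => c0 τ + c1 τ * L τ := h0.add (h1.mul hLc)
  have main : ∀ s ∈ Set.Icc a b, ∀ t ∈ Set.Icc a b, s ≤ t →
      |L t - L s| ≤ ∫ τ in s..t, (ε⁻¹ * c0 τ + ε⁻¹ * c1 τ * L τ) := by
    intro s hs t ht hst
    rw [hLe t ht, hLe s hs]
    refine (l2_diff hz hε heq hzL hdz hzM hdM hGL hgc
      (fun τ => add_nonneg (h0p τ) (mul_nonneg (h1p τ) (hL0 τ))) (fun τ hτ => ?_)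
      hs.1 hst ht.2).trans (le_of_eq ?_)
    · rw [hLe τ hτ]; exact hGg τ hτ
    · rw [← intervalIntegral.integral_const_mul]; congr 1; ext τ; ring
  have hε' : 0 < ε⁻¹ := inv_pos.2 hε
  rcases le_total s t with hst | hst
  · have := gron (L := L) (c0 := fun τ => ε⁻¹ * c0 τ) (c1 := fun τ => ε⁻¹ * c1 τ) hst hLc.continuousOn
      (continuous_const.mul h0) (continuous_const.mul h1) (fun τ => mul_nonneg hε'.le (h0p τ))
      (fun τ => mul_nonneg hε'.le (h1p τ)) (fun τ hτ => by
        have := main s hs τ ⟨hs.1.trans hτ.1, hτ.2.trans ht.2⟩ hτ.1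
        linarith [le_abs_self (L τ - L s)])
    rw [hLe t ht, hLe s hs, intervalIntegral.integral_const_mul, intervalIntegral.integral_const_mul] at this
    rwa [abs_of_nonneg (intervalIntegral.integral_nonneg hst fun τ _ => h0p τ),
      abs_of_nonneg (intervalIntegral.integral_nonneg hst fun τ _ => h1p τ)]
  · have := gron (L := fun τ => L (-τ)) (c0 := fun τ => ε⁻¹ * c0 (-τ)) (c1 := fun τ => ε⁻¹ * c1 (-τ))
      (a := -s) (b := -t) (neg_le_neg hst) (hLc.comp continuous_neg).continuousOn
      (continuous_const.mul (h0.comp continuous_neg)) (continuous_const.mul (h1.comp continuous_neg))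
      (fun τ => mul_nonneg hε'.le (h0p _))
      (fun τ => mul_nonneg hε'.le (h1p _)) (fun τ hτ => by
        have h3 := main (-τ) ⟨by linarith [hτ.2, ht.1], by linarith [hτ.1, hs.2]⟩ s hs (by linarith [hτ.1])
        have h4 := intervalIntegral.integral_comp_neg (a := -s) (b := τ)
          (fun τ => ε⁻¹ * c0 τ + ε⁻¹ * c1 τ * L τ)
        rw [neg_neg] at h4 ⊢
        rw [h4]
        linarith [neg_abs_le (L s - L (-τ))])
    rw [neg_neg, neg_neg, hLe t ht, hLe s hs, intervalIntegral.integral_const_mul,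
      intervalIntegral.integral_const_mul, intervalIntegral.integral_comp_neg,
      intervalIntegral.integral_comp_neg, neg_neg, neg_neg] at this
    rwa [intervalIntegral.integral_symm t s, intervalIntegral.integral_symm t s, abs_neg, abs_neg,
      abs_of_nonneg (intervalIntegral.integral_nonneg hst fun τ _ => h0p τ),
      abs_of_nonneg (intervalIntegral.integral_nonneg hst fun τ _ => h1p τ)]


/-- Smooth functions in `H¹`. -/
structure H1 {n : ℕ} (φ : Rn n → ℂ) : Prop where
  sm : ContDiff ℝ (⊤ : ℕ∞) φ
  l2 : MemLp φ 2 volume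
  d2 : ∀ j, MemLp (pd j φ) 2 volume

/-- Being a Schwartz function. -/
def Sch {n : ℕ} (φ : Rn n → ℂ) : Prop := ∃ ψ : SchwartzMap (Rn n) ℂ, φ = ⇑ψ

section sch
variable {n : ℕ} {φ ψ : Rn n → ℂ}

lemma Sch.memLp (h : Sch φ) : MemLp φ 2 volume := by
  obtain ⟨f, rfl⟩ := h
  exact f.memLp 2

lemma Sch.pd (h : Sch φ) (j : Fin n) : Sch (pd j φ) := by
  obtain ⟨f, rfl⟩ := h
  exact ⟨LineDeriv.lineDerivOp (eb j) f, by
    ext x; exact (SchwartzMap.lineDerivOp_apply_eq_fderiv (eb j) f x).symm⟩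

lemma Sch.h1 (h : Sch φ) : H1 φ where
  sm := by obtain ⟨f, rfl⟩ := h; exact f.smooth _
  l2 := h.memLp
  d2 j := (h.pd j).memLp

lemma Sch.sub (h : Sch φ) (h' : Sch ψ) : Sch (fun x => φ x - ψ x) := by
  obtain ⟨f, rfl⟩ := h
  obtain ⟨g, rfl⟩ := h'
  exact ⟨f - g, rfl⟩

lemma Sch.const_mul (h : Sch φ) (c : ℂ) : Sch (fun x => c * φ x) := by
  obtain ⟨f, rfl⟩ := h
  exact ⟨c • f, rfl⟩

lemma Sch.add (h : Sch φ) (h' : Sch ψ) : Sch (fun x => φ x + ψ x) := by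
  obtain ⟨f, rfl⟩ := h
  obtain ⟨g, rfl⟩ := h'
  exact ⟨f + g, rfl⟩

lemma Sch.coord (h : Sch φ) (j : Fin n) : Sch (fun x => ((x j : ℝ) : ℂ) * φ x) := by
  obtain ⟨f, rfl⟩ := h
  have hg : Function.HasTemperateGrowth (fun x : Rn n => ((x j : ℝ) : ℂ)) :=
    (Complex.ofRealCLM ∘L (EuclideanSpace.proj j : Rn n →L[ℝ] ℝ)).hasTemperateGrowth
  exact ⟨SchwartzMap.smulLeftCLM ℂ (fun x : Rn n => ((x j : ℝ) : ℂ)) f, by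
    ext x; rw [SchwartzMap.smulLeftCLM_apply_apply hg]; rfl⟩

lemma pd_sub (h : ContDiff ℝ (⊤ : ℕ∞) φ) (h' : ContDiff ℝ (⊤ : ℕ∞) ψ) (j : Fin n) :
    _root_.pd j (fun x => φ x - ψ x) = fun x => _root_.pd j φ x - _root_.pd j ψ x := by
  ext x
  unfold _root_.pd
  rw [fderiv_fun_sub (h.differentiable (by simp) x) (h'.differentiable (by simp) x)]
  rfl

lemma lap_sub (h : ContDiff ℝ (⊤ : ℕ∞) φ) (h' : ContDiff ℝ (⊤ : ℕ∞) ψ) (x : Rn n) :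
    lap (fun x => φ x - ψ x) x = lap φ x - lap ψ x := by
  rw [lap_eq, lap_eq, lap_eq, ← Finset.sum_sub_distrib]
  refine Finset.sum_congr rfl fun j _ => ?_
  rw [pd_sub h h', pd_sub (pd_smooth h j) (pd_smooth h' j)]

lemma H1.sub (h : H1 φ) (h' : H1 ψ) : H1 (fun x => φ x - ψ x) where
  sm := h.sm.sub h'.sm
  l2 := h.l2.sub h'.l2
  d2 j := by rw [pd_sub h.sm h'.sm]; exact (h.d2 j).sub (h'.d2 j)

lemma H1.pd_sub_le (h : H1 φ) (h' : H1 ψ) (j : Fin n) :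
    nL (_root_.pd j (fun x => φ x - ψ x)) ≤ nL (_root_.pd j φ) + nL (_root_.pd j ψ) := by
  rw [pd_sub h.sm h'.sm]; exact nL_sub_le (h.d2 j) (h'.d2 j)

end sch

/-- Coulomb kernel. -/
def KK {n : ℕ} (x y : Rn n) : ℝ≥0∞ := ENNReal.ofReal (‖x - y‖⁻¹)

/-- Hardy-type bound. -/
def HB {n : ℕ} (φ : Rn n → ℂ) (v : ℝ) : Prop :=
  ∀ x, ∫⁻ y, KK x y * ‖φ y‖ₑ ^ 2 ≤ ENNReal.ofReal v

lemma KK_symm {n : ℕ} (x y : Rn n) : KK x y = KK y x := by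
  unfold KK; rw [norm_sub_rev]

lemma KK_meas {n : ℕ} : Measurable (fun p : Rn n × Rn n => KK p.1 p.2) := by
  unfold KK; fun_prop

lemma HB.mono {n : ℕ} {φ : Rn n → ℂ} {v w : ℝ} (h : HB φ v) (hvw : v ≤ w) : HB φ w :=
  fun x => (h x).trans (ENNReal.ofReal_le_ofReal hvw)

lemma enorm_sq_ofReal (z : ℂ) : ‖z‖ₑ ^ 2 = ENNReal.ofReal (‖z‖ ^ 2) := by
  rw [ENNReal.ofReal_pow (norm_nonneg _), ofReal_norm]

/-- Hardy inequality. -/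
lemma hardy {n : ℕ} (hn : 2 ≤ n) {φ : Rn n → ℂ} (h : H1 φ) :
    HB φ (∑ j, 2 * ∫ y, |(conj (φ y) * pd j φ y).re|) := by
  intro x
  set B := ∑ j, 2 * ∫ y, |(conj (φ y) * pd j φ y).re| with hB
  have hdn : ∀ y (j : Fin n), HasFDerivAt (fun y => ‖φ y‖ ^ 2) (2 • (innerSL ℝ (φ y)).comp (fderiv ℝ φ y)) y :=
    fun y j => (h.sm.differentiable (by simp) y).hasFDerivAt.norm_sq
  have hdn' : ∀ y (j : Fin n), fderiv ℝ (fun y => ‖φ y‖ ^ 2) y (eb j) = 2 * (conj (φ y) * pd j φ y).re := by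
    intro y j
    rw [(hdn y j).fderiv]
    simp [pd, Complex.inner, mul_comm]
    ring
  have hint1 : Integrable (fun y => ‖φ y‖ ^ 2) volume := nL_sq_int h.l2
  have hint2 : ∀ j, Integrable (fun y => (conj (φ y) * pd j φ y).re) volume := by
    intro j
    refine (nL_mul_int h.l2 (h.d2 j)).mono' ?_ (ae_of_all _ fun y => ?_)
    · have := h.sm.continuous
      have := (pd_smooth h.sm j).continuous
      exact (by fun_prop : Continuous fun y => (conj (φ y) * pd j φ y).re).aestronglyMeasurable
    · refine (Complex.abs_re_le_norm _).trans ?_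
      rw [norm_mul, Complex.norm_conj]
  -- regularized estimate
  have reg : ∀ η : ℝ, 0 < η → ∫ y, (Real.sqrt (‖y - x‖ ^ 2 + η))⁻¹ * ‖φ y‖ ^ 2 ≤ B := by
    intro η hη
    set s : Rn n → ℝ := fun y => Real.sqrt (‖y - x‖ ^ 2 + η) with hs
    have hs0 : ∀ y, 0 < s y := fun y => Real.sqrt_pos.2 (by positivity)
    have hs2 : ∀ y, s y ^ 2 = ‖y - x‖ ^ 2 + η := fun y => Real.sq_sqrt (by positivity)
    have hsη : ∀ y, Real.sqrt η ≤ s y := fun y => Real.sqrt_le_sqrt (by nlinarith [norm_nonneg (y - x)])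
    have hη' := Real.sqrt_pos.2 hη
    have hcoord : ∀ y (j : Fin n), |(y - x) j| ≤ s y := by
      intro y j
      refine Real.abs_le_sqrt ?_
      have h1 := PiLp.norm_apply_le (y - x) j
      have h2 : ((y - x) j) ^ 2 ≤ ‖y - x‖ ^ 2 := by
        rw [← sq_abs]; exact pow_le_pow_left₀ (abs_nonneg _) h1 2
      linarith
    set X : Fin n → Rn n → ℝ := fun j y => (y - x) j * (s y)⁻¹ with hX
    have hsc : Continuous s := by fun_prop
    have hsic : Continuous fun y => (s y)⁻¹ := hsc.inv₀ fun y => (hs0 y).ne'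
    have hsd : ∀ y, HasFDerivAt s ((1 / (2 * s y)) • (2 • (innerSL ℝ (y - x)))) y := by
      intro y
      have h1 : HasFDerivAt (fun y : Rn n => ‖y - x‖ ^ 2 + η) (2 • (innerSL ℝ (y - x))) y := by
        have := ((hasFDerivAt_id (𝕜 := ℝ) y).sub_const x).norm_sq.add_const η
        simpa using this
      exact h1.sqrt (by positivity)
    have hXd : ∀ j y, HasFDerivAt (X j) ((y - x) j • (-(s y ^ 2)⁻¹ • ((1 / (2 * s y)) • (2 • (innerSL ℝ (y - x)))))
        + (s y)⁻¹ • (EuclideanSpace.proj j : Rn n →L[ℝ] ℝ)) y := by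
      intro j y
      have h1 : HasFDerivAt (fun y : Rn n => (y - x) j) (EuclideanSpace.proj j : Rn n →L[ℝ] ℝ) y :=
        (EuclideanSpace.proj j : Rn n →L[ℝ] ℝ).hasFDerivAt.comp y ((hasFDerivAt_id y).sub_const x)
      have h2 := (hasDerivAt_inv (hs0 y).ne').comp_hasFDerivAt y (hsd y)
      exact h1.mul h2
    have hXd' : ∀ j y, fderiv ℝ (X j) y (eb j) = (s y)⁻¹ - ((y - x) j) ^ 2 * (s y ^ 3)⁻¹ := by
      intro j y
      rw [(hXd j y).fderiv]
      have := (hs0 y).ne'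
      simp [EuclideanSpace.inner_single_right]
      field_simp
      ring
    have hXc : ∀ j, Continuous (X j) := fun j => by
      exact (by fun_prop : Continuous fun y : Rn n => (y - x) j).mul hsic
    have hXb : ∀ j y, |X j y| ≤ 1 := by
      intro j y
      rw [hX]; simp only
      rw [abs_mul, abs_of_pos (inv_pos.2 (hs0 y)), ← div_eq_mul_inv, div_le_one (hs0 y)]
      exact hcoord y j
    have hX'c : ∀ j, Continuous (fun y => fderiv ℝ (X j) y (eb j)) := fun j => by
      simp_rw [hXd']
      have : Continuous fun y => (s y ^ 3)⁻¹ := (hsc.pow 3).inv₀ fun y => (pow_pos (hs0 y) 3).ne'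
      exact hsic.sub ((by fun_prop : Continuous fun y : Rn n => ((y - x) j) ^ 2).mul this)
    have hX'b : ∀ j y, |fderiv ℝ (X j) y (eb j)| ≤ (Real.sqrt η)⁻¹ := by
      intro j y
      rw [hXd']
      have h1 : ((y - x) j) ^ 2 ≤ s y ^ 2 := by
        rw [← sq_abs]; exact pow_le_pow_left₀ (abs_nonneg _) (hcoord y j) 2
      have h2 : ((y - x) j) ^ 2 * (s y ^ 3)⁻¹ ≤ (s y)⁻¹ := by
        have := hs0 y
        rw [← div_eq_mul_inv, div_le_iff₀ (by positivity)]
        field_simp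
        exact h1
      have h3 : 0 ≤ ((y - x) j) ^ 2 * (s y ^ 3)⁻¹ := by have := hs0 y; positivity
      rw [abs_of_nonneg (by linarith)]
      have : (s y)⁻¹ ≤ (Real.sqrt η)⁻¹ := inv_anti₀ hη' (hsη y)
      linarith
    have i1 : ∀ j, Integrable (fun y => fderiv ℝ (X j) y (eb j) * ‖φ y‖ ^ 2) volume := fun j =>
      hint1.bdd_mul (hX'c j).aestronglyMeasurable (c := (Real.sqrt η)⁻¹) (ae_of_all _ (hX'b j))
    have i2 : ∀ j, Integrable (fun y => X j y * (2 * (conj (φ y) * pd j φ y).re)) volume := fun j =>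
      ((hint2 j).const_mul 2).bdd_mul (hXc j).aestronglyMeasurable (c := 1) (ae_of_all _ (hXb j))
    have i3 : ∀ j, Integrable (fun y => X j y * ‖φ y‖ ^ 2) volume := fun j =>
      hint1.bdd_mul (hXc j).aestronglyMeasurable (c := 1) (ae_of_all _ (hXb j))
    have i0 : Integrable (fun y => (s y)⁻¹ * ‖φ y‖ ^ 2) volume :=
      hint1.bdd_mul hsic.aestronglyMeasurable (c := (Real.sqrt η)⁻¹) (ae_of_all _ fun y => by
        rw [Real.norm_eq_abs, abs_of_pos (inv_pos.2 (hs0 y))]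
        exact inv_anti₀ hη' (hsη y))
    have ibp : ∀ j, ∫ y, fderiv ℝ (X j) y (eb j) * ‖φ y‖ ^ 2 ≤ 2 * ∫ y, |(conj (φ y) * pd j φ y).re| := by
      intro j
      have := integral_mul_fderiv_eq_neg_fderiv_mul_of_integrable (μ := volume) (𝕜 := ℝ) (f := X j)
        (g := fun y => ‖φ y‖ ^ 2) (v := eb j) (i1 j) (by simp_rw [hdn' _ j]; exact i2 j) (i3 j)
        (fun y _ => (hXd j y).differentiableAt) (fun y _ => (hdn y j).differentiableAt)
      have h4 : ∫ y, fderiv ℝ (X j) y (eb j) * ‖φ y‖ ^ 2 = - ∫ y, X j y * (2 * (conj (φ y) * pd j φ y).re) := by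
        simp_rw [hdn' _ j] at this
        rw [this, neg_neg]
      rw [h4, ← integral_neg, ← integral_const_mul]
      refine integral_mono (i2 j).neg ((hint2 j).abs.const_mul 2) fun y => ?_
      simp only
      refine (neg_le_abs _).trans ?_
      rw [abs_mul (X j y), abs_mul 2, abs_two]
      exact mul_le_of_le_one_left (by positivity) (hXb j y)
    calc ∫ y, (s y)⁻¹ * ‖φ y‖ ^ 2 ≤ ∫ y, ∑ j, fderiv ℝ (X j) y (eb j) * ‖φ y‖ ^ 2 := by
          refine integral_mono i0 (integrable_finsetSum _ fun j _ => i1 j) fun y => ?_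
          simp only
          rw [← Finset.sum_mul]
          refine mul_le_mul_of_nonneg_right ?_ (by positivity)
          simp_rw [hXd']
          rw [Finset.sum_sub_distrib, ← Finset.sum_mul]
          have h5 : ∑ j, ((y - x) j) ^ 2 = ‖y - x‖ ^ 2 := by
            rw [EuclideanSpace.norm_sq_eq]; simp
          rw [h5]
          simp only [Finset.sum_const, Finset.card_univ, Fintype.card_fin, nsmul_eq_mul]
          have hp := hs0 y
          have h6 : ‖y - x‖ ^ 2 * (s y ^ 3)⁻¹ ≤ (s y)⁻¹ := by
            rw [← div_eq_mul_inv, div_le_iff₀ (by positivity)]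
            field_simp
            rw [hs2]; linarith
          have h7 : (2 : ℝ) ≤ n := by exact_mod_cast hn
          have h8 : 0 < (s y)⁻¹ := inv_pos.2 hp
          nlinarith
      _ = ∑ j, ∫ y, fderiv ℝ (X j) y (eb j) * ‖φ y‖ ^ 2 := integral_finsetSum _ fun j _ => i1 j
      _ ≤ B := Finset.sum_le_sum fun j _ => ibp j
  -- Fatou
  set F : ℕ → Rn n → ℝ≥0∞ := fun k y =>
    ENNReal.ofReal ((Real.sqrt (‖y - x‖ ^ 2 + 1 / ((k : ℝ) + 1)))⁻¹ * ‖φ y‖ ^ 2) with hF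
  have hcφ := h.sm.continuous
  have hFm : ∀ k, Measurable (F k) := fun k => by
    have : Measurable fun y => ‖φ y‖ ^ 2 := (hcφ.norm.pow 2).measurable
    have h2 : Measurable fun y : Rn n => Real.sqrt (‖y - x‖ ^ 2 + 1 / ((k : ℝ) + 1)) := by fun_prop
    exact ENNReal.measurable_ofReal.comp (h2.inv.mul this)
  have hFB : ∀ k, ∫⁻ y, F k y ≤ ENNReal.ofReal B := by
    intro k
    have hk : (0 : ℝ) < 1 / ((k : ℝ) + 1) := by positivity
    have hci : Continuous fun y : Rn n => (Real.sqrt (‖y - x‖ ^ 2 + 1 / ((k : ℝ) + 1)))⁻¹ :=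
      Continuous.inv₀ (by fun_prop) fun y => (Real.sqrt_pos.2 (by positivity)).ne'
    have hi : Integrable (fun y => (Real.sqrt (‖y - x‖ ^ 2 + 1 / ((k : ℝ) + 1)))⁻¹ * ‖φ y‖ ^ 2) volume :=
      hint1.bdd_mul hci.aestronglyMeasurable (c := (Real.sqrt (1 / ((k : ℝ) + 1)))⁻¹)
        (ae_of_all _ fun y => by
          rw [Real.norm_eq_abs, abs_of_nonneg (by positivity)]
          exact inv_anti₀ (Real.sqrt_pos.2 hk) (Real.sqrt_le_sqrt (by nlinarith [norm_nonneg (y - x)])))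
    rw [← ofReal_integral_eq_lintegral_ofReal hi (ae_of_all _ fun y => by positivity)]
    exact ENNReal.ofReal_le_ofReal (reg _ hk)
  calc ∫⁻ y, KK x y * ‖φ y‖ₑ ^ 2 ≤ ∫⁻ y, liminf (fun k => F k y) atTop := by
        refine lintegral_mono fun y => ?_
        unfold KK
        rw [enorm_sq_ofReal, ← ENNReal.ofReal_mul (by positivity), norm_sub_rev]
        by_cases hy : ‖y - x‖ = 0
        · rw [hy]; simp
        · have : Tendsto (fun k => F k y) atTop (𝓝 (ENNReal.ofReal (‖y - x‖⁻¹ * ‖φ y‖ ^ 2))) := by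
            refine ENNReal.tendsto_ofReal (Tendsto.mul_const _ (Tendsto.inv₀ ?_ hy))
            have h9 := ((tendsto_one_div_add_atTop_nhds_zero_nat (𝕜 := ℝ)).const_add (‖y - x‖ ^ 2)).sqrt
            rwa [add_zero, Real.sqrt_sq (norm_nonneg _)] at h9
          rw [this.liminf_eq]
    _ ≤ liminf (fun k => ∫⁻ y, F k y) atTop := lintegral_liminf_le hFm
    _ ≤ ENNReal.ofReal B := liminf_le_of_frequently_le (Frequently.of_forall hFB)

lemma hardy' {n : ℕ} (hn : 2 ≤ n) {φ : Rn n → ℂ} (h : H1 φ) :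
    HB φ (∑ j, 2 * (nL φ * nL (pd j φ))) := by
  refine (hardy hn h).mono (Finset.sum_le_sum fun j _ => ?_)
  refine mul_le_mul_of_nonneg_left ?_ (by norm_num)
  refine (integral_mono_of_nonneg (ae_of_all _ fun y => abs_nonneg _) (nL_mul_int h.l2 (h.d2 j))
    (ae_of_all _ fun y => ?_)).trans (nL_mul h.l2 (h.d2 j))
  refine (Complex.abs_re_le_norm _).trans ?_
  rw [norm_mul, Complex.norm_conj]


section kern
variable {n : ℕ} {φ ψ w : Rn n → ℂ} {v : ℝ}

lemma KK_meas_left (x : Rn n) : Measurable (KK x) := by unfold KK; fun_prop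

lemma csK (x : Rn n) {f g : Rn n → ℝ≥0∞} (hf : Measurable f) (hg : Measurable g) :
    (∫⁻ y, KK x y * (f y * g y)) ^ 2 ≤ (∫⁻ y, KK x y * f y ^ 2) * ∫⁻ y, KK x y * g y ^ 2 := by
  have hK := KK_meas_left x
  have e : ∀ F : Rn n → ℝ≥0∞, Measurable F → ∫⁻ y, KK x y * F y = ∫⁻ y, F y ∂(volume.withDensity (KK x)) :=
    fun F hF => (lintegral_withDensity_eq_lintegral_mul _ hK hF).symm
  have q1 : Measurable fun y => f y * g y := hf.mul hg
  have q2 : Measurable fun y => f y ^ 2 := hf.pow_const 2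
  have q3 : Measurable fun y => g y ^ 2 := hg.pow_const 2
  rw [e _ q1, e _ q2, e _ q3]
  have := ENNReal.lintegral_mul_le_Lp_mul_Lq (volume.withDensity (KK x)) (p := 2) (q := 2)
    (by constructor <;> norm_num) hf.aemeasurable hg.aemeasurable
  refine (pow_le_pow_left₀ (zero_le) this 2).trans (le_of_eq ?_)
  simp only [ENNReal.rpow_two]
  rw [mul_pow, ← ENNReal.rpow_natCast, ← ENNReal.rpow_natCast, ← ENNReal.rpow_mul, ← ENNReal.rpow_mul]
  norm_num

lemma enorm_meas (h : Continuous φ) : Measurable (fun y => ‖φ y‖ₑ) := h.measurable.enorm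

lemma hartree_kern (φ : Rn n → ℂ) (x y : Rn n) :
    ENNReal.ofReal (‖x - y‖ ^ (-1 : ℝ) * Complex.normSq (φ y)) = KK x y * ‖φ y‖ₑ ^ 2 := by
  rw [Real.rpow_neg_one, Complex.normSq_eq_norm_sq, ENNReal.ofReal_mul (by positivity), enorm_sq_ofReal, KK]

lemma hartree_int (hc : Continuous φ) (hB : HB φ v) (x : Rn n) :
    Integrable (fun y => ‖x - y‖ ^ (-1 : ℝ) * Complex.normSq (φ y)) volume := by
  have hm : Measurable (fun y => ‖x - y‖ ^ (-1 : ℝ) * Complex.normSq (φ y)) := by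
    have : Measurable fun y => Complex.normSq (φ y) := (Complex.continuous_normSq.comp hc).measurable
    fun_prop
  refine ⟨hm.aestronglyMeasurable, ?_⟩
  rw [hasFiniteIntegral_iff_ofReal (ae_of_all _ fun y => mul_nonneg (by positivity) (Complex.normSq_nonneg _))]
  simp_rw [hartree_kern]
  exact (hB x).trans_lt ENNReal.ofReal_lt_top

lemma hartree_nonneg (φ : Rn n → ℂ) (x : Rn n) : 0 ≤ hartree 1 φ x :=
  integral_nonneg fun y => mul_nonneg (by positivity) (Complex.normSq_nonneg _)

lemma hartree_ofReal (hc : Continuous φ) (hB : HB φ v) (x : Rn n) :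
    ENNReal.ofReal (hartree 1 φ x) = ∫⁻ y, KK x y * ‖φ y‖ₑ ^ 2 := by
  unfold hartree conv
  rw [ofReal_integral_eq_lintegral_ofReal (hartree_int hc hB x)
    (ae_of_all _ fun y => mul_nonneg (by positivity) (Complex.normSq_nonneg _))]
  simp_rw [hartree_kern]

lemma hartree_le (hc : Continuous φ) (hB : HB φ v) (hv : 0 ≤ v) (x : Rn n) : hartree 1 φ x ≤ v := by
  have := hB x
  rw [← hartree_ofReal hc hB] at this
  exact (ENNReal.ofReal_le_ofReal_iff hv).1 this

lemma lint_meas (hc : Continuous φ) : Measurable (fun x => ∫⁻ y, KK x y * ‖φ y‖ₑ ^ 2) := by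
  refine Measurable.lintegral_prod_right' (f := fun p : Rn n × Rn n => KK p.1 p.2 * ‖φ p.2‖ₑ ^ 2) ?_
  exact KK_meas.mul (((enorm_meas hc).comp measurable_snd).pow_const 2)

lemma hartree_meas (hc : Continuous φ) (hB : HB φ v) : Measurable (hartree 1 φ) := by
  have : hartree 1 φ = fun x => (∫⁻ y, KK x y * ‖φ y‖ₑ ^ 2).toReal := by
    ext x
    rw [← hartree_ofReal hc hB, ENNReal.toReal_ofReal (hartree_nonneg _ _)]
  rw [this]
  exact (lint_meas hc).ennreal_toReal

/-- Schur-type double integral. -/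
lemma schur (hφ : Continuous φ) (hw : Continuous w) (hB : HB w v) :
    ∫⁻ x, ‖w x‖ₑ ^ 2 * ∫⁻ y, KK x y * ‖φ y‖ₑ ^ 2 ≤ ENNReal.ofReal v * ∫⁻ y, ‖φ y‖ₑ ^ 2 := by
  have hm1 := (enorm_meas hφ).pow_const 2
  have hm2 := (enorm_meas hw).pow_const 2
  calc ∫⁻ x, ‖w x‖ₑ ^ 2 * ∫⁻ y, KK x y * ‖φ y‖ₑ ^ 2
      = ∫⁻ x, ∫⁻ y, ‖w x‖ₑ ^ 2 * (KK x y * ‖φ y‖ₑ ^ 2) := by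
        refine lintegral_congr fun x => ?_
        have a1 : Measurable fun y => KK x y * ‖φ y‖ₑ ^ 2 := (KK_meas_left x).mul hm1
        rw [lintegral_const_mul _ a1]
    _ = ∫⁻ y, ∫⁻ x, ‖w x‖ₑ ^ 2 * (KK x y * ‖φ y‖ₑ ^ 2) := by
        refine lintegral_lintegral_swap ?_
        exact ((hm2.comp measurable_fst).mul (KK_meas.mul (hm1.comp measurable_snd))).aemeasurable
    _ = ∫⁻ y, ‖φ y‖ₑ ^ 2 * ∫⁻ x, KK y x * ‖w x‖ₑ ^ 2 := by
        refine lintegral_congr fun y => ?_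
        have a2 : Measurable fun x => KK y x * ‖w x‖ₑ ^ 2 := (KK_meas_left y).mul hm2
        rw [← lintegral_const_mul _ a2]
        refine lintegral_congr fun x => ?_
        rw [KK_symm y x]; ring
    _ ≤ ∫⁻ y, ‖φ y‖ₑ ^ 2 * ENNReal.ofReal v := by
        refine lintegral_mono fun y => ?_
        gcongr
        exact hB y
    _ = _ := by rw [lintegral_mul_const _ hm1, mul_comm]

lemma eLpNorm_sq (φ : Rn n → ℂ) : eLpNorm φ 2 volume ^ 2 = ∫⁻ y, ‖φ y‖ₑ ^ 2 := by
  rw [eLpNorm_eq_lintegral_rpow_enorm_toReal (by norm_num) (by norm_num)]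
  simp only [ENNReal.toReal_ofNat, ENNReal.rpow_two]
  rw [← ENNReal.rpow_natCast, ← ENNReal.rpow_mul]
  norm_num

lemma diff_pt (hφ : Continuous φ) (hψ : Continuous ψ) (hB : HB φ v) (hB' : HB ψ v) (hv : 0 ≤ v)
    (x : Rn n) : ‖((hartree 1 φ x - hartree 1 ψ x : ℝ) : ℂ)‖ₑ ^ 2 ≤
      ENNReal.ofReal (4 * v) * ∫⁻ y, KK x y * ‖φ y - ψ y‖ₑ ^ 2 := by
  have i1 := hartree_int hφ hB x
  have i2 := hartree_int hψ hB' x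
  have h1 : hartree 1 φ x - hartree 1 ψ x =
      ∫ y, ‖x - y‖ ^ (-1 : ℝ) * (Complex.normSq (φ y) - Complex.normSq (ψ y)) := by
    unfold hartree conv
    rw [← integral_sub i1 i2]
    simp_rw [mul_sub]
  have mφ := enorm_meas hφ
  have mψ := enorm_meas hψ
  have hc : Continuous fun y => φ y - ψ y := hφ.sub hψ
  have md : Measurable fun y => ‖φ y - ψ y‖ₑ := enorm_meas hc
  have h2 : ‖((hartree 1 φ x - hartree 1 ψ x : ℝ) : ℂ)‖ₑ ≤
      ∫⁻ y, KK x y * ((‖φ y‖ₑ + ‖ψ y‖ₑ) * ‖φ y - ψ y‖ₑ) := by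
    have e1 : ‖((hartree 1 φ x - hartree 1 ψ x : ℝ) : ℂ)‖ₑ = ‖hartree 1 φ x - hartree 1 ψ x‖ₑ := by
      rw [← ofReal_norm, ← ofReal_norm, Complex.norm_real]
    rw [e1, h1]
    refine (enorm_integral_le_lintegral_enorm _).trans (lintegral_mono fun y => ?_)
    rw [enorm_mul]
    have e2 : ‖‖x - y‖ ^ (-1 : ℝ)‖ₑ = KK x y := by
      rw [Real.rpow_neg_one, KK, ← ofReal_norm, norm_inv, norm_norm]
    rw [e2]
    gcongr
    rw [← ofReal_norm, ← ofReal_norm, ← ofReal_norm, ← ofReal_norm,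
      ← ENNReal.ofReal_add (norm_nonneg _) (norm_nonneg _), ← ENNReal.ofReal_mul (by positivity)]
    refine ENNReal.ofReal_le_ofReal ?_
    rw [Complex.normSq_eq_norm_sq, Complex.normSq_eq_norm_sq, sq_sub_sq, norm_mul, Real.norm_eq_abs,
      Real.norm_eq_abs, abs_of_nonneg (by positivity)]
    gcongr
    exact abs_norm_sub_norm_le _ _
  refine (pow_le_pow_left₀ (zero_le) h2 2).trans ?_
  refine (csK x (mφ.add mψ) md).trans ?_
  gcongr
  calc ∫⁻ y, KK x y * (‖φ y‖ₑ + ‖ψ y‖ₑ) ^ 2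
      ≤ ∫⁻ y, (2 * (KK x y * ‖φ y‖ₑ ^ 2) + 2 * (KK x y * ‖ψ y‖ₑ ^ 2)) := by
        refine lintegral_mono fun y => ?_
        have : (‖φ y‖ₑ + ‖ψ y‖ₑ) ^ 2 ≤ 2 * ‖φ y‖ₑ ^ 2 + 2 * ‖ψ y‖ₑ ^ 2 := by
          rw [← ofReal_norm, ← ofReal_norm, ← ENNReal.ofReal_add (norm_nonneg _) (norm_nonneg _),
            ← ENNReal.ofReal_pow (by positivity), ← ENNReal.ofReal_pow (by positivity),
            ← ENNReal.ofReal_pow (by positivity)]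
          have e3 : (2 : ℝ≥0∞) = ENNReal.ofReal 2 := by simp
          rw [e3, ← ENNReal.ofReal_mul (by norm_num), ← ENNReal.ofReal_mul (by norm_num),
            ← ENNReal.ofReal_add (by positivity) (by positivity)]
          refine ENNReal.ofReal_le_ofReal ?_
          nlinarith [sq_nonneg (‖φ y‖ - ‖ψ y‖)]
        calc _ ≤ KK x y * (2 * ‖φ y‖ₑ ^ 2 + 2 * ‖ψ y‖ₑ ^ 2) := by gcongr
          _ = _ := by ring
    _ = 2 * (∫⁻ y, KK x y * ‖φ y‖ₑ ^ 2) + 2 * ∫⁻ y, KK x y * ‖ψ y‖ₑ ^ 2 := by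
        have a1 : Measurable fun y => KK x y * ‖φ y‖ₑ ^ 2 := (KK_meas_left x).mul (mφ.pow_const 2)
        have a2 : Measurable fun y => KK x y * ‖ψ y‖ₑ ^ 2 := (KK_meas_left x).mul (mψ.pow_const 2)
        rw [lintegral_add_left (a1.const_mul 2), lintegral_const_mul _ a1, lintegral_const_mul _ a2]
    _ ≤ 2 * ENNReal.ofReal v + 2 * ENNReal.ofReal v := by
        gcongr
        · exact hB x
        · exact hB' x
    _ = ENNReal.ofReal (4 * v) := by
        rw [ENNReal.ofReal_mul (by norm_num), ← add_mul]
        norm_num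

/-- The key trilinear estimate. -/
lemma diff_mul (hφ : Continuous φ) (hψ : Continuous ψ) (hw : Continuous w) (hB : HB φ v)
    (hB' : HB ψ v) (hBw : HB w v) (hv : 0 ≤ v) (hd : MemLp (fun y => φ y - ψ y) 2 volume) :
    MemLp (fun x => ((hartree 1 φ x - hartree 1 ψ x : ℝ) : ℂ) * w x) 2 volume ∧
    nL (fun x => ((hartree 1 φ x - hartree 1 ψ x : ℝ) : ℂ) * w x) ≤ 2 * v * nL (fun y => φ y - ψ y) := by
  have hc : Continuous fun y => φ y - ψ y := hφ.sub hψ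
  have key : eLpNorm (fun x => ((hartree 1 φ x - hartree 1 ψ x : ℝ) : ℂ) * w x) 2 volume ≤
      ENNReal.ofReal (2 * v * nL (fun y => φ y - ψ y)) := by
    refine (ENNReal.pow_le_pow_left_iff (n := 2) (by norm_num)).1 ?_
    rw [eLpNorm_sq]
    calc ∫⁻ x, ‖((hartree 1 φ x - hartree 1 ψ x : ℝ) : ℂ) * w x‖ₑ ^ 2
        ≤ ∫⁻ x, ENNReal.ofReal (4 * v) * (‖w x‖ₑ ^ 2 * ∫⁻ y, KK x y * ‖φ y - ψ y‖ₑ ^ 2) := by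
          refine lintegral_mono fun x => ?_
          rw [enorm_mul, mul_pow]
          calc _ ≤ (ENNReal.ofReal (4 * v) * ∫⁻ y, KK x y * ‖φ y - ψ y‖ₑ ^ 2) * ‖w x‖ₑ ^ 2 := by
                gcongr
                exact diff_pt hφ hψ hB hB' hv x
            _ = _ := by ring
      _ = ENNReal.ofReal (4 * v) * ∫⁻ x, (‖w x‖ₑ ^ 2 * ∫⁻ y, KK x y * ‖φ y - ψ y‖ₑ ^ 2) := by
          refine lintegral_const_mul _ ?_
          exact ((enorm_meas hw).pow_const 2).mul (lint_meas hc)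
      _ ≤ ENNReal.ofReal (4 * v) * (ENNReal.ofReal v * ∫⁻ y, ‖φ y - ψ y‖ₑ ^ 2) := by
          gcongr
          exact schur hc hw hBw
      _ = ENNReal.ofReal (2 * v * nL (fun y => φ y - ψ y)) ^ 2 := by
          rw [← eLpNorm_sq (fun y => φ y - ψ y), ← nL_ofReal hd, ← ENNReal.ofReal_pow (nL_nonneg _),
            ← ENNReal.ofReal_mul hv, ← ENNReal.ofReal_mul (by positivity),
            ← ENNReal.ofReal_pow (mul_nonneg (by positivity) (nL_nonneg _))]
          congr 1; ring
  refine ⟨⟨?_, key.trans_lt ENNReal.ofReal_lt_top⟩, nL_le_of (mul_nonneg (by positivity) (nL_nonneg _)) key⟩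
  exact ((Complex.measurable_ofReal.comp ((hartree_meas hφ hB).sub (hartree_meas hψ hB'))).mul
    hw.measurable).aestronglyMeasurable

lemma pot_mul (hφ : Continuous φ) (hB : HB φ v) (hv : 0 ≤ v) (hw : MemLp w 2 volume) :
    MemLp (fun x => ((hartree 1 φ x : ℝ) : ℂ) * w x) 2 volume ∧
    nL (fun x => ((hartree 1 φ x : ℝ) : ℂ) * w x) ≤ v * nL w := by
  have h1 : ∀ x, ‖((hartree 1 φ x : ℝ) : ℂ) * w x‖ ≤ ‖(v : ℂ) * w x‖ := by
    intro x
    rw [norm_mul, norm_mul, Complex.norm_real, Complex.norm_real, Real.norm_eq_abs, Real.norm_eq_abs,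
      abs_of_nonneg (hartree_nonneg _ _), abs_of_nonneg hv]
    gcongr
    exact hartree_le hφ hB hv x
  have hm : MemLp (fun x => (v : ℂ) * w x) 2 volume := hw.const_mul _
  refine ⟨hm.mono ?_ (ae_of_all _ h1), ?_⟩
  · exact (Complex.measurable_ofReal.comp (hartree_meas hφ hB)).aestronglyMeasurable.mul hw.1
  · refine (nL_mono hm h1).trans (le_of_eq ?_)
    rw [nL_const_mul, Complex.norm_real, Real.norm_eq_abs, abs_of_nonneg hv]

lemma diff_full (hφ : Continuous φ) (hψ : Continuous ψ) (hB : HB φ v)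
    (hB' : HB ψ v) (hv : 0 ≤ v) (hd : MemLp (fun y => φ y - ψ y) 2 volume) :
    MemLp (fun x => ((hartree 1 φ x : ℝ) : ℂ) * φ x - ((hartree 1 ψ x : ℝ) : ℂ) * ψ x) 2 volume ∧
    nL (fun x => ((hartree 1 φ x : ℝ) : ℂ) * φ x - ((hartree 1 ψ x : ℝ) : ℂ) * ψ x)
      ≤ 3 * v * nL (fun y => φ y - ψ y) := by
  have e : (fun x => ((hartree 1 φ x : ℝ) : ℂ) * φ x - ((hartree 1 ψ x : ℝ) : ℂ) * ψ x) =
      fun x => ((hartree 1 φ x - hartree 1 ψ x : ℝ) : ℂ) * ψ x + ((hartree 1 φ x : ℝ) : ℂ) * (φ x - ψ x) := by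
    ext x; push_cast; ring
  have h1 := diff_mul hφ hψ hψ hB hB' hB' hv hd
  have h2 := pot_mul hφ hB hv hd
  rw [e]
  exact ⟨h1.1.add h2.1, (nL_add_le h1.1 h2.1).trans (by linarith [h1.2, h2.2])⟩

lemma pot_int (hφ : Continuous φ) (hB : HB φ v) (hv : 0 ≤ v) (hw : MemLp w 2 volume) :
    Integrable (fun x => hartree 1 φ x * ‖w x‖ ^ 2) volume := by
  refine (nL_sq_int hw).bdd_mul (c := v) (hartree_meas hφ hB).aestronglyMeasurable
    (ae_of_all _ fun x => ?_)
  rw [Real.norm_eq_abs, abs_of_nonneg (hartree_nonneg _ _)]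
  exact hartree_le hφ hB hv x

lemma pot_symm (hφ : Continuous φ) (hψ : Continuous ψ) (hB : HB φ v) (hB' : HB ψ v) :
    ∫ x, hartree 1 φ x * ‖ψ x‖ ^ 2 = ∫ x, hartree 1 ψ x * ‖φ x‖ ^ 2 := by
  have conv : ∀ {φ ψ : Rn n → ℂ}, Continuous φ → Continuous ψ → HB φ v →
      ∫ x, hartree 1 φ x * ‖ψ x‖ ^ 2 = (∫⁻ x, ‖ψ x‖ₑ ^ 2 * ∫⁻ y, KK x y * ‖φ y‖ₑ ^ 2).toReal := by
    intro φ ψ hφ hψ hB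
    have hmm : AEStronglyMeasurable (fun x => hartree 1 φ x * ‖ψ x‖ ^ 2) volume :=
      ((hartree_meas hφ hB).mul (hψ.norm.pow 2).measurable).aestronglyMeasurable
    have hnn : ∀ x, 0 ≤ hartree 1 φ x * ‖ψ x‖ ^ 2 := fun x =>
      mul_nonneg (hartree_nonneg _ _) (by positivity)
    rw [integral_eq_lintegral_of_nonneg_ae (ae_of_all _ hnn) hmm]
    congr 1
    refine lintegral_congr fun x => ?_
    rw [ENNReal.ofReal_mul (hartree_nonneg _ _), hartree_ofReal hφ hB, enorm_sq_ofReal, mul_comm]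
  rw [conv hφ hψ hB, conv hψ hφ hB']
  congr 1
  have hm1 := (enorm_meas hφ).pow_const 2
  have hm2 := (enorm_meas hψ).pow_const 2
  calc ∫⁻ x, ‖ψ x‖ₑ ^ 2 * ∫⁻ y, KK x y * ‖φ y‖ₑ ^ 2
      = ∫⁻ x, ∫⁻ y, ‖ψ x‖ₑ ^ 2 * (KK x y * ‖φ y‖ₑ ^ 2) := by
        refine lintegral_congr fun x => ?_
        have a1 : Measurable fun y => KK x y * ‖φ y‖ₑ ^ 2 := (KK_meas_left x).mul hm1
        rw [lintegral_const_mul _ a1]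
    _ = ∫⁻ y, ∫⁻ x, ‖ψ x‖ₑ ^ 2 * (KK x y * ‖φ y‖ₑ ^ 2) := by
        refine lintegral_lintegral_swap ?_
        exact ((hm2.comp measurable_fst).mul (KK_meas.mul (hm1.comp measurable_snd))).aemeasurable
    _ = ∫⁻ y, ‖φ y‖ₑ ^ 2 * ∫⁻ x, KK y x * ‖ψ x‖ₑ ^ 2 := by
        refine lintegral_congr fun y => ?_
        have a2 : Measurable fun x => KK y x * ‖ψ x‖ₑ ^ 2 := (KK_meas_left y).mul hm2
        rw [← lintegral_const_mul _ a2]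
        refine lintegral_congr fun x => ?_
        rw [KK_symm y x]; ring

end kern

/-- Solutions (finite energy) with a source. -/
structure SolS {n : ℕ} (lam ε : ℝ) (u S : ℝ → Rn n → ℂ) : Prop where
  js : JS u
  h1 : ∀ t, H1 (u t)
  eq : ∀ t x, Complex.I * (ε : ℂ) * dt u t x + ((ε ^ 2 / 2 : ℝ) : ℂ) * lap (u t) x
    = ((‖x‖ ^ 2 / 2 : ℝ) : ℂ) * u t x + (lam : ℂ) * ((hartree 1 (u t) x : ℝ) : ℂ) * u t x + S t x

/-- Schwartz solutions. -/
structure Sol {n : ℕ} (lam ε : ℝ) (u : ℝ → Rn n → ℂ) : Prop where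
  js : JS u
  sch : ∀ t, Sch (u t)
  eq : ∀ t x, Complex.I * (ε : ℂ) * dt u t x + ((ε ^ 2 / 2 : ℝ) : ℂ) * lap (u t) x
    = ((‖x‖ ^ 2 / 2 : ℝ) : ℂ) * u t x + (lam : ℂ) * ((hartree 1 (u t) x : ℝ) : ℂ) * u t x

section sol
variable {n : ℕ} {lam ε : ℝ} {u w S : ℝ → Rn n → ℂ}

lemma Sol.solS (h : Sol lam ε u) : SolS lam ε u (fun _ _ => 0) where
  js := h.js
  h1 t := (h.sch t).h1
  eq t x := by rw [h.eq t x, add_zero]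

lemma stab (hlam : 0 ≤ lam) (hε : 0 < ε) (hu : SolS lam ε u (fun _ _ => 0)) (hw : SolS lam ε w S)
    {a b M : ℝ} {c0 c : ℝ → ℝ} (hc0 : Continuous c0) (hc0p : ∀ t, 0 ≤ c0 t) (hc : Continuous c)
    (hcp : ∀ t, 0 ≤ c t) (hBu : ∀ t ∈ Set.Icc a b, HB (u t) (c t))
    (hBw : ∀ t ∈ Set.Icc a b, HB (w t) (c t))
    (huM : ∀ t ∈ Set.Icc a b, nL (u t) ≤ M) (hwM : ∀ t ∈ Set.Icc a b, nL (w t) ≤ M)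
    (hudM : ∀ t ∈ Set.Icc a b, ∀ j, nL (pd j (u t)) ≤ M)
    (hwdM : ∀ t ∈ Set.Icc a b, ∀ j, nL (pd j (w t)) ≤ M)
    (hSL : ∀ t ∈ Set.Icc a b, MemLp (S t) 2 volume) (hS : ∀ t ∈ Set.Icc a b, nL (S t) ≤ c0 t)
    {s t : ℝ} (hs : s ∈ Set.Icc a b) (ht : t ∈ Set.Icc a b) :
    nL (fun x => u t x - w t x) ≤ (nL (fun x => u s x - w s x) + ε⁻¹ * |∫ τ in s..t, c0 τ|) *
      Real.exp (ε⁻¹ * |∫ τ in s..t, 2 * lam * c τ|) := by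
  have hz : JS (fun t x => u t x - w t x) := hu.js.sub hw.js
  have hd : ∀ t, MemLp (fun x => u t x - w t x) 2 volume := fun t => ((hu.h1 t).sub (hw.h1 t)).l2
  have hDM := fun (t : ℝ) (ht : t ∈ Set.Icc a b) => diff_mul (hu.h1 t).sm.continuous (hw.h1 t).sm.continuous
    (hw.h1 t).sm.continuous (hBu t ht) (hBw t ht) (hBw t ht) (hcp t) (hd t)
  have hlD : ∀ t ∈ Set.Icc a b, MemLp (fun x => (lam : ℂ) * (((hartree 1 (u t) x - hartree 1 (w t) x : ℝ) : ℂ) * w t x)) 2 volume :=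
    fun t ht => (hDM t ht).1.const_mul _
  refine l2_gron (M := M + M) hz hε (P := fun t x => ‖x‖ ^ 2 / 2 + lam * hartree 1 (u t) x)
    (G := fun t x => (lam : ℂ) * (((hartree 1 (u t) x - hartree 1 (w t) x : ℝ) : ℂ) * w t x) - S t x)
    (c0 := c0) (c1 := fun τ => 2 * lam * c τ) ?_ ?_ ?_ ?_ ?_ ?_ hc0 hc0p (by fun_prop)
    (fun t => mul_nonneg (by positivity) (hcp t)) ?_ hs ht
  · intro t _ x
    rw [dt_sub hu.js hw.js, lap_sub (hu.h1 t).sm (hw.h1 t).sm]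
    have e1 := hu.eq t x
    have e2 := hw.eq t x
    push_cast at e1 e2 ⊢
    linear_combination e1 - e2
  · exact fun t _ => hd t
  · exact fun t _ j => ((hu.h1 t).sub (hw.h1 t)).d2 j
  · exact fun t ht => (nL_sub_le (hu.h1 t).l2 (hw.h1 t).l2).trans (add_le_add (huM t ht) (hwM t ht))
  · exact fun t ht j => ((hu.h1 t).pd_sub_le (hw.h1 t) j).trans (add_le_add (hudM t ht j) (hwdM t ht j))
  · exact fun t ht => (hlD t ht).sub (hSL t ht)
  · intro t ht
    refine (nL_sub_le (hlD t ht) (hSL t ht)).trans ?_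
    rw [nL_const_mul, Complex.norm_real, Real.norm_eq_abs, abs_of_nonneg hlam]
    have := mul_le_mul_of_nonneg_left (hDM t ht).2 hlam
    linarith [hS t ht]

lemma Sch.lap (h : Sch (u 0)) : Sch (lap (u 0)) := by
  have : ∀ s : Finset (Fin n), Sch (fun x => ∑ j ∈ s, _root_.pd j (_root_.pd j (u 0)) x) := by
    intro s
    classical
    induction s using Finset.induction_on with
    | empty => exact ⟨0, by ext; simp⟩
    | insert a s ha ih =>
      simp_rw [Finset.sum_insert ha]
      exact ((h.pd a).pd a).add ih
  exact this Finset.univ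

lemma Sch.lap' {φ : Rn n → ℂ} (h : Sch φ) : Sch (_root_.lap φ) := Sch.lap (u := fun _ => φ) h

lemma Sch.sq {φ : Rn n → ℂ} (h : Sch φ) : Sch (fun x => ((‖x‖ ^ 2 : ℝ) : ℂ) * φ x) := by
  have : ∀ s : Finset (Fin n), Sch (fun x => ∑ j ∈ s, ((x j : ℝ) : ℂ) * (((x j : ℝ) : ℂ) * φ x)) := by
    intro s
    classical
    induction s using Finset.induction_on with
    | empty => exact ⟨0, by ext; simp⟩
    | insert a s ha ih =>
      simp_rw [Finset.sum_insert ha]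
      exact ((h.coord a).coord a).add ih
  convert this Finset.univ using 2 with x
  rw [EuclideanSpace.norm_sq_eq]
  push_cast
  rw [Finset.sum_mul]
  refine Finset.sum_congr rfl fun j _ => ?_
  rw [Real.norm_eq_abs, ← mul_assoc, ← Complex.ofReal_pow, sq_abs]
  push_cast; ring

/-- crude Hardy constant for a Schwartz function -/
lemma hb_exists (hn : 2 ≤ n) {φ : Rn n → ℂ} (h : H1 φ) : ∃ v, 0 ≤ v ∧ HB φ v :=
  ⟨_, Finset.sum_nonneg fun j _ => mul_nonneg (by norm_num) (mul_nonneg (nL_nonneg _) (nL_nonneg _)), hardy' hn h⟩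

lemma Sol.dtL (hn : 2 ≤ n) (hε : 0 < ε) (h : Sol lam ε u) (t : ℝ) : MemLp (dt u t) 2 volume := by
  obtain ⟨v, hv, hB⟩ := hb_exists hn (h.sch t).h1
  have e : dt u t = fun x => (Complex.I * (ε : ℂ))⁻¹ * ((((‖x‖ ^ 2 : ℝ) : ℂ) * u t x) * (1 / 2)
      + (lam : ℂ) * (((hartree 1 (u t) x : ℝ) : ℂ) * u t x) - ((ε ^ 2 / 2 : ℝ) : ℂ) * lap (u t) x) := by
    ext x
    have hne : Complex.I * (ε : ℂ) ≠ 0 := mul_ne_zero Complex.I_ne_zero (by exact_mod_cast hε.ne')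
    rw [eq_inv_mul_iff_mul_eq₀ hne]
    have := h.eq t x
    push_cast at this ⊢
    linear_combination this
  rw [e]
  have m1 : MemLp (fun x => (((‖x‖ ^ 2 : ℝ) : ℂ) * u t x) * (1 / 2)) 2 volume := (h.sch t).sq.memLp.mul_const _
  have m2 : MemLp (fun x => (lam : ℂ) * (((hartree 1 (u t) x : ℝ) : ℂ) * u t x)) 2 volume :=
    (pot_mul (h.js.slice t).continuous hB hv (h.sch t).memLp).1.const_mul _
  have m3 : MemLp (fun x => ((ε ^ 2 / 2 : ℝ) : ℂ) * lap (u t) x) 2 volume := (h.sch t).lap'.memLp.const_mul _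
  exact ((m1.add m2).sub m3).const_mul _

lemma ibp {a b : Rn n → ℂ} (ha : Sch a) (hb : Sch b) (j : Fin n) :
    ∫ x, conj (a x) * pd j b x = - ∫ x, conj (pd j a x) * b x := by
  obtain ⟨f, rfl⟩ := ha
  obtain ⟨g, rfl⟩ := hb
  have hf : ContDiff ℝ (⊤ : ℕ∞) (f : Rn n → ℂ) := f.smooth _
  have hg : ContDiff ℝ (⊤ : ℕ∞) (g : Rn n → ℂ) := g.smooth _
  have hcd : ∀ x, HasFDerivAt (fun x => conj (f x)) ((Complex.conjCLE : ℂ →L[ℝ] ℂ).comp (fderiv ℝ f x)) x := fun x =>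
    (Complex.conjCLE : ℂ →L[ℝ] ℂ).hasFDerivAt.comp x (hf.differentiable (by simp) x).hasFDerivAt
  have e : ∀ x, fderiv ℝ (fun x => conj (f x)) x (eb j) = conj (pd j f x) := by
    intro x; rw [(hcd x).fderiv]; rfl
  have L : ∀ {p q : Rn n → ℂ}, Sch p → Sch q → Integrable (fun x => conj (p x) * q x) volume := by
    intro p q hp hq
    refine (nL_mul_int hp.memLp hq.memLp).mono' ?_ (ae_of_all _ fun x => by simp)
    exact ((Complex.continuous_conj.comp hp.h1.sm.continuous).mul hq.h1.sm.continuous).aestronglyMeasurable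
  have hfS : Sch (f : Rn n → ℂ) := ⟨f, rfl⟩
  have hgS : Sch (g : Rn n → ℂ) := ⟨g, rfl⟩
  have := integral_mul_fderiv_eq_neg_fderiv_mul_of_integrable (μ := (volume : Measure (Rn n)))
    (f := fun x => conj (f x)) (g := fun x => g x) (v := eb j)
    (by simp_rw [e]; exact L (hfS.pd j) hgS) (L hfS (hgS.pd j)) (L hfS hgS)
    (fun x _ => (hcd x).differentiableAt) (fun x _ => hg.differentiable (by simp) x)
  simp_rw [e] at this
  exact this

end sol

section en
variable {n : ℕ} {lam ε : ℝ}

lemma conj_int {p q : Rn n → ℂ} (hp : MemLp p 2 volume) (hq : MemLp q 2 volume) :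
    Integrable (fun x => conj (p x) * q x) volume := by
  refine (nL_mul_int hp hq).mono' ?_ (ae_of_all _ fun x => by simp)
  exact (Complex.continuous_conj.comp_aestronglyMeasurable hp.1).mul hq.1

/-- Real inner product. -/
def rip (p q : Rn n → ℂ) : ℝ := ∫ x, (conj (p x) * q x).re

lemma rip_int {p q : Rn n → ℂ} (hp : MemLp p 2 volume) (hq : MemLp q 2 volume) :
    Integrable (fun x => (conj (p x) * q x).re) volume := (conj_int hp hq).re

lemma rip_eq {p q : Rn n → ℂ} (hp : MemLp p 2 volume) (hq : MemLp q 2 volume) :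
    rip p q = (∫ x, conj (p x) * q x).re := integral_re (conj_int hp hq)

lemma rip_le {p q : Rn n → ℂ} (hp : MemLp p 2 volume) (hq : MemLp q 2 volume) :
    |rip p q| ≤ ∫ x, ‖p x‖ * ‖q x‖ := by
  rw [← Real.norm_eq_abs]
  refine norm_integral_le_of_norm_le (nL_mul_int hp hq) (ae_of_all _ fun x => ?_)
  rw [Real.norm_eq_abs]
  refine (Complex.abs_re_le_norm _).trans ?_
  simp

lemma rip_le' {p q : Rn n → ℂ} (hp : MemLp p 2 volume) (hq : MemLp q 2 volume) :
    |rip p q| ≤ nL p * nL q := (rip_le hp hq).trans (nL_mul hp hq)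

/-- Energy. -/
def En (lam ε : ℝ) (φ : Rn n → ℂ) : ℝ :=
  (∑ j, (ε ^ 2 / 4 * nL (pd j φ) ^ 2 + 1 / 4 * nL (fun x => ((x j : ℝ) : ℂ) * φ x) ^ 2))
    + lam / 4 * ∫ x, hartree 1 φ x * ‖φ x‖ ^ 2

lemma ibp2 {a b : Rn n → ℂ} (ha : Sch a) (hb : Sch b) (j : Fin n) :
    ∫ x, (conj (a x - b x) * (pd j (pd j a) x + pd j (pd j b) x)).re = -(nL (pd j a) ^ 2 - nL (pd j b) ^ 2) := by
  have hs := ha.sub hb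
  have hs2 := (ha.pd j).add (hb.pd j)
  have e1 : (pd j fun x => pd j a x + pd j b x) = fun x => pd j (pd j a) x + pd j (pd j b) x := by
    ext x
    unfold pd
    rw [fderiv_fun_add]
    · rfl
    · exact (ha.pd j).h1.sm.differentiable (by simp) x
    · exact (hb.pd j).h1.sm.differentiable (by simp) x
  have h1 := ibp hs hs2 j
  rw [e1] at h1
  have hl := integral_re (conj_int hs.memLp (hs2.pd j).memLp)
  have hr := integral_re (conj_int (hs.pd j).memLp hs2.memLp)
  rw [e1] at hl
  simp only [RCLike.re_to_complex] at hl hr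
  rw [hl, h1, Complex.neg_re, ← hr, nL_sq (ha.pd j).memLp, nL_sq (hb.pd j).memLp,
    ← integral_sub (nL_sq_int (ha.pd j).memLp) (nL_sq_int (hb.pd j).memLp)]
  congr 1
  refine integral_congr_ae (ae_of_all _ fun x => ?_)
  simp only
  rw [pd_sub ha.h1.sm hb.h1.sm]
  simp only [Complex.sq_norm, Complex.normSq_apply, Complex.mul_re, Complex.conj_re, Complex.conj_im, map_sub,
    Complex.sub_re, Complex.sub_im, Complex.add_re, Complex.add_im]
  ring

lemma coord2 {a b : Rn n → ℂ} (ha : Sch a) (hb : Sch b) (j : Fin n) :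
    ∫ x, (conj (a x - b x) * (((x j : ℝ) : ℂ) * (((x j : ℝ) : ℂ) * (a x + b x)))).re =
      nL (fun x => ((x j : ℝ) : ℂ) * a x) ^ 2 - nL (fun x => ((x j : ℝ) : ℂ) * b x) ^ 2 := by
  rw [nL_sq (ha.coord j).memLp, nL_sq (hb.coord j).memLp,
    ← integral_sub (nL_sq_int (ha.coord j).memLp) (nL_sq_int (hb.coord j).memLp)]
  refine integral_congr_ae (ae_of_all _ fun x => ?_)
  simp only [Complex.sq_norm, Complex.normSq_apply, Complex.mul_re, Complex.mul_im, Complex.conj_re, Complex.conj_im, map_sub,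
    Complex.sub_re, Complex.sub_im, Complex.add_re, Complex.add_im, Complex.ofReal_re, Complex.ofReal_im]
  ring

lemma pot2 {a b : Rn n → ℂ} (ha : H1 a) (hb : H1 b) {v : ℝ} (hv : 0 ≤ v) (hBa : HB a v) (hBb : HB b v) :
    ∫ x, (conj (a x - b x) * (((hartree 1 a x : ℝ) : ℂ) * a x + ((hartree 1 b x : ℝ) : ℂ) * b x)).re =
      1 / 2 * (∫ x, hartree 1 a x * ‖a x‖ ^ 2) - 1 / 2 * (∫ x, hartree 1 b x * ‖b x‖ ^ 2)
       + 1 / 2 * ∫ x, (hartree 1 a x - hartree 1 b x) * ‖a x - b x‖ ^ 2 := by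
  have ca := ha.sm.continuous
  have cb := hb.sm.continuous
  have hs := pot_symm ca cb hBa hBb
  have i1 := pot_int ca hBa hv ha.l2
  have i2 := pot_int cb hBb hv hb.l2
  have i3 := pot_int ca hBa hv hb.l2
  have i4 := pot_int cb hBb hv ha.l2
  have i5 := pot_int ca hBa hv (ha.sub hb).l2
  have i6 := pot_int cb hBb hv (ha.sub hb).l2
  have e : ∀ x, (conj (a x - b x) * (((hartree 1 a x : ℝ) : ℂ) * a x + ((hartree 1 b x : ℝ) : ℂ) * b x)).re =
      (1 / 2 * (hartree 1 a x * ‖a x‖ ^ 2) - 1 / 2 * (hartree 1 b x * ‖b x‖ ^ 2))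
       + (1 / 2 * (hartree 1 b x * ‖a x‖ ^ 2) - 1 / 2 * (hartree 1 a x * ‖b x‖ ^ 2))
       + 1 / 2 * ((hartree 1 a x - hartree 1 b x) * ‖a x - b x‖ ^ 2) := by
    intro x
    simp only [Complex.sq_norm, Complex.normSq_apply, Complex.mul_re, Complex.mul_im, Complex.conj_re, Complex.conj_im, map_sub,
      Complex.sub_re, Complex.sub_im, Complex.add_re, Complex.add_im, Complex.ofReal_re, Complex.ofReal_im]
    ring
  have i7 : Integrable (fun x => (hartree 1 a x - hartree 1 b x) * ‖a x - b x‖ ^ 2) volume := by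
    simp_rw [sub_mul]; exact i5.sub i6
  simp_rw [e]
  have j1 : Integrable (fun x => 1 / 2 * (hartree 1 a x * ‖a x‖ ^ 2) - 1 / 2 * (hartree 1 b x * ‖b x‖ ^ 2)) volume :=
    (i1.const_mul _).sub (i2.const_mul _)
  have j2 : Integrable (fun x => 1 / 2 * (hartree 1 b x * ‖a x‖ ^ 2) - 1 / 2 * (hartree 1 a x * ‖b x‖ ^ 2)) volume :=
    (i4.const_mul _).sub (i3.const_mul _)
  have j3 : Integrable (fun x => (1 / 2 * (hartree 1 a x * ‖a x‖ ^ 2) - 1 / 2 * (hartree 1 b x * ‖b x‖ ^ 2)) +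
    (1 / 2 * (hartree 1 b x * ‖a x‖ ^ 2) - 1 / 2 * (hartree 1 a x * ‖b x‖ ^ 2))) volume := j1.add j2
  rw [integral_add j3 (i7.const_mul _), integral_add j1 j2,
    integral_sub (i1.const_mul _) (i2.const_mul _), integral_sub (i4.const_mul _) (i3.const_mul _)]
  simp only [integral_const_mul]
  rw [hs]; ring

lemma en_id (hn : 2 ≤ n) (hε : 0 < ε) {u : ℝ → Rn n → ℂ} (h : Sol lam ε u) (t s : ℝ) :
    En lam ε (u t) - En lam ε (u s) =
      ε / 2 * rip (fun x => u t x - u s x) (fun x => Complex.I * (dt u t x + dt u s x))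
      - lam / 4 * ∫ x, (hartree 1 (u t) x - hartree 1 (u s) x) * ‖u t x - u s x‖ ^ 2 := by
  obtain ⟨v1, hv1, hB1⟩ := hb_exists hn (h.sch t).h1
  obtain ⟨v2, hv2, hB2⟩ := hb_exists hn (h.sch s).h1
  have hv : 0 ≤ max v1 v2 := hv1.trans (le_max_left _ _)
  have hBt := hB1.mono (le_max_left v1 v2)
  have hBs := hB2.mono (le_max_right v1 v2)
  have ha := h.sch t
  have hb := h.sch s
  have hab := (ha.sub hb).memLp
  have key : ε * rip (fun x => u t x - u s x) (fun x => Complex.I * (dt u t x + dt u s x)) =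
    (∑ j, ((-(ε ^ 2 / 2)) * (-(nL (pd j (u t)) ^ 2 - nL (pd j (u s)) ^ 2)) +
      1 / 2 * (nL (fun x => ((x j : ℝ) : ℂ) * u t x) ^ 2 - nL (fun x => ((x j : ℝ) : ℂ) * u s x) ^ 2)))
    + lam * (1 / 2 * (∫ x, hartree 1 (u t) x * ‖u t x‖ ^ 2) - 1 / 2 * (∫ x, hartree 1 (u s) x * ‖u s x‖ ^ 2)
       + 1 / 2 * ∫ x, (hartree 1 (u t) x - hartree 1 (u s) x) * ‖u t x - u s x‖ ^ 2) := by
    rw [← pot2 ha.h1 hb.h1 hv hBt hBs]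
    simp_rw [← ibp2 ha hb, ← coord2 ha hb]
    have m1 : ∀ j, MemLp (fun x => pd j (pd j (u t)) x + pd j (pd j (u s)) x) 2 volume := fun j =>
      (((ha.pd j).pd j).add ((hb.pd j).pd j)).memLp
    have m2 : ∀ j, MemLp (fun x : Rn n => ((x j : ℝ) : ℂ) * (((x j : ℝ) : ℂ) * (u t x + u s x))) 2 volume := fun j =>
      (((ha.add hb).coord j).coord j).memLp
    have m3 : MemLp (fun x => ((hartree 1 (u t) x : ℝ) : ℂ) * u t x + ((hartree 1 (u s) x : ℝ) : ℂ) * u s x) 2 volume :=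
      (pot_mul ha.h1.sm.continuous hBt hv ha.memLp).1.add (pot_mul hb.h1.sm.continuous hBs hv hb.memLp).1
    have i1 := fun j => (rip_int hab (m1 j)).const_mul (-(ε ^ 2 / 2))
    have i2 := fun j => (rip_int hab (m2 j)).const_mul (1 / 2)
    have i12 : ∀ j, Integrable (fun x => -(ε ^ 2 / 2) * (conj (u t x - u s x) * (pd j (pd j (u t)) x + pd j (pd j (u s)) x)).re
       + 1 / 2 * (conj (u t x - u s x) * (((x j : ℝ) : ℂ) * (((x j : ℝ) : ℂ) * (u t x + u s x)))).re) volume :=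
      fun j => (i1 j).add (i2 j)
    have i3 := (rip_int hab m3).const_mul lam
    have i4 : Integrable (fun x => ∑ j, (-(ε ^ 2 / 2) * (conj (u t x - u s x) * (pd j (pd j (u t)) x + pd j (pd j (u s)) x)).re
       + 1 / 2 * (conj (u t x - u s x) * (((x j : ℝ) : ℂ) * (((x j : ℝ) : ℂ) * (u t x + u s x)))).re)) volume :=
      integrable_finsetSum _ fun j _ => i12 j
    unfold rip
    simp_rw [← integral_const_mul]
    simp_rw [← fun j => integral_add (i1 j) (i2 j)]
    rw [← integral_finsetSum _ fun j _ => i12 j, ← integral_add i4 i3]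
    refine integral_congr_ae (ae_of_all _ fun x => ?_)
    simp only
    have e1 := h.eq t x
    have e2 := h.eq s x
    rw [lap_eq] at e1 e2
    have hx : ((‖x‖ ^ 2 : ℝ) : ℂ) = ∑ j, ((x j : ℝ) : ℂ) * ((x j : ℝ) : ℂ) := by
      rw [EuclideanSpace.norm_sq_eq]
      push_cast
      refine Finset.sum_congr rfl fun j _ => ?_
      rw [Real.norm_eq_abs, ← Complex.ofReal_pow, sq_abs]
      push_cast; ring
    have e3 : (ε : ℂ) * (Complex.I * (dt u t x + dt u s x)) =
        (∑ j, ((-(ε ^ 2 / 2) : ℝ) * (pd j (pd j (u t)) x + pd j (pd j (u s)) x) +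
        ((1 / 2 : ℝ) : ℂ) * (((x j : ℝ) : ℂ) * (((x j : ℝ) : ℂ) * (u t x + u s x)))))
        + (lam : ℂ) * (((hartree 1 (u t) x : ℝ) : ℂ) * u t x + ((hartree 1 (u s) x : ℝ) : ℂ) * u s x) := by
      rw [Finset.sum_add_distrib, ← Finset.mul_sum, ← Finset.mul_sum, Finset.sum_add_distrib]
      simp_rw [← mul_assoc ((_ : ℝ) : ℂ) ((_ : ℝ) : ℂ) (_ + _)]
      rw [← Finset.sum_mul, ← hx]
      push_cast at e1 e2 ⊢
      linear_combination e1 + e2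
    have e4 : ε * (conj (u t x - u s x) * (Complex.I * (dt u t x + dt u s x))).re =
        (conj (u t x - u s x) * ((ε : ℂ) * (Complex.I * (dt u t x + dt u s x)))).re := by
      rw [← Complex.re_ofReal_mul]; congr 1; ring
    rw [e4, e3, mul_add, Complex.add_re, Finset.mul_sum, Complex.re_sum]
    congr 1
    · refine Finset.sum_congr rfl fun j _ => ?_
      rw [mul_add, Complex.add_re, ← Complex.re_ofReal_mul, ← Complex.re_ofReal_mul]
      congr 2 <;> ring
    · rw [← Complex.re_ofReal_mul]; congr 1; ring
  unfold En
  have : ∀ A : ℝ, ε / 2 * A = 1 / 2 * (ε * A) := fun A => by ring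
  rw [this, key, mul_add, Finset.mul_sum]
  have e5 : ∀ a b c d : ℝ, (a + b) - (c + d) = (a - c) + (b - d) := fun a b c d => by ring
  rw [e5, ← Finset.sum_sub_distrib, add_sub_assoc]
  congr 1
  · refine Finset.sum_congr rfl fun j _ => ?_
    ring
  · ring

end en

section lb
variable {n : ℕ} {lam ε : ℝ} {u : ℝ → Rn n → ℂ}

/-- Sigma-norm. -/
def MM (u : ℝ → Rn n → ℂ) (t : ℝ) : ℝ :=
  nL (u t) + ∑ j, (nL (pd j (u t)) + nL (fun x => ((x j : ℝ) : ℂ) * u t x))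

lemma MM_nonneg (u : ℝ → Rn n → ℂ) (t : ℝ) : 0 ≤ MM u t :=
  add_nonneg (nL_nonneg _) (Finset.sum_nonneg fun j _ => add_nonneg (nL_nonneg _) (nL_nonneg _))

lemma MM_u (u : ℝ → Rn n → ℂ) (t : ℝ) : nL (u t) ≤ MM u t :=
  le_add_of_nonneg_right (Finset.sum_nonneg fun j _ => add_nonneg (nL_nonneg _) (nL_nonneg _))

lemma MM_j (u : ℝ → Rn n → ℂ) (t : ℝ) (j : Fin n) :
    nL (pd j (u t)) + nL (fun x => ((x j : ℝ) : ℂ) * u t x) ≤ MM u t := by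
  have := Finset.single_le_sum (f := fun j => nL (pd j (u t)) + nL (fun x => ((x j : ℝ) : ℂ) * u t x))
    (fun j _ => add_nonneg (nL_nonneg _) (nL_nonneg _)) (Finset.mem_univ j)
  exact this.trans (le_add_of_nonneg_left (nL_nonneg _))

lemma MM_pd (u : ℝ → Rn n → ℂ) (t : ℝ) (j : Fin n) : nL (pd j (u t)) ≤ MM u t :=
  (le_add_of_nonneg_right (nL_nonneg _)).trans (MM_j u t j)

lemma MM_x (u : ℝ → Rn n → ℂ) (t : ℝ) (j : Fin n) :
    nL (fun x => ((x j : ℝ) : ℂ) * u t x) ≤ MM u t :=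
  (le_add_of_nonneg_left (nL_nonneg _)).trans (MM_j u t j)

/-- Hardy constant. -/
def vK (n : ℕ) (K : ℝ) : ℝ := n * (2 * (K * K))

lemma vK_nonneg (K : ℝ) : 0 ≤ vK n K := by unfold vK; have := mul_self_nonneg K; positivity

lemma hb_of (hn : 2 ≤ n) {φ : Rn n → ℂ} (h : H1 φ) {K : ℝ} (h0 : nL φ ≤ K) (h1 : ∀ j, nL (pd j φ) ≤ K) :
    HB φ (vK n K) := by
  refine (hardy' hn h).mono ?_
  unfold vK
  calc _ ≤ ∑ j : Fin n, 2 * (K * K) := by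
        refine Finset.sum_le_sum fun j _ => ?_
        have := mul_le_mul h0 (h1 j) (nL_nonneg _) ((nL_nonneg _).trans h0)
        linarith
    _ = _ := by simp

lemma hb_MM (hn : 2 ≤ n) (h : Sol lam ε u) {K t : ℝ} (hK : MM u t ≤ K) : HB (u t) (vK n K) :=
  hb_of hn (h.sch t).h1 ((MM_u u t).trans hK) fun j => (MM_pd u t j).trans hK

lemma dt_shift (u : ℝ → Rn n → ℂ) (h t : ℝ) (x : Rn n) : dt (fun τ => u (τ + h)) t x = dt u (t + h) x := by
  unfold dt
  exact deriv_comp_add_const (fun s => u s x) h t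

lemma Sol.shift (hu : Sol lam ε u) (h : ℝ) : Sol lam ε (fun τ => u (τ + h)) where
  js := by
    have h2 : ContDiff ℝ (⊤ : ℕ∞) fun p : ℝ × Rn n => ((p.1 + h, p.2) : ℝ × Rn n) := by fun_prop
    exact ContDiff.comp (g := fun p : ℝ × Rn n => u p.1 p.2) hu.js h2
  sch t := hu.sch _
  eq t x := by rw [dt_shift]; exact hu.eq _ _

lemma Sol.static (hn : 2 ≤ n) (hε : 0 < ε) (hu : Sol lam ε u) (s : ℝ) :
    SolS lam ε (fun _ => u s) (fun _ x => -(Complex.I * (ε : ℂ)) * dt u s x) where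
  js := ContDiff.comp (g := u s) (hu.js.slice s) contDiff_snd
  h1 t := (hu.sch s).h1
  eq t x := by
    have e : dt (fun _ => u s) t x = 0 := by unfold dt; simp
    rw [e]
    linear_combination hu.eq s x

lemma lipL (hn : 2 ≤ n) (hlam : 0 ≤ lam) (hε : 0 < ε) (hu : Sol lam ε u) {a b K : ℝ}
    (hK : ∀ t ∈ Set.Icc a b, MM u t ≤ K) {s t : ℝ} (hs : s ∈ Set.Icc a b) (ht : t ∈ Set.Icc a b) :
    nL (fun x => u t x - u s x) ≤ nL (dt u s) * |t - s| * Real.exp (ε⁻¹ * (2 * lam * vK n K) * |t - s|) := by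
  have h := stab hlam hε hu.solS (hu.static hn hε s) (a := a) (b := b) (M := K)
    (c0 := fun _ => ε * nL (dt u s)) (c := fun _ => vK n K) continuous_const
    (fun _ => mul_nonneg hε.le (nL_nonneg _)) continuous_const (fun _ => vK_nonneg K)
    (fun τ hτ => hb_MM hn hu (hK τ hτ)) (fun τ hτ => hb_MM hn hu (hK s hs))
    (fun τ hτ => (MM_u u τ).trans (hK τ hτ)) (fun τ hτ => (MM_u u s).trans (hK s hs))
    (fun τ hτ j => (MM_pd u τ j).trans (hK τ hτ)) (fun τ hτ j => (MM_pd u s j).trans (hK s hs))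
    (fun τ hτ => (hu.dtL hn hε s).const_mul _)
    (fun τ hτ => by rw [nL_const_mul]; simp [abs_of_pos hε]) hs ht
  refine h.trans (le_of_eq ?_)
  have e0 : nL (fun x => u s x - u s x) = 0 := by
    unfold nL; simp
  rw [e0, intervalIntegral.integral_const, intervalIntegral.integral_const, smul_eq_mul, smul_eq_mul, abs_mul (t - s),
    abs_mul (t - s), abs_of_nonneg (mul_nonneg hε.le (nL_nonneg _)),
    abs_of_nonneg (mul_nonneg (mul_nonneg (by norm_num) hlam) (vK_nonneg K))]
  congr 1
  · field_simp; ring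
  · congr 1; ring

lemma mass_const (hε : 0 < ε) (hu : Sol lam ε u) {a b K : ℝ}
    (hK : ∀ t ∈ Set.Icc a b, MM u t ≤ K) {s t : ℝ} (has : a ≤ s) (hst : s ≤ t) (htb : t ≤ b) :
    nL (u t) = nL (u s) := by
  have h := l2_diff hu.js hε (a := a) (b := b) (M := K) (P := fun t x => ‖x‖ ^ 2 / 2 + lam * hartree 1 (u t) x)
    (G := fun _ _ => 0) (g := fun _ => 0)
    (fun t _ x => by rw [hu.eq]; push_cast; ring) (fun t _ => (hu.sch t).memLp) (fun t _ j => ((hu.sch t).pd j).memLp)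
    (fun t ht => (MM_u u t).trans (hK t ht)) (fun t ht j => (MM_pd u t j).trans (hK t ht))
    (fun t _ => MemLp.zero') continuous_const (fun _ => le_rfl) (fun t _ => by unfold nL; simp) has hst htb
  simp at h
  linarith

lemma dq (h : JS u) (t : ℝ) (x : Rn n) {hk : ℕ → ℝ} (h0 : Tendsto hk atTop (𝓝 0)) (hne : ∀ k, hk k ≠ 0) :
    Tendsto (fun k => (((hk k)⁻¹ : ℝ) : ℂ) * (u (t + hk k) x - u t x)) atTop (𝓝 (dt u t x)) := by
  have h1 := (h.hasDerivAt t x).tendsto_slope_zero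
  have h2 : Tendsto hk atTop (𝓝[≠] 0) := tendsto_nhdsWithin_iff.2 ⟨h0, Eventually.of_forall hne⟩
  have := h1.comp h2
  refine this.congr fun k => ?_
  simp

lemma beta_le (hn : 2 ≤ n) (hlam : 0 ≤ lam) (hε : 0 < ε) (hu : Sol lam ε u) {a b K : ℝ}
    (hK : ∀ t ∈ Set.Icc a b, MM u t ≤ K) {t : ℝ} (hat : a ≤ t) (htb : t < b) :
    nL (dt u t) ≤ nL (dt u a) * Real.exp (2 * (ε⁻¹ * (2 * lam * vK n K) * (b - a))) := by
  set L := ε⁻¹ * (2 * lam * vK n K) with hL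
  have hL0 : 0 ≤ L := mul_nonneg (inv_nonneg.2 hε.le) (mul_nonneg (by positivity) (vK_nonneg K))
  set hk : ℕ → ℝ := fun k => (b - t) / (k + 1) with hhk
  have hkp : ∀ k, 0 < hk k := fun k => div_pos (by linarith) (by positivity)
  have hkb : ∀ k, t + hk k ≤ b := by
    intro k
    have : hk k ≤ b - t := div_le_self (by linarith) (by linarith [(Nat.cast_nonneg k : (0:ℝ) ≤ k)])
    linarith
  have hk0 : Tendsto hk atTop (𝓝 0) := by
    have := (tendsto_one_div_add_atTop_nhds_zero_nat (𝕜 := ℝ)).const_mul (b - t)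
    simpa [hhk, div_eq_mul_inv] using this
  have bound : ∀ k, nL (fun x => (((hk k)⁻¹ : ℝ) : ℂ) * (u (t + hk k) x - u t x)) ≤
      nL (dt u a) * Real.exp (2 * (L * (b - a))) := by
    intro k
    have hsub : ∀ τ ∈ Set.Icc a t, τ ∈ Set.Icc a b := fun τ hτ => ⟨hτ.1, hτ.2.trans htb.le⟩
    have hsub' : ∀ τ ∈ Set.Icc a t, τ + hk k ∈ Set.Icc a b := fun τ hτ =>
      ⟨by linarith [hτ.1, hkp k], by linarith [hτ.2, hkb k]⟩
    have h := stab hlam hε (hu.shift (hk k)).solS hu.solS (a := a) (b := t) (M := K)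
      (c0 := fun _ => 0) (c := fun _ => vK n K) continuous_const
      (fun _ => le_rfl) continuous_const (fun _ => vK_nonneg K)
      (fun τ hτ => hb_MM hn hu (hK _ (hsub' τ hτ))) (fun τ hτ => hb_MM hn hu (hK τ (hsub τ hτ)))
      (fun τ hτ => (MM_u u _).trans (hK _ (hsub' τ hτ))) (fun τ hτ => (MM_u u τ).trans (hK τ (hsub τ hτ)))
      (fun τ hτ j => (MM_pd u _ j).trans (hK _ (hsub' τ hτ))) (fun τ hτ j => (MM_pd u τ j).trans (hK τ (hsub τ hτ)))
      (fun τ hτ => MemLp.zero')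
      (fun τ hτ => by unfold nL; simp) (s := a) (t := t) ⟨le_rfl, hat⟩ ⟨hat, le_rfl⟩
    have h2 := lipL hn hlam hε hu hK (s := a) (t := a + hk k) ⟨le_rfl, by linarith⟩ (hsub' a ⟨le_rfl, hat⟩)
    rw [intervalIntegral.integral_const, intervalIntegral.integral_const, smul_zero, abs_zero, mul_zero, add_zero,
      smul_eq_mul, abs_mul, abs_of_nonneg (by linarith : 0 ≤ t - a),
      abs_of_nonneg (mul_nonneg (mul_nonneg (by norm_num) hlam) (vK_nonneg K))] at h
    have e1 : ε⁻¹ * ((t - a) * (2 * lam * vK n K)) = L * (t - a) := by rw [hL]; ring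
    rw [e1] at h
    have e2 : a + hk k - a = hk k := by ring
    rw [e2, abs_of_pos (hkp k), ← hL] at h2
    rw [nL_const_mul, Complex.norm_real, Real.norm_eq_abs, abs_of_pos (inv_pos.2 (hkp k)),
      inv_mul_le_iff₀ (hkp k)]
    refine h.trans ((mul_le_mul_of_nonneg_right h2 (Real.exp_pos _).le).trans ?_)
    rw [mul_assoc, ← Real.exp_add]
    have h3 : Real.exp (L * hk k + L * (t - a)) ≤ Real.exp (2 * (L * (b - a))) := by
      refine Real.exp_le_exp.2 ?_
      have i1 : hk k ≤ b - a := by linarith [hkb k]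
      have i2 : t - a ≤ b - a := by linarith
      nlinarith [mul_le_mul_of_nonneg_left i1 hL0, mul_le_mul_of_nonneg_left i2 hL0]
    have := mul_le_mul_of_nonneg_left h3 (mul_nonneg (nL_nonneg (dt u a)) (hkp k).le)
    linarith
  refine nL_le_of (mul_nonneg (nL_nonneg _) (Real.exp_pos _).le) ?_
  refine nL_fatou (mul_nonneg (nL_nonneg _) (Real.exp_pos _).le) (fun k => ?_)
    (fun x => dq hu.js t x hk0 fun k => (hkp k).ne') (Eventually.of_forall bound).frequently
  exact ((hu.sch _).sub (hu.sch _)).memLp.const_mul _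

end lb

section en2
variable {n : ℕ} {lam ε : ℝ} {u : ℝ → Rn n → ℂ}

lemma pot_diff_le (hu : Sol lam ε u) {s t v : ℝ} (hv : 0 ≤ v) (hs : HB (u s) v) (ht : HB (u t) v) :
    |∫ x, (hartree 1 (u t) x - hartree 1 (u s) x) * ‖u t x - u s x‖ ^ 2| ≤ v * nL (fun x => u t x - u s x) ^ 2 := by
  have hd := ((hu.sch t).sub (hu.sch s)).memLp
  rw [nL_sq hd, ← integral_const_mul, ← Real.norm_eq_abs]
  refine norm_integral_le_of_norm_le ((nL_sq_int hd).const_mul v) (ae_of_all _ fun x => ?_)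
  rw [norm_mul, Real.norm_eq_abs, Real.norm_eq_abs, abs_of_nonneg (by positivity : 0 ≤ ‖u t x - u s x‖ ^ 2)]
  refine mul_le_mul_of_nonneg_right ?_ (by positivity)
  have a1 := hartree_nonneg (u t) x
  have a2 := hartree_nonneg (u s) x
  have a3 := hartree_le (hu.js.slice t).continuous ht hv x
  have a4 := hartree_le (hu.js.slice s).continuous hs hv x
  rw [abs_le]; constructor <;> linarith

lemma en_lip (hn : 2 ≤ n) (hlam : 0 ≤ lam) (hε : 0 < ε) (hu : Sol lam ε u) {a b K B : ℝ}
    (hK : ∀ t ∈ Set.Icc a b, MM u t ≤ K) (hB : ∀ t ∈ Set.Icc a b, nL (dt u t) ≤ B) {s t : ℝ}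
    (hs : s ∈ Set.Icc a b) (ht : t ∈ Set.Icc a b) :
    |En lam ε (u t) - En lam ε (u s)| ≤ ε * B * nL (fun x => u t x - u s x)
      + lam / 4 * vK n K * nL (fun x => u t x - u s x) ^ 2 := by
  rw [en_id hn hε hu]
  have hd := ((hu.sch t).sub (hu.sch s)).memLp
  have hdt : MemLp (fun x => dt u t x + dt u s x) 2 volume := (hu.dtL hn hε t).add (hu.dtL hn hε s)
  have h1 := rip_le' hd (hdt.const_mul Complex.I)
  rw [nL_const_mul, Complex.norm_I, one_mul] at h1
  have h2 := nL_add_le (hu.dtL hn hε t) (hu.dtL hn hε s)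
  have h3 := pot_diff_le hu (vK_nonneg K) (hb_MM hn hu (hK s hs)) (hb_MM hn hu (hK t ht))
  refine (abs_sub _ _).trans ?_
  rw [abs_mul, abs_mul, abs_of_pos (by linarith : 0 < ε / 2), abs_of_nonneg (by linarith : 0 ≤ lam / 4)]
  have h4 : nL (fun x => dt u t x + dt u s x) ≤ 2 * B := by linarith [hB s hs, hB t ht]
  have h5 := h1.trans (mul_le_mul_of_nonneg_left h4 (nL_nonneg _))
  have h6 := mul_le_mul_of_nonneg_left h5 (by linarith : 0 ≤ ε / 2)
  have h7 := mul_le_mul_of_nonneg_left h3 (by linarith : 0 ≤ lam / 4)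
  linarith

lemma en_seq (hn : 2 ≤ n) (hlam : 0 ≤ lam) (hε : 0 < ε) (hu : Sol lam ε u) {a b K B : ℝ}
    (hK : ∀ t ∈ Set.Icc a b, MM u t ≤ K) (hB : ∀ t ∈ Set.Icc a b, nL (dt u t) ≤ B) {s : ℝ}
    (hs : s ∈ Set.Icc a b) {h : ℕ → ℝ} (hp : ∀ k, 0 < h k) (hb : ∀ k, s + h k ≤ b) (h0 : Tendsto h atTop (𝓝 0)) :
    Tendsto (fun k => (h k)⁻¹ * (En lam ε (u (s + h k)) - En lam ε (u s))) atTop (𝓝 0) := by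
  have hI : ∀ k, s + h k ∈ Set.Icc a b := fun k => ⟨by linarith [hs.1, hp k], hb k⟩
  have hB0 : 0 ≤ B := (nL_nonneg _).trans (hB s hs)
  set L := ε⁻¹ * (2 * lam * vK n K) with hL
  have hL0 : 0 ≤ L := mul_nonneg (inv_nonneg.2 hε.le) (mul_nonneg (by positivity) (vK_nonneg K))
  set p := dt u s with hpdef
  have hpL : MemLp p 2 volume := hu.dtL hn hε s
  set q : ℕ → Rn n → ℂ := fun k x => (((h k)⁻¹ : ℝ) : ℂ) * (u (s + h k) x - u s x) with hq
  have hqL : ∀ k, MemLp (q k) 2 volume := fun k => ((hu.sch _).sub (hu.sch _)).memLp.const_mul _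
  have hqn : ∀ k, nL (q k) = (h k)⁻¹ * nL (fun x => u (s + h k) x - u s x) := by
    intro k
    rw [hq, nL_const_mul, Complex.norm_real, Real.norm_eq_abs, abs_of_pos (inv_pos.2 (hp k))]
  have hqb : ∀ k, nL (q k) ≤ nL p * Real.exp (L * h k) := by
    intro k
    have := lipL hn hlam hε hu hK hs (hI k)
    rw [add_sub_cancel_left, abs_of_pos (hp k), ← hL] at this
    rw [hqn, inv_mul_le_iff₀ (hp k)]
    linarith
  have hhb : ∀ k, h k ≤ b - a := fun k => by linarith [hb k, hs.1]
  have hqB : ∀ k, nL (q k) ≤ B * Real.exp (L * (b - a)) := fun k => (hqb k).trans <|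
    mul_le_mul (hB s hs) (Real.exp_le_exp.2 (mul_le_mul_of_nonneg_left (hhb k) hL0)) (Real.exp_pos _).le hB0
  have hqlim : ∀ x, Tendsto (fun k => q k x) atTop (𝓝 (p x)) := fun x => dq hu.js s x h0 fun k => (hp k).ne'
  set d : ℕ → Rn n → ℂ := fun k x => q k x - p x with hd
  have hdL : ∀ k, MemLp (d k) 2 volume := fun k => (hqL k).sub hpL
  have hdlim : ∀ x, Tendsto (fun k => d k x) atTop (𝓝 0) := fun x => by
    have := (hqlim x).sub_const (p x)
    rwa [sub_self] at this
  have w1 : Tendsto (fun k => ∫ x, ‖d k x‖ * ‖p x‖) atTop (𝓝 0) :=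
    weak_lim (M := B * Real.exp (L * (b - a)) + B) hdL hpL hdlim
      (fun k => (nL_sub_le (hqL k) hpL).trans (add_le_add (hqB k) (hB s hs)))
  set r : ℕ → Rn n → ℂ := fun k x => dt u (s + h k) x - p x with hr
  have hrL : ∀ k, MemLp (r k) 2 volume := fun k => (hu.dtL hn hε _).sub hpL
  have hrlim : ∀ x, Tendsto (fun k => r k x) atTop (𝓝 0) := fun x => by
    have h1 : Continuous fun τ => dt u τ x := (hu.js.dt.tslice x).continuous
    have h2 : Tendsto (fun k => s + h k) atTop (𝓝 s) := by simpa using h0.const_add s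
    have := ((h1.tendsto s).comp h2).sub_const (p x)
    rwa [sub_self] at this
  have w2 : Tendsto (fun k => ∫ x, ‖r k x‖ * ‖p x‖) atTop (𝓝 0) :=
    weak_lim (M := B + B) hrL hpL hrlim
      (fun k => (nL_sub_le (hu.dtL hn hε _) hpL).trans (add_le_add (hB _ (hI k)) (hB s hs)))
  -- strong convergence
  have hd2 : ∀ k, nL (d k) ^ 2 ≤ nL p ^ 2 * (Real.exp (L * h k) ^ 2 - 1) + 2 * ∫ x, ‖d k x‖ * ‖p x‖ := by
    intro k
    have e1 : nL (d k) ^ 2 ≤ nL (q k) ^ 2 - nL p ^ 2 + 2 * ∫ x, ‖d k x‖ * ‖p x‖ := by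
      have i3 := (nL_mul_int (hdL k) hpL).const_mul 2
      have i12 : Integrable (fun x => ‖q k x‖ ^ 2 - ‖p x‖ ^ 2) volume := (nL_sq_int (hqL k)).sub (nL_sq_int hpL)
      rw [nL_sq (hdL k), nL_sq (hqL k), nL_sq hpL, ← integral_const_mul, ← integral_sub (nL_sq_int (hqL k)) (nL_sq_int hpL),
        ← integral_add i12 i3]
      refine integral_mono (nL_sq_int (hdL k)) (i12.add i3) fun x => ?_
      have e2 : ‖q k x‖ ^ 2 = ‖p x‖ ^ 2 + 2 * (conj (d k x) * p x).re + ‖d k x‖ ^ 2 := by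
        have : q k x = p x + d k x := by simp [hd]
        rw [this]
        simp only [Complex.sq_norm, Complex.normSq_apply, Complex.mul_re, Complex.conj_re, Complex.conj_im,
          Complex.add_re, Complex.add_im]
        ring
      have e3 : |(conj (d k x) * p x).re| ≤ ‖d k x‖ * ‖p x‖ := (Complex.abs_re_le_norm _).trans (by simp)
      have := (abs_le.1 e3).1
      simp only [Pi.add_apply]
      linarith
    have e4 : nL (q k) ^ 2 ≤ (nL p * Real.exp (L * h k)) ^ 2 := pow_le_pow_left₀ (nL_nonneg _) (hqb k) 2
    rw [mul_pow] at e4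
    linarith
  have hdn : Tendsto (fun k => nL (d k)) atTop (𝓝 0) := by
    have t1 : Tendsto (fun k => nL p ^ 2 * (Real.exp (L * h k) ^ 2 - 1) + 2 * ∫ x, ‖d k x‖ * ‖p x‖) atTop (𝓝 0) := by
      have : Tendsto (fun k => Real.exp (L * h k)) atTop (𝓝 1) := by
        have := (Real.continuous_exp.tendsto _).comp (h0.const_mul L)
        simpa [Function.comp_def] using this
      have := (((this.pow 2).sub_const 1).const_mul (nL p ^ 2)).add (w1.const_mul 2)
      simpa using this
    have t2 := squeeze_zero (fun k => sq_nonneg (nL (d k))) hd2 t1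
    have t3 := (Real.continuous_sqrt.tendsto _).comp t2
    simpa [Function.comp_def, Real.sqrt_sq (nL_nonneg _)] using t3
  -- conclusion
  set v := vK n K with hv
  have hv0 : 0 ≤ v := vK_nonneg K
  have fin : ∀ k, ‖(h k)⁻¹ * (En lam ε (u (s + h k)) - En lam ε (u s))‖ ≤
      ε / 2 * ((∫ x, ‖r k x‖ * ‖p x‖) + nL (d k) * (2 * B)) + lam / 4 * (v * (h k * (B * Real.exp (L * (b - a))) ^ 2)) := by
    intro k
    rw [en_id hn hε hu, mul_sub]
    have hdt : MemLp (fun x => dt u (s + h k) x + p x) 2 volume := (hu.dtL hn hε _).add hpL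
    have c1 : (h k)⁻¹ * (ε / 2 * rip (fun x => u (s + h k) x - u s x) fun x => Complex.I * (dt u (s + h k) x + dt u s x))
       = ε / 2 * rip (q k) (fun x => Complex.I * (dt u (s + h k) x + p x)) := by
      have : rip (q k) (fun x => Complex.I * (dt u (s + h k) x + p x)) = (h k)⁻¹ *
          rip (fun x => u (s + h k) x - u s x) fun x => Complex.I * (dt u (s + h k) x + dt u s x) := by
        unfold rip
        rw [← integral_const_mul]
        refine integral_congr_ae (ae_of_all _ fun x => ?_)
        simp only [hq]
        rw [← Complex.re_ofReal_mul, map_mul, Complex.conj_ofReal]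
        congr 1; ring
      rw [this]; ring
    have c2 : |rip (q k) (fun x => Complex.I * (dt u (s + h k) x + p x))| ≤
        (∫ x, ‖r k x‖ * ‖p x‖) + nL (d k) * (2 * B) := by
      have i1 := nL_mul_int (hrL k) hpL
      have i2 := nL_mul_int (hdL k) hdt
      have : |rip (q k) (fun x => Complex.I * (dt u (s + h k) x + p x))| ≤
          ∫ x, (‖r k x‖ * ‖p x‖ + ‖d k x‖ * ‖dt u (s + h k) x + p x‖) := by
        unfold rip
        rw [← Real.norm_eq_abs]
        refine norm_integral_le_of_norm_le (i1.add i2) (ae_of_all _ fun x => ?_)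
        have e1 : (conj (q k x) * (Complex.I * (dt u (s + h k) x + p x))).re =
            (conj (p x) * (Complex.I * r k x)).re + (conj (d k x) * (Complex.I * (dt u (s + h k) x + p x))).re := by
          have f1 : q k x = p x + d k x := by simp [hd]
          have f2 : dt u (s + h k) x = p x + r k x := by simp [hr]
          rw [f1, f2]
          simp only [Complex.mul_re, Complex.mul_im, Complex.conj_re, Complex.conj_im, Complex.I_re, Complex.I_im,
            Complex.add_re, Complex.add_im, map_add]
          ring
        rw [e1]
        refine (norm_add_le _ _).trans (add_le_add ?_ ?_)
        · refine (Complex.abs_re_le_norm _).trans (le_of_eq ?_)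
          simp [mul_comm]
        · refine (Complex.abs_re_le_norm _).trans (le_of_eq ?_)
          simp
      refine this.trans ?_
      rw [integral_add i1 i2]
      refine add_le_add le_rfl ((nL_mul (hdL k) hdt).trans ?_)
      refine mul_le_mul_of_nonneg_left ?_ (nL_nonneg _)
      exact (nL_add_le (hu.dtL hn hε _) hpL).trans (by linarith [hB _ (hI k), hB s hs])
    have c3 := pot_diff_le hu hv0 (hb_MM hn hu (hK s hs)) (hb_MM hn hu (hK _ (hI k)))
    have c4 : nL (fun x => u (s + h k) x - u s x) = h k * nL (q k) := by
      rw [hqn]; field_simp [(hp k).ne']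
    rw [c4] at c3
    rw [c1]
    refine (norm_sub_le _ _).trans (add_le_add ?_ ?_)
    · rw [norm_mul, Real.norm_eq_abs, Real.norm_eq_abs, abs_of_pos (by linarith : 0 < ε / 2)]
      exact mul_le_mul_of_nonneg_left c2 (by linarith)
    · rw [norm_mul, norm_mul, Real.norm_eq_abs, Real.norm_eq_abs, Real.norm_eq_abs, abs_of_pos (inv_pos.2 (hp k)),
        abs_of_nonneg (by linarith : 0 ≤ lam / 4), mul_left_comm]
      refine mul_le_mul_of_nonneg_left ?_ (by linarith)
      rw [inv_mul_le_iff₀ (hp k)]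
      refine c3.trans ?_
      have : (h k * nL (q k)) ^ 2 ≤ (h k * (B * Real.exp (L * (b - a)))) ^ 2 :=
        pow_le_pow_left₀ (mul_nonneg (hp k).le (nL_nonneg _)) (mul_le_mul_of_nonneg_left (hqB k) (hp k).le) 2
      refine (mul_le_mul_of_nonneg_left this hv0).trans (le_of_eq ?_)
      ring
  refine squeeze_zero_norm fin ?_
  have := ((w2.add (hdn.mul_const (2 * B))).const_mul (ε / 2)).add
    (((h0.mul_const ((B * Real.exp (L * (b - a))) ^ 2)).const_mul v).const_mul (lam / 4))
  simpa using this

end en2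

section en3
variable {n : ℕ} {lam ε : ℝ} {u : ℝ → Rn n → ℂ}

lemma en_const (hn : 2 ≤ n) (hlam : 0 ≤ lam) (hε : 0 < ε) (hu : Sol lam ε u) {a b K : ℝ} (hab : a ≤ b)
    (hK : ∀ t ∈ Set.Icc a b, MM u t ≤ K) : ∀ t ∈ Set.Icc a b, En lam ε (u t) = En lam ε (u a) := by
  set B := max (nL (dt u a) * Real.exp (2 * (ε⁻¹ * (2 * lam * vK n K) * (b - a)))) (nL (dt u b)) with hBdef
  have hB : ∀ t ∈ Set.Icc a b, nL (dt u t) ≤ B := by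
    intro t ht
    rcases ht.2.lt_or_eq with h | h
    · exact (beta_le hn hlam hε hu hK ht.1 h).trans (le_max_left _ _)
    · rw [h]; exact le_max_right _ _
  have hB0 : 0 ≤ B := (nL_nonneg _).trans (le_max_right _ _)
  refine constant_of_has_deriv_right_zero ?_ ?_
  · intro s hs
    set L := ε⁻¹ * (2 * lam * vK n K) with hL
    have hN : Tendsto (fun t => nL (fun x => u t x - u s x)) (𝓝[Set.Icc a b] s) (𝓝 0) := by
      have h1 : ∀ᶠ t in 𝓝[Set.Icc a b] s, nL (fun x => u t x - u s x) ≤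
          nL (dt u s) * |t - s| * Real.exp (L * |t - s|) := by
        filter_upwards [self_mem_nhdsWithin] with t ht
        exact lipL hn hlam hε hu hK hs ht
      have h2 : Tendsto (fun t => nL (dt u s) * |t - s| * Real.exp (L * |t - s|)) (𝓝[Set.Icc a b] s) (𝓝 0) := by
        have : Continuous fun t => nL (dt u s) * |t - s| * Real.exp (L * |t - s|) := by fun_prop
        have := (this.tendsto s).mono_left (nhdsWithin_le_nhds (s := Set.Icc a b))
        simpa using this
      exact squeeze_zero' (Eventually.of_forall fun t => nL_nonneg _) h1 h2
    have h3 : Tendsto (fun t => ε * B * nL (fun x => u t x - u s x)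
      + lam / 4 * vK n K * nL (fun x => u t x - u s x) ^ 2) (𝓝[Set.Icc a b] s) (𝓝 0) := by
      have := (hN.const_mul (ε * B)).add ((hN.pow 2).const_mul (lam / 4 * vK n K))
      simpa using this
    have h4 : Tendsto (fun t => En lam ε (u t) - En lam ε (u s)) (𝓝[Set.Icc a b] s) (𝓝 0) := by
      refine squeeze_zero_norm' ?_ h3
      filter_upwards [self_mem_nhdsWithin] with t ht
      exact en_lip hn hlam hε hu hK hB hs ht
    have := h4.add_const (En lam ε (u s))
    simpa [ContinuousWithinAt] using this
  · intro s hs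
    rw [← hasDerivWithinAt_Ioi_iff_Ici, hasDerivWithinAt_iff_tendsto_slope' (show s ∉ Set.Ioi s from lt_irrefl s)]
    refine tendsto_of_seq_tendsto fun x hx => ?_
    obtain ⟨hx1, hx2⟩ := tendsto_nhdsWithin_iff.1 hx
    have hx3 : ∀ᶠ k in atTop, x k < b := hx1.eventually (gt_mem_nhds hs.2)
    obtain ⟨N, hN⟩ := eventually_atTop.1 (hx2.and hx3)
    rw [← tendsto_add_atTop_iff_nat N]
    have hx4 : Tendsto (fun k => x (k + N) - s) atTop (𝓝 0) := by
      have := ((tendsto_add_atTop_iff_nat N).2 hx1).sub_const s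
      rwa [sub_self] at this
    have := en_seq hn hlam hε hu hK hB ⟨hs.1, hs.2.le⟩ (h := fun k => x (k + N) - s)
      (fun k => sub_pos.2 (hN (k + N) (by omega)).1) (fun k => by
        have := (hN (k + N) (by omega)).2
        linarith) hx4
    refine this.congr fun k => ?_
    simp [slope_def_field, div_eq_inv_mul]

lemma pot_nonneg (φ : Rn n → ℂ) : 0 ≤ ∫ x, hartree 1 φ x * ‖φ x‖ ^ 2 :=
  integral_nonneg fun x => mul_nonneg (hartree_nonneg _ _) (by positivity)

lemma pot_le {φ : Rn n → ℂ} (h : H1 φ) {v : ℝ} (hv : 0 ≤ v) (hB : HB φ v) :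
    ∫ x, hartree 1 φ x * ‖φ x‖ ^ 2 ≤ v * nL φ ^ 2 := by
  rw [nL_sq h.l2, ← integral_const_mul]
  refine integral_mono (pot_int h.sm.continuous hB hv h.l2) ((nL_sq_int h.l2).const_mul v) fun x => ?_
  exact mul_le_mul_of_nonneg_right (hartree_le h.sm.continuous hB hv x) (by positivity)

lemma gap (hn : 2 ≤ n) (hlam : 0 ≤ lam) (hε : 0 < ε) (hu : Sol lam ε u) (k : ℝ) : ∃ k', ∀ a b K : ℝ,
    (∀ t ∈ Set.Icc a b, MM u t ≤ K) → ∀ s ∈ Set.Icc a b, ∀ t ∈ Set.Icc a b, MM u s ≤ k → MM u t ≤ k' := by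
  set E : ℝ := n * (ε ^ 2 / 4 * k ^ 2 + 1 / 4 * k ^ 2) + lam / 4 * (vK n k * k ^ 2) with hE
  refine ⟨k + n * (Real.sqrt (4 * E / ε ^ 2) + Real.sqrt (4 * E)), ?_⟩
  intro a b K hK s hs t ht hk
  have hk0 : 0 ≤ k := (MM_nonneg u s).trans hk
  have hab : a ≤ b := hs.1.trans hs.2
  have e1 := en_const hn hlam hε hu hab hK
  have e2 : En lam ε (u t) = En lam ε (u s) := by rw [e1 t ht, e1 s hs]
  have e3 : En lam ε (u s) ≤ E := by
    unfold En
    refine add_le_add ?_ ?_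
    · calc _ ≤ ∑ j : Fin n, (ε ^ 2 / 4 * k ^ 2 + 1 / 4 * k ^ 2) := by
            refine Finset.sum_le_sum fun j _ => ?_
            gcongr
            · exact nL_nonneg _
            · exact (MM_pd u s j).trans hk
            · exact nL_nonneg _
            · exact (MM_x u s j).trans hk
        _ = _ := by rw [Finset.sum_const, Finset.card_univ, Fintype.card_fin, nsmul_eq_mul]
    · refine mul_le_mul_of_nonneg_left ?_ (by linarith)
      refine (pot_le (hu.sch s).h1 (vK_nonneg k) (hb_MM hn hu hk)).trans ?_
      exact mul_le_mul_of_nonneg_left (pow_le_pow_left₀ (nL_nonneg _) ((MM_u u s).trans hk) 2) (vK_nonneg k)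
  have e4 : ∀ j, ε ^ 2 / 4 * nL (pd j (u t)) ^ 2 + 1 / 4 * nL (fun x => ((x j : ℝ) : ℂ) * u t x) ^ 2 ≤ E := by
    intro j
    refine le_trans ?_ (e2.trans_le e3)
    unfold En
    have := Finset.single_le_sum (f := fun j => ε ^ 2 / 4 * nL (pd j (u t)) ^ 2 + 1 / 4 * nL (fun x => ((x j : ℝ) : ℂ) * u t x) ^ 2)
      (fun j _ => by positivity) (Finset.mem_univ j)
    have h2 := mul_nonneg (by linarith : 0 ≤ lam / 4) (pot_nonneg (u t))
    linarith
  have e5 : nL (u t) = nL (u s) := by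
    rcases le_total s t with h | h
    · exact mass_const hε hu hK hs.1 h ht.2
    · exact (mass_const hε hu hK ht.1 h hs.2).symm
  unfold MM
  refine add_le_add (e5.trans_le ((MM_u u s).trans hk)) ?_
  calc _ ≤ ∑ j : Fin n, (Real.sqrt (4 * E / ε ^ 2) + Real.sqrt (4 * E)) := by
        refine Finset.sum_le_sum fun j _ => ?_
        have p1 := sq_nonneg (nL (fun x => ((x j : ℝ) : ℂ) * u t x))
        have p2 := mul_nonneg (sq_nonneg ε) (sq_nonneg (nL (pd j (u t))))
        refine add_le_add (Real.le_sqrt_of_sq_le ?_) (Real.le_sqrt_of_sq_le ?_)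
        · rw [le_div_iff₀ (by positivity)]
          linarith [e4 j]
        · linarith [e4 j]
    _ = _ := by rw [Finset.sum_const, Finset.card_univ, Fintype.card_fin, nsmul_eq_mul]

/-- Lower semicontinuity. -/
lemma nL_lsc {z : ℝ → Rn n → ℂ} (hz : ∀ x, Continuous fun t => z t x) (hL : ∀ t, MemLp (z t) 2 volume)
    {t : ℕ → ℝ} {s c : ℝ} (ht : Tendsto t atTop (𝓝 s)) (hc : ∃ᶠ k in atTop, nL (z (t k)) ≤ c) : nL (z s) ≤ c := by
  have hc0 : 0 ≤ c := by
    obtain ⟨k, hk⟩ := hc.exists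
    exact (nL_nonneg _).trans hk
  exact nL_le_of hc0 (nL_fatou hc0 (fun k => hL _) (fun x => ((hz x).tendsto s).comp ht) hc)

/-- Frequent version of closedness: bounded sequences. -/
lemma pd_cont (hu : JS u) (j : Fin n) (x : Rn n) : Continuous fun t => pd j (u t) x := by
  have h1 : ContDiff ℝ (⊤ : ℕ∞) (fun p : ℝ × Rn n => fderiv ℝ (fun p : ℝ × Rn n => u p.1 p.2) p (0, eb j)) :=
    (ContDiff.fderiv_right (m := (⊤ : ℕ∞)) hu (by simp)).clm_apply contDiff_const
  have h2 : ∀ t, pd j (u t) x = fderiv ℝ (fun p : ℝ × Rn n => u p.1 p.2) (t, x) (0, eb j) := by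
    intro t
    have h3 : HasFDerivAt (fun p : ℝ × Rn n => u p.1 p.2) (fderiv ℝ (fun p : ℝ × Rn n => u p.1 p.2) (t, x)) (t, x) :=
      (ContDiff.differentiable hu (by simp) _).hasFDerivAt
    have h4 := h3.comp x (hasFDerivAt_prodMk_right t x)
    have h5 : fderiv ℝ (u t) x = _ := h4.fderiv
    unfold pd
    rw [h5]; rfl
  simp_rw [h2]
  exact h1.continuous.comp (by fun_prop : Continuous fun t : ℝ => (t, x))

end en3

lemma bdd_of_loc {M : ℝ → ℝ} {a b : ℝ} (h : ∀ t ∈ Set.Icc a b, ∃ K, ∀ᶠ s in 𝓝 t, M s ≤ K) :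
    ∃ K, ∀ t ∈ Set.Icc a b, M t ≤ K := by
  refine isCompact_Icc.induction_on (p := fun s => ∃ K, ∀ t ∈ s, M t ≤ K) ⟨0, fun t ht => absurd ht (by simp)⟩
    (fun s t hst ⟨K, hK⟩ => ⟨K, fun x hx => hK x (hst hx)⟩) ?_ ?_
  · rintro s t ⟨K, hK⟩ ⟨L, hL⟩
    refine ⟨max K L, fun x hx => ?_⟩
    rcases hx with hx | hx
    · exact (hK x hx).trans (le_max_left _ _)
    · exact (hL x hx).trans (le_max_right _ _)
  · intro t ht
    obtain ⟨K, hK⟩ := h t ht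
    exact ⟨{s | M s ≤ K}, mem_nhdsWithin_of_mem_nhds hK, K, fun x hx => hx⟩

lemma baire_bdd {M : ℝ → ℝ} {F : ℕ → Set ℝ} (hc : ∀ k, IsClosed (F k)) (hU : ∀ t, ∃ k, t ∈ F k)
    (hF : ∀ k, ∃ B, ∀ t ∈ F k, M t ≤ B)
    (gap : ∀ k, ∃ k', ∀ a b K : ℝ, (∀ t ∈ Set.Icc a b, M t ≤ K) →
      ∀ s ∈ Set.Icc a b, ∀ t ∈ Set.Icc a b, M s ≤ k → M t ≤ k') (a b : ℝ) :
    ∃ K, ∀ t ∈ Set.Icc a b, M t ≤ K := by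
  suffices H : ∀ t, ∃ K, ∀ᶠ s in 𝓝 t, M s ≤ K from bdd_of_loc fun t _ => H t
  by_contra hcon
  push Not at hcon
  obtain ⟨t1, ht1⟩ := hcon
  set S : Set ℝ := {t | ∃ K, ∀ᶠ s in 𝓝 t, M s ≤ K}ᶜ with hS
  have hSc : IsClosed S := by
    rw [hS, isClosed_compl_iff, isOpen_iff_mem_nhds]
    rintro t ⟨K, hK⟩
    filter_upwards [eventually_eventually_nhds.2 hK] with s hs
    exact ⟨K, hs⟩
  have ht1S : t1 ∈ S := by
    rintro ⟨K, hK⟩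
    exact ht1 K (by simpa [not_lt] using hK)
  have hG : ∀ t, t ∉ S → ∃ K, ∀ᶠ s in 𝓝 t, M s ≤ K := fun t ht => by simpa [hS] using ht
  haveI : CompleteSpace S := hSc.completeSpace_coe
  haveI : Nonempty S := ⟨⟨t1, ht1S⟩⟩
  obtain ⟨k, ⟨t0, ht0⟩⟩ := nonempty_interior_of_iUnion_of_closed (f := fun k => ((↑) : S → ℝ) ⁻¹' (F k))
    (fun k => (hc k).preimage continuous_subtype_val) (by
      ext t
      simpa using hU t)
  obtain ⟨r, hr, hr2⟩ := Metric.mem_nhds_iff.1 (mem_interior_iff_mem_nhds.1 ht0)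
  obtain ⟨B, hB⟩ := hF k
  have hSB : ∀ t ∈ S, dist t t0 < r → M t ≤ B := fun t ht hd => hB t (@hr2 ⟨t, ht⟩ hd)
  obtain ⟨k', hk'⟩ := gap B
  refine t0.2 ⟨max B k', ?_⟩
  filter_upwards [Metric.ball_mem_nhds (t0 : ℝ) hr] with t ht
  rw [Metric.mem_ball] at ht
  by_cases htS : t ∈ S
  · exact (hSB t htS ht).trans (le_max_left _ _)
  refine le_trans ?_ (le_max_right _ _)
  obtain ⟨kt, hkt⟩ := gap (M t)
  rcases lt_or_ge (t0 : ℝ) t with h | h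
  · obtain ⟨a, ⟨haS, ha1, ha2⟩, ha3⟩ := ((isCompact_Icc (a := (t0 : ℝ)) (b := t)).inter_left hSc).exists_isGreatest
      ⟨t0, t0.2, le_refl _, h.le⟩
    have hMa : M a ≤ B := hSB a haS (by
      rw [Real.dist_eq] at ht ⊢
      rw [abs_lt] at ht ⊢
      constructor <;> linarith)
    refine hk' a t (max (M a) kt) ?_ a ⟨le_refl _, ha2⟩ t ⟨ha2, le_refl _⟩ hMa
    intro s hs
    rcases hs.1.eq_or_lt with h1 | h1
    · rw [← h1]; exact le_max_left _ _
    · refine le_trans ?_ (le_max_right _ _)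
      obtain ⟨K, hK⟩ := bdd_of_loc (M := M) (a := s) (b := t) fun x hx => hG x fun hxS =>
        absurd (ha3 ⟨hxS, ⟨by linarith [hx.1], hx.2⟩⟩) (by linarith [hx.1])
      exact hkt s t K hK t ⟨hs.2, le_refl _⟩ s ⟨le_refl _, hs.2⟩ le_rfl
  · obtain ⟨a, ⟨haS, ha1, ha2⟩, ha3⟩ := ((isCompact_Icc (a := t) (b := (t0 : ℝ))).inter_left hSc).exists_isLeast
      ⟨t0, t0.2, h, le_refl _⟩
    have hMa : M a ≤ B := hSB a haS (by
      rw [Real.dist_eq] at ht ⊢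
      rw [abs_lt] at ht ⊢
      constructor <;> linarith)
    refine hk' t a (max (M a) kt) ?_ a ⟨ha1, le_refl _⟩ t ⟨le_refl _, ha1⟩ hMa
    intro s hs
    rcases hs.2.eq_or_lt with h1 | h1
    · rw [h1]; exact le_max_left _ _
    · refine le_trans ?_ (le_max_right _ _)
      obtain ⟨K, hK⟩ := bdd_of_loc (M := M) (a := t) (b := s) fun x hx => hG x fun hxS =>
        absurd (ha3 ⟨hxS, ⟨hx.1, by linarith [hx.2]⟩⟩) (by linarith [hx.2])
      exact hkt t s K hK t ⟨le_refl _, hs.1⟩ s ⟨hs.1, le_refl _⟩ le_rfl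

section fin
variable {n : ℕ} {lam ε : ℝ} {u : ℝ → Rn n → ℂ}

lemma closed_lev {z : ℝ → Rn n → ℂ} (hz : ∀ x, Continuous fun t => z t x) (hL : ∀ t, MemLp (z t) 2 volume)
    (c : ℝ) : IsClosed {t | nL (z t) ≤ c} := by
  refine IsSeqClosed.isClosed fun t s ht hs => ?_
  exact nL_lsc hz hL hs (Eventually.of_forall ht).frequently

lemma MM_bdd (hn : 2 ≤ n) (hlam : 0 ≤ lam) (hε : 0 < ε) (hu : Sol lam ε u) (a b : ℝ) :
    ∃ K, ∀ t ∈ Set.Icc a b, MM u t ≤ K := by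
  refine baire_bdd (F := fun k : ℕ => {t | nL (u t) ≤ k} ∩ ⋂ j, ({t | nL (pd j (u t)) ≤ k} ∩
    {t | nL (fun x => ((x j : ℝ) : ℂ) * u t x) ≤ k})) ?_ ?_ ?_ (gap hn hlam hε hu) a b
  · intro k
    refine (closed_lev (fun x => ?_) (fun t => (hu.sch t).memLp) _).inter (isClosed_iInter fun j =>
      (closed_lev (z := fun t => pd j (u t)) (pd_cont hu.js j) (fun t => ((hu.sch t).pd j).memLp) _).inter
      (closed_lev (z := fun t x => ((x j : ℝ) : ℂ) * u t x) (fun x => ?_) (fun t => ((hu.sch t).coord j).memLp) _))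
    · exact hu.js.cont.comp (by fun_prop : Continuous fun t : ℝ => (t, x))
    · exact continuous_const.mul (hu.js.cont.comp (by fun_prop : Continuous fun t : ℝ => (t, x)))
  · intro t
    obtain ⟨k, hk⟩ := exists_nat_ge (MM u t)
    refine ⟨k, (MM_u u t).trans hk, Set.mem_iInter.2 fun j => ⟨(MM_pd u t j).trans hk, (MM_x u t j).trans hk⟩⟩
  · intro k
    refine ⟨k + ∑ j : Fin n, ((k : ℝ) + k), fun t ht => ?_⟩
    refine add_le_add ht.1 (Finset.sum_le_sum fun j _ => ?_)
    have := Set.mem_iInter.1 ht.2 j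
    exact add_le_add this.1 this.2
end fin

/-- Phase of the Weyl translation. -/
def ph {n : ℕ} (ε c d : ℝ) (j : Fin n) (h : ℝ) (x : Rn n) : ℝ := (h * d * x j - h ^ 2 * c * d / 2) / ε

/-- Weyl translation. -/
def Wt {n : ℕ} (ε c d : ℝ) (j : Fin n) (h : ℝ) (φ : Rn n → ℂ) (x : Rn n) : ℂ :=
  Complex.exp (Complex.I * (ph ε c d j h x : ℂ)) * φ (x - (h * c) • eb j)

/-- Generator. -/
def Op {n : ℕ} (ε c d : ℝ) (j : Fin n) (φ : Rn n → ℂ) (x : Rn n) : ℂ :=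
  (c : ℂ) * pd j φ x - Complex.I * ((d / ε : ℝ) : ℂ) * (((x j : ℝ) : ℂ) * φ x)

section W
variable {n : ℕ} {ε c d : ℝ} {j : Fin n} {h : ℝ} {φ ψ : Rn n → ℂ}

lemma hd_of {f g : ℝ → ℂ} {f' g' : ℂ} {x : ℝ} (h : HasDerivAt f f' x) (e : ∀ s, g s = f s) (e' : g' = f') :
    HasDerivAt g g' x := by
  have : g = f := funext e
  rw [this, e']; exact h

lemma exp_ph (r : ℝ) : ‖Complex.exp (Complex.I * (r : ℂ))‖ = 1 := by
  rw [mul_comm]; exact Complex.norm_exp_ofReal_mul_I r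

lemma Wt_norm (x : Rn n) : ‖Wt ε c d j h φ x‖ = ‖φ (x - (h * c) • eb j)‖ := by
  unfold Wt
  rw [norm_mul, exp_ph, one_mul]

lemma Wt_ph_cont : Continuous (fun x : Rn n => Complex.exp (Complex.I * (ph ε c d j h x : ℂ))) := by
  unfold ph; fun_prop

lemma Wt_eLp (hc : AEStronglyMeasurable φ volume) : eLpNorm (Wt ε c d j h φ) 2 volume = eLpNorm φ 2 volume := by
  have h1 : eLpNorm (Wt ε c d j h φ) 2 volume = eLpNorm (φ ∘ fun x => x - (h * c) • eb j) 2 volume :=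
    eLpNorm_congr_norm_ae (ae_of_all _ fun x => Wt_norm x)
  rw [h1]
  exact eLpNorm_comp_measurePreserving hc (measurePreserving_sub_right volume _)

lemma Wt_mem (hφ : MemLp φ 2 volume) : MemLp (Wt ε c d j h φ) 2 volume := by
  refine ⟨?_, by rw [Wt_eLp hφ.1]; exact hφ.2⟩
  exact Wt_ph_cont.aestronglyMeasurable.mul
    (hφ.1.comp_measurePreserving (measurePreserving_sub_right volume ((h * c) • eb j)))

lemma Wt_nL (hφ : MemLp φ 2 volume) : nL (Wt ε c d j h φ) = nL φ := by
  unfold nL; rw [Wt_eLp hφ.1]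

lemma Wt_sub (x : Rn n) : Wt ε c d j h (fun x => φ x - ψ x) x = Wt ε c d j h φ x - Wt ε c d j h ψ x := by
  unfold Wt; ring

lemma Wt_HB {v : ℝ} (hB : HB φ v) : HB (Wt ε c d j h φ) v := by
  intro x
  have h1 : ∀ y, KK x y * ‖Wt ε c d j h φ y‖ₑ ^ 2 =
      (fun y => KK (x - (h * c) • eb j) y * ‖φ y‖ₑ ^ 2) (y - (h * c) • eb j) := by
    intro y
    have e1 : ‖Wt ε c d j h φ y‖ₑ = ‖φ (y - (h * c) • eb j)‖ₑ := by
      rw [← ofReal_norm, ← ofReal_norm, Wt_norm]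
    have e2 : x - (h * c) • eb j - (y - (h * c) • eb j) = x - y := by abel
    simp only [e1, KK, e2]
  rw [lintegral_congr h1, lintegral_sub_right_eq_self (fun y => KK (x - (h * c) • eb j) y * ‖φ y‖ₑ ^ 2)]
  exact hB _

lemma Wt_hartree (x : Rn n) : hartree 1 (Wt ε c d j h φ) x = hartree 1 φ (x - (h * c) • eb j) := by
  unfold hartree conv
  have h1 : ∀ y, ‖x - y‖ ^ (-1 : ℝ) * Complex.normSq (Wt ε c d j h φ y) =
      (fun y => ‖x - (h * c) • eb j - y‖ ^ (-1 : ℝ) * Complex.normSq (φ y)) (y - (h * c) • eb j) := by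
    intro y
    have e2 : x - (h * c) • eb j - (y - (h * c) • eb j) = x - y := by abel
    simp only [Complex.normSq_eq_norm_sq, Wt_norm, e2]
  rw [integral_congr_ae (ae_of_all _ h1)]
  exact integral_sub_right_eq_self (μ := volume) (fun y => ‖x - (h * c) • eb j - y‖ ^ (-1 : ℝ) * Complex.normSq (φ y)) _

lemma Wt_smooth (hφ : ContDiff ℝ (⊤ : ℕ∞) φ) : ContDiff ℝ (⊤ : ℕ∞) (Wt ε c d j h φ) := by
  unfold Wt ph
  have h1 : ContDiff ℝ (⊤ : ℕ∞) (fun x : Rn n => (((h * d * x j - h ^ 2 * c * d / 2) / ε : ℝ) : ℂ)) :=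
    Complex.ofRealCLM.contDiff.comp (g := Complex.ofRealCLM) (f := fun x : Rn n => (h * d * x j - h ^ 2 * c * d / 2) / ε) (ContDiff.div_const (by fun_prop) _)
  have h2 : ContDiff ℝ (⊤ : ℕ∞) (fun x : Rn n => φ (x - (h * c) • eb j)) := hφ.comp (by fun_prop)
  exact ((contDiff_const.mul h1).cexp).mul h2

lemma eb_apply (k : Fin n) : (eb k : Rn n) j = if j = k then 1 else 0 := by
  unfold eb; simp

lemma pd_lin (φ : Rn n → ℂ) (hφ : ContDiff ℝ (⊤ : ℕ∞) φ) (k : Fin n) (x : Rn n) :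
    HasDerivAt (fun s : ℝ => φ (x + s • eb k)) (pd k φ x) 0 := by
  have h1 : HasFDerivAt φ (fderiv ℝ φ (x + (0 : ℝ) • eb k)) (x + (0 : ℝ) • eb k) :=
    (hφ.differentiable (by simp) _).hasFDerivAt
  have h2 : HasDerivAt (fun s : ℝ => x + s • eb k) (eb k) 0 := by
    have := ((hasDerivAt_id (0 : ℝ)).smul_const (eb k)).const_add x
    simpa using this
  have := h1.comp_hasDerivAt 0 h2
  simpa [pd, Function.comp_def] using this

lemma pd_Wt (hφ : ContDiff ℝ (⊤ : ℕ∞) φ) (k : Fin n) (x : Rn n) :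
    pd k (Wt ε c d j h φ) x = Wt ε c d j h (pd k φ) x +
      (if j = k then Complex.I * ((h * d / ε : ℝ) : ℂ) else 0) * Wt ε c d j h φ x := by
  have h1 := pd_lin _ (Wt_smooth (ε := ε) (c := c) (d := d) (j := j) (h := h) hφ) k x
  refine h1.unique ?_
  have h2 := pd_lin φ hφ k (x - (h * c) • eb j)
  have h3 : HasDerivAt (fun s : ℝ => Complex.I * (ph ε c d j h (x + s • eb k) : ℂ))
      (if j = k then Complex.I * ((h * d / ε : ℝ) : ℂ) else 0) 0 := by
    have e : ∀ s : ℝ, Complex.I * (ph ε c d j h (x + s • eb k) : ℂ) =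
        Complex.I * (((ph ε c d j h x + s * ((if j = k then 1 else 0) * (h * d / ε)) : ℝ)) : ℂ) := by
      intro s
      congr 2
      unfold ph
      simp only [PiLp.add_apply, PiLp.smul_apply, eb_apply, smul_eq_mul]
      ring
    simp_rw [e]
    have := ((((hasDerivAt_id (0 : ℝ)).mul_const ((if j = k then 1 else 0) * (h * d / ε))).const_add
      (ph ε c d j h x)).ofReal_comp).const_mul Complex.I
    refine hd_of this (fun s => rfl) ?_
    split_ifs <;> simp
  have h4 := h3.cexp.mul h2
  unfold Wt
  refine hd_of h4 (fun s => ?_) ?_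
  · simp only [Pi.mul_apply]
    rw [show x + s • eb k - (h * c) • eb j = x - (h * c) • eb j + s • eb k by abel]
  · simp only [zero_smul, add_zero]
    ring

lemma lap_Wt (hφ : ContDiff ℝ (⊤ : ℕ∞) φ) (x : Rn n) :
    lap (Wt ε c d j h φ) x = Wt ε c d j h (lap φ) x + 2 * (Complex.I * ((h * d / ε : ℝ) : ℂ)) * Wt ε c d j h (pd j φ) x
      + (Complex.I * ((h * d / ε : ℝ) : ℂ)) ^ 2 * Wt ε c d j h φ x := by
  set a := Complex.I * ((h * d / ε : ℝ) : ℂ) with ha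
  have e1 : ∀ k, pd k (pd k (Wt ε c d j h φ)) x = Wt ε c d j h (pd k (pd k φ)) x
      + (if j = k then 2 * a * Wt ε c d j h (pd j φ) x + a ^ 2 * Wt ε c d j h φ x else 0) := by
    intro k
    have e2 : pd k (Wt ε c d j h φ) = fun x => Wt ε c d j h (pd k φ) x + (if j = k then a else 0) * Wt ε c d j h φ x := by
      ext x; exact pd_Wt hφ k x
    have hs1 := Wt_smooth (ε := ε) (c := c) (d := d) (j := j) (h := h) (pd_smooth hφ k)
    have hs2 := Wt_smooth (ε := ε) (c := c) (d := d) (j := j) (h := h) hφ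
    have e3 : pd k (pd k (Wt ε c d j h φ)) x = pd k (Wt ε c d j h (pd k φ)) x +
        (if j = k then a else 0) * pd k (Wt ε c d j h φ) x := by
      rw [e2]
      have h1 := pd_lin _ hs1 k x
      have h2 := pd_lin _ hs2 k x
      have h3 := h1.add (h2.const_mul (if j = k then a else 0))
      refine (pd_lin _ ?_ k x).unique ?_
      · exact hs1.add (contDiff_const.mul hs2)
      · refine hd_of h3 (fun s => rfl) ?_
        rw [e2]
    rw [e3, pd_Wt (pd_smooth hφ k), pd_Wt hφ]
    split_ifs with hjk
    · subst hjk
      rw [← ha]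
      ring
    · ring
  rw [lap_eq]
  simp_rw [e1]
  rw [Finset.sum_add_distrib, Finset.sum_ite_eq]
  simp only [Finset.mem_univ, if_true]
  rw [add_assoc]
  congr 1
  unfold Wt
  rw [lap_eq, Finset.mul_sum]

lemma Wt_H1 (hφ : H1 φ) : H1 (Wt ε c d j h φ) where
  sm := Wt_smooth hφ.sm
  l2 := Wt_mem hφ.l2
  d2 k := by
    have : pd k (Wt ε c d j h φ) = fun x => Wt ε c d j h (pd k φ) x +
      (if j = k then Complex.I * ((h * d / ε : ℝ) : ℂ) else 0) * Wt ε c d j h φ x := by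
      ext x; exact pd_Wt hφ.sm k x
    rw [this]
    exact (Wt_mem (hφ.d2 k)).add ((Wt_mem hφ.l2).const_mul _)

lemma Wt_pd_le (hφ : H1 φ) (k : Fin n) : nL (pd k (Wt ε c d j h φ)) ≤ nL (pd k φ) + |h * d / ε| * nL φ := by
  have : pd k (Wt ε c d j h φ) = fun x => Wt ε c d j h (pd k φ) x +
      (if j = k then Complex.I * ((h * d / ε : ℝ) : ℂ) else 0) * Wt ε c d j h φ x := by
    ext x; exact pd_Wt hφ.sm k x
  rw [this]
  refine (nL_add_le (Wt_mem (hφ.d2 k)) ((Wt_mem hφ.l2).const_mul _)).trans ?_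
  rw [Wt_nL (hφ.d2 k), nL_const_mul, Wt_nL hφ.l2]
  refine add_le_add le_rfl (mul_le_mul_of_nonneg_right ?_ (nL_nonneg _))
  split_ifs
  · rw [norm_mul, Complex.norm_I, one_mul, Complex.norm_real, Real.norm_eq_abs]
  · simp

lemma Wt_zero (x : Rn n) : Wt ε c d j 0 φ x = φ x := by
  unfold Wt ph; simp

lemma Wt_deriv (hφ : ContDiff ℝ (⊤ : ℕ∞) φ) (x : Rn n) (s : ℝ) :
    HasDerivAt (fun s => Wt ε c d j s φ x) (-Wt ε c d j s (Op ε c d j φ) x) s := by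
  have h1 : HasFDerivAt φ (fderiv ℝ φ (x - (s * c) • eb j)) (x - (s * c) • eb j) :=
    (hφ.differentiable (by simp) _).hasFDerivAt
  have h2 : HasDerivAt (fun s : ℝ => x - (s * c) • eb j) (-((1 * c) • eb j)) s :=
    (((hasDerivAt_id s).mul_const c).smul_const (eb j)).const_sub x
  have h3 := h1.comp_hasDerivAt s h2
  have h4 : HasDerivAt (fun s : ℝ => ph ε c d j s x) ((d * x j - s * c * d) / ε) s := by
    unfold ph
    have a1 := ((hasDerivAt_id s).mul_const d).mul_const (x j)
    have a2 := (((hasDerivAt_pow 2 s).mul_const c).mul_const d).div_const 2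
    have := (a1.sub a2).div_const ε
    refine this.congr_deriv ?_
    simp; ring
  have h5 := (h4.ofReal_comp.const_mul Complex.I).cexp.mul h3
  unfold Wt
  refine hd_of h5 (fun s => rfl) ?_
  unfold Op pd
  simp only [Function.comp_def, map_neg, map_smul, one_mul, PiLp.sub_apply, PiLp.smul_apply, eb_apply, if_true,
    Complex.real_smul, smul_eq_mul]
  push_cast
  ring

end W

section W2
variable {n : ℕ} {ε c d : ℝ} {j : Fin n} {h : ℝ} {φ ψ : Rn n → ℂ}

lemma Sch.op (hφ : Sch φ) (ε c d : ℝ) (j : Fin n) : Sch (Op ε c d j φ) := by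
  have := ((hφ.pd j).const_mul (c : ℂ)).sub ((hφ.coord j).const_mul (Complex.I * ((d / ε : ℝ) : ℂ)))
  exact this

lemma cs_int {f : ℝ → ℝ≥0∞} (hf : Measurable f) (hh : 0 ≤ h) :
    (∫⁻ s in Set.Ioc 0 h, f s) ^ 2 ≤ ENNReal.ofReal h * ∫⁻ s in Set.Ioc 0 h, f s ^ 2 := by
  have := ENNReal.lintegral_mul_le_Lp_mul_Lq (volume.restrict (Set.Ioc 0 h)) (p := 2) (q := 2)
    (f := fun _ => 1) (g := f) (by constructor <;> norm_num) aemeasurable_const hf.aemeasurable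
  simp only [Pi.mul_apply, one_mul, ENNReal.one_rpow, lintegral_const, Measure.restrict_apply MeasurableSet.univ,
    Set.univ_inter, Real.volume_Ioc, sub_zero] at this
  refine (pow_le_pow_left₀ zero_le this 2).trans (le_of_eq ?_)
  simp only [ENNReal.rpow_two]
  rw [mul_pow, ← ENNReal.rpow_natCast, ← ENNReal.rpow_natCast, ← ENNReal.rpow_mul, ← ENNReal.rpow_mul]
  norm_num

lemma Wt_diff (hφ : Sch φ) (hh : 0 ≤ h) :
    nL (fun x => Wt ε c d j h φ x - φ x) ≤ h * nL (Op ε c d j φ) := by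
  have hO : Sch (Op ε c d j φ) := hφ.op ε c d j
  set g := Op ε c d j φ with hg
  have hgc : Continuous g := hO.h1.sm.continuous
  have hcont : ∀ x, Continuous fun s : ℝ => -Wt ε c d j s g x := by
    intro x
    unfold Wt ph
    have : Continuous fun s : ℝ => g (x - (s * c) • eb j) := hgc.comp (by fun_prop)
    fun_prop
  have h1 : ∀ x, ‖Wt ε c d j h φ x - φ x‖ₑ ≤ ∫⁻ s in Set.Ioc 0 h, ‖g (x - (s * c) • eb j)‖ₑ := by
    intro x
    have e1 := intervalIntegral.integral_eq_sub_of_hasDerivAt (a := 0) (b := h)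
      (fun s _ => Wt_deriv (ε := ε) (c := c) (d := d) (j := j) hφ.h1.sm x s) ((hcont x).intervalIntegrable 0 h)
    rw [Wt_zero] at e1
    rw [← e1, intervalIntegral.integral_of_le hh]
    refine (enorm_integral_le_lintegral_enorm _).trans (le_of_eq (lintegral_congr fun s => ?_))
    rw [enorm_neg, ← ofReal_norm, ← ofReal_norm, Wt_norm]
  have h2 : ∫⁻ x, ‖Wt ε c d j h φ x - φ x‖ₑ ^ 2 ≤ ENNReal.ofReal h * (ENNReal.ofReal h * ∫⁻ x, ‖g x‖ₑ ^ 2) := by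
    have hm : Measurable fun p : Rn n × ℝ => ‖g (p.1 - (p.2 * c) • eb j)‖ₑ ^ 2 := by
      have : Continuous fun p : Rn n × ℝ => g (p.1 - (p.2 * c) • eb j) := hgc.comp (by fun_prop)
      exact this.measurable.enorm.pow_const 2
    calc ∫⁻ x, ‖Wt ε c d j h φ x - φ x‖ₑ ^ 2
        ≤ ∫⁻ x, ENNReal.ofReal h * ∫⁻ s in Set.Ioc 0 h, ‖g (x - (s * c) • eb j)‖ₑ ^ 2 := by
          refine lintegral_mono fun x => (pow_le_pow_left₀ zero_le (h1 x) 2).trans (cs_int ?_ hh)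
          have : Continuous fun s : ℝ => g (x - (s * c) • eb j) := hgc.comp (by fun_prop)
          exact this.measurable.enorm
      _ = ENNReal.ofReal h * ∫⁻ x, ∫⁻ s in Set.Ioc 0 h, ‖g (x - (s * c) • eb j)‖ₑ ^ 2 := by
          rw [lintegral_const_mul' _ _ ENNReal.ofReal_ne_top]
      _ = ENNReal.ofReal h * ∫⁻ s in Set.Ioc 0 h, ∫⁻ x, ‖g (x - (s * c) • eb j)‖ₑ ^ 2 := by
          rw [lintegral_lintegral_swap]
          exact hm.aemeasurable
      _ = ENNReal.ofReal h * ∫⁻ s in Set.Ioc 0 h, ∫⁻ x, ‖g x‖ₑ ^ 2 := by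
          congr 1
          refine lintegral_congr fun s => ?_
          exact lintegral_sub_right_eq_self (fun x => ‖g x‖ₑ ^ 2) _
      _ = _ := by
          rw [lintegral_const, Measure.restrict_apply MeasurableSet.univ, Set.univ_inter, Real.volume_Ioc, sub_zero,
            mul_comm (∫⁻ x, ‖g x‖ₑ ^ 2)]
  refine nL_le_of (mul_nonneg hh (nL_nonneg _)) ?_
  rw [ENNReal.ofReal_mul hh, nL_ofReal hO.memLp]
  refine (ENNReal.pow_le_pow_left_iff two_ne_zero).1 ?_
  rw [eLpNorm_sq, mul_pow, eLpNorm_sq]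
  refine h2.trans (le_of_eq ?_)
  ring

end W2

/-- Rotating coefficients. -/
structure Rot (c d : ℝ → ℝ) : Prop where
  cs : ContDiff ℝ (⊤ : ℕ∞) c
  ds : ContDiff ℝ (⊤ : ℕ∞) d
  hc : ∀ t, HasDerivAt c (d t) t
  hd : ∀ t, HasDerivAt d (-c t) t
  bd : ∀ t, |d t| ≤ 1

lemma rotJ : Rot Real.cos (fun t => -Real.sin t) where
  cs := Real.contDiff_cos
  ds := Real.contDiff_sin.neg
  hc := Real.hasDerivAt_cos
  hd t := (Real.hasDerivAt_sin t).neg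
  bd t := by rw [abs_neg]; exact Real.abs_sin_le_one t

lemma rotH : Rot Real.sin Real.cos where
  cs := Real.contDiff_sin
  ds := Real.contDiff_cos
  hc := Real.hasDerivAt_sin
  hd t := Real.hasDerivAt_cos t
  bd t := Real.abs_cos_le_one t

section W3
variable {n : ℕ} {lam ε : ℝ} {c d : ℝ → ℝ} {j : Fin n} {h : ℝ} {u : ℝ → Rn n → ℂ}

lemma pd_joint (hu : JS u) (j : Fin n) (t : ℝ) (x : Rn n) :
    pd j (u t) x = fderiv ℝ (fun p : ℝ × Rn n => u p.1 p.2) (t, x) (0, eb j) := by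
  have h3 : HasFDerivAt (fun p : ℝ × Rn n => u p.1 p.2) (fderiv ℝ (fun p : ℝ × Rn n => u p.1 p.2) (t, x)) (t, x) :=
    (ContDiff.differentiable hu (by simp) _).hasFDerivAt
  have h4 := h3.comp x (hasFDerivAt_prodMk_right t x)
  have h5 : fderiv ℝ (u t) x = _ := h4.fderiv
  unfold pd
  rw [h5]; rfl

lemma Wt_JS (hr : Rot c d) (hu : JS u) : JS (fun t => Wt ε (c t) (d t) j h (u t)) := by
  unfold JS Wt ph
  have hc : ContDiff ℝ (⊤ : ℕ∞) fun p : ℝ × Rn n => c p.1 := hr.cs.comp contDiff_fst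
  have hd : ContDiff ℝ (⊤ : ℕ∞) fun p : ℝ × Rn n => d p.1 := hr.ds.comp contDiff_fst
  have hx : ContDiff ℝ (⊤ : ℕ∞) fun p : ℝ × Rn n => p.2 j := by fun_prop
  have h1 : ContDiff ℝ (⊤ : ℕ∞) (fun p : ℝ × Rn n => (((h * d p.1 * p.2 j - h ^ 2 * c p.1 * d p.1 / 2) / ε : ℝ) : ℂ)) :=
    Complex.ofRealCLM.contDiff.comp (g := Complex.ofRealCLM)
      (f := fun p : ℝ × Rn n => (h * d p.1 * p.2 j - h ^ 2 * c p.1 * d p.1 / 2) / ε)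
      (ContDiff.div_const (((contDiff_const.mul hd).mul hx).sub
        (((contDiff_const.mul hc).mul hd).div_const _)) _)
  have h2 : ContDiff ℝ (⊤ : ℕ∞) (fun p : ℝ × Rn n => u p.1 (p.2 - (h * c p.1) • eb j)) :=
    ContDiff.comp (g := fun p : ℝ × Rn n => u p.1 p.2) (f := fun p : ℝ × Rn n => (p.1, p.2 - (h * c p.1) • eb j)) hu
      (contDiff_fst.prodMk (contDiff_snd.sub ((contDiff_const.mul hc).smul contDiff_const)))
  exact ((contDiff_const.mul h1).cexp).mul h2

lemma dt_Wt (hr : Rot c d) (hu : JS u) (t : ℝ) (x : Rn n) :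
    dt (fun t => Wt ε (c t) (d t) j h (u t)) t x = Wt ε (c t) (d t) j h (dt u t) x
      - ((h * d t : ℝ) : ℂ) * Wt ε (c t) (d t) j h (pd j (u t)) x
      + Complex.I * (((h * (-c t) * x j - h ^ 2 * (d t ^ 2 - c t ^ 2) / 2) / ε : ℝ) : ℂ) * Wt ε (c t) (d t) j h (u t) x := by
  refine HasDerivAt.deriv ?_
  have h1 : HasFDerivAt (fun p : ℝ × Rn n => u p.1 p.2)
      (fderiv ℝ (fun p : ℝ × Rn n => u p.1 p.2) (t, x - (h * c t) • eb j)) (t, x - (h * c t) • eb j) :=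
    (ContDiff.differentiable hu (by simp) _).hasFDerivAt
  have h2 : HasDerivAt (fun s : ℝ => (s, x - (h * c s) • eb j)) (1, -((h * d t) • eb j)) t :=
    (hasDerivAt_id t).prodMk ((((hr.hc t).const_mul h).smul_const (eb j)).const_sub x)
  have h3 := h1.comp_hasDerivAt t h2
  have h4 : HasDerivAt (fun s : ℝ => ph ε (c s) (d s) j h x)
      ((h * (-c t) * x j - h ^ 2 * (d t ^ 2 - c t ^ 2) / 2) / ε) t := by
    unfold ph
    have a1 := ((hr.hd t).const_mul h).mul_const (x j)
    have a2 := (((hr.hc t).const_mul (h ^ 2)).mul (hr.hd t)).div_const 2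
    have := (a1.sub a2).div_const ε
    refine this.congr_deriv ?_
    ring
  have h5 := (h4.ofReal_comp.const_mul Complex.I).cexp.mul h3
  unfold Wt
  refine hd_of h5 (fun s => rfl) ?_
  rw [hu.dt_eq, pd_joint hu]
  have e : ((1 : ℝ), -((h * d t) • (eb j : Rn n))) = (1, 0) + (-(h * d t)) • ((0 : ℝ), (eb j : Rn n)) := by
    ext <;> simp
  rw [e, map_add, map_smul]
  simp only [Function.comp_def, Complex.real_smul]
  push_cast
  ring

lemma nsq (x : Rn n) (a : ℝ) : ‖x - a • eb j‖ ^ 2 = ‖x‖ ^ 2 - 2 * a * x j + a ^ 2 := by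
  rw [norm_sub_sq_real, inner_smul_right, norm_smul]
  have e1 : inner ℝ x (eb j) = x j := by
    unfold eb; simp [PiLp.inner_apply]
  have e2 : ‖(eb j : Rn n)‖ = 1 := by unfold eb; simp
  rw [e1, e2, mul_one, Real.norm_eq_abs, sq_abs]
  ring

lemma Wt_eq (hε : 0 < ε) (hr : Rot c d) (hu : JS u) {R : ℝ → Rn n → ℂ}
    (heq : ∀ t x, Complex.I * (ε : ℂ) * dt u t x + ((ε ^ 2 / 2 : ℝ) : ℂ) * lap (u t) x
    = ((‖x‖ ^ 2 / 2 : ℝ) : ℂ) * u t x + R t x) (t : ℝ) (x : Rn n) :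
    Complex.I * (ε : ℂ) * dt (fun t => Wt ε (c t) (d t) j h (u t)) t x
      + ((ε ^ 2 / 2 : ℝ) : ℂ) * lap (Wt ε (c t) (d t) j h (u t)) x
    = ((‖x‖ ^ 2 / 2 : ℝ) : ℂ) * Wt ε (c t) (d t) j h (u t) x + Wt ε (c t) (d t) j h (R t) x := by
  rw [dt_Wt hr hu, lap_Wt (hu.slice t)]
  have e1 := heq t (x - (h * c t) • eb j)
  rw [nsq] at e1
  unfold Wt
  have hεc : (ε : ℂ) ≠ 0 := by exact_mod_cast hε.ne'
  set E := Complex.exp (Complex.I * (ph ε (c t) (d t) j h x : ℂ))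
  set y := x - (h * c t) • eb j
  have hI : Complex.I ^ 2 = -1 := Complex.I_sq
  push_cast at e1 ⊢
  field_simp
  field_simp at e1
  linear_combination E * e1 + (-2 * E * h * (c t : ℂ) * (x j : ℂ) * u t y + E * h ^ 2 * (c t : ℂ) ^ 2 * u t y) * hI

end W3

section W4
variable {n : ℕ} {lam ε : ℝ} {c d : ℝ → ℝ} {j : Fin n} {h : ℝ} {u uf : ℝ → Rn n → ℂ}

lemma Wt_solS (hε : 0 < ε) (hr : Rot c d) (hu : Sol lam ε u) :
    SolS lam ε (fun t => Wt ε (c t) (d t) j h (u t)) (fun _ _ => 0) where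
  js := Wt_JS hr hu.js
  h1 t := Wt_H1 (hu.sch t).h1
  eq t x := by
    have := Wt_eq (j := j) (h := h) hε hr hu.js (R := fun t x => (lam : ℂ) * ((hartree 1 (u t) x : ℝ) : ℂ) * u t x) hu.eq t x
    rw [this, add_zero, Wt_hartree]
    unfold Wt
    ring

lemma op_fat {φ : Rn n → ℂ} {c d C : ℝ} (hφ : Sch φ) (hC : 0 ≤ C)
    (H : ∀ h : ℝ, 0 < h → h ≤ 1 → nL (fun x => Wt ε c d j h φ x - φ x) ≤ h * C) : nL (Op ε c d j φ) ≤ C := by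
  refine nL_le_of hC (nL_fatou (f := fun k x => -(((1 / ((k : ℝ) + 1))⁻¹ : ℝ) : ℂ) * (Wt ε c d j (1 / ((k : ℝ) + 1)) φ x - φ x))
    hC ?_ ?_ ?_)
  · exact fun k => ((Wt_mem hφ.memLp).sub hφ.memLp).const_mul _
  · intro x
    have h1 := (Wt_deriv (ε := ε) (c := c) (d := d) (j := j) hφ.h1.sm x 0).tendsto_slope_zero
    have h2 : Tendsto (fun k : ℕ => 1 / ((k : ℝ) + 1)) atTop (𝓝[≠] 0) :=
      tendsto_nhdsWithin_iff.2 ⟨tendsto_one_div_add_atTop_nhds_zero_nat, Eventually.of_forall fun k => by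
        have : (0 : ℝ) < 1 / ((k : ℝ) + 1) := by positivity
        exact this.ne'⟩
    have h3 := (h1.comp h2).neg
    simp only [Wt_zero, neg_neg] at h3
    refine h3.congr fun k => ?_
    simp only [Function.comp_def, zero_add, Complex.real_smul, neg_mul]
  · refine (Eventually.of_forall fun k => ?_).frequently
    have hk : (0 : ℝ) < 1 / ((k : ℝ) + 1) := by positivity
    have hk1 : 1 / ((k : ℝ) + 1) ≤ 1 := by
      rw [div_le_one (by positivity)]
      have : (0 : ℝ) ≤ k := Nat.cast_nonneg k
      linarith
    rw [nL_const_mul, norm_neg, Complex.norm_real, Real.norm_eq_abs, abs_of_pos (inv_pos.2 hk),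
      inv_mul_le_iff₀ hk]
    exact H _ hk hk1

lemma pd_bd {φ : Rn n → ℂ} {c d K h : ℝ} (hφ : H1 φ) (hε : 0 < ε) (hd : |d| ≤ 1) (hh : 0 < h) (hh1 : h ≤ 1)
    (h0 : nL φ ≤ K) (h1 : ∀ j, nL (pd j φ) ≤ K) (k : Fin n) : nL (pd k (Wt ε c d j h φ)) ≤ K + ε⁻¹ * K := by
  refine (Wt_pd_le hφ k).trans (add_le_add (h1 k) ?_)
  refine mul_le_mul ?_ h0 (nL_nonneg _) (by positivity)
  rw [abs_div, abs_mul, abs_of_pos hh, abs_of_pos hε, div_eq_mul_inv]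
  have : h * |d| ≤ 1 := mul_le_one₀ hh1 (abs_nonneg _) hd
  nlinarith [inv_pos.2 hε]

lemma op_prop (hlam : 0 ≤ lam) (hε : 0 < ε) (hr : Rot c d) (hu : Sol lam ε u) {a b K : ℝ}
    (hK : ∀ t ∈ Set.Icc a b, MM u t ≤ K) {v : ℝ → ℝ} (hv : Continuous v) (hvp : ∀ t, 0 ≤ v t)
    (hB : ∀ t ∈ Set.Icc a b, HB (u t) (v t)) {s t : ℝ} (hs : s ∈ Set.Icc a b) (ht : t ∈ Set.Icc a b) (j : Fin n) :
    nL (Op ε (c t) (d t) j (u t)) ≤ nL (Op ε (c s) (d s) j (u s)) * Real.exp (ε⁻¹ * |∫ τ in s..t, 2 * lam * v τ|) := by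
  have hK0 : 0 ≤ K := (MM_nonneg u s).trans (hK s hs)
  have hKε : 0 ≤ ε⁻¹ * K := by positivity
  refine op_fat (hu.sch t) (mul_nonneg (nL_nonneg _) (Real.exp_nonneg _)) fun h hh hh1 => ?_
  have h1 := stab hlam hε (Wt_solS (j := j) (h := h) hε hr hu) hu.solS (a := a) (b := b) (M := K + ε⁻¹ * K)
    (c0 := fun _ => 0) (c := v) continuous_const (fun _ => le_rfl) hv hvp
    (fun t ht => Wt_HB (hB t ht)) hB
    (fun t ht => by
      rw [Wt_nL (hu.sch t).memLp]
      linarith [(MM_u u t).trans (hK t ht)])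
    (fun t ht => by linarith [(MM_u u t).trans (hK t ht)])
    (fun t ht k => pd_bd (hu.sch t).h1 hε (hr.bd t) hh hh1 ((MM_u u t).trans (hK t ht))
      (fun j => (MM_pd u t j).trans (hK t ht)) k)
    (fun t ht k => by linarith [(MM_pd u t k).trans (hK t ht)])
    (fun t ht => MemLp.zero') (fun t ht => by unfold nL; simp) hs ht
  refine h1.trans ?_
  rw [intervalIntegral.integral_zero, abs_zero, mul_zero, add_zero, ← mul_assoc]
  exact mul_le_mul_of_nonneg_right (Wt_diff (hu.sch s) hh.le) (Real.exp_nonneg _)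

lemma op_comp (hlam : 0 ≤ lam) (hε : 0 < ε) (hr : Rot c d) (hu : Sol lam ε u) (huf : Sol 0 ε uf) {a b K q : ℝ}
    (hK : ∀ t ∈ Set.Icc a b, MM u t ≤ K) (hKf : ∀ t ∈ Set.Icc a b, MM uf t ≤ K)
    {v : ℝ → ℝ} (hv : Continuous v) (hvp : ∀ t, 0 ≤ v t)
    (hB : ∀ t ∈ Set.Icc a b, HB (u t) (v t)) (j : Fin n)
    (hq : ∀ t ∈ Set.Icc a b, nL (Op ε (c t) (d t) j (u t)) ≤ q) (h0 : u a = uf a) {t : ℝ} (ht : t ∈ Set.Icc a b) :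
    nL (Op ε (c t) (d t) j (fun x => u t x - uf t x)) ≤ ε⁻¹ * (∫ τ in a..t, 3 * lam * v τ) * q := by
  have ha : a ∈ Set.Icc a b := ⟨le_rfl, ht.1.trans ht.2⟩
  have hK0 : 0 ≤ K := (MM_nonneg u t).trans (hK t ht)
  have hKε : 0 ≤ ε⁻¹ * K := by positivity
  have hq0 : 0 ≤ q := (nL_nonneg _).trans (hq t ht)
  have hI0 : 0 ≤ ∫ τ in a..t, 3 * lam * v τ :=
    intervalIntegral.integral_nonneg ht.1 fun τ _ => mul_nonneg (by positivity) (hvp τ)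
  refine op_fat ((hu.sch t).sub (huf.sch t)) (by positivity) fun h hh hh1 => ?_
  have hw : JS (fun t x => u t x - uf t x) := hu.js.sub huf.js
  have hws : ∀ t, Sch (fun x => u t x - uf t x) := fun t => (hu.sch t).sub (huf.sch t)
  have hwe : ∀ t x, Complex.I * (ε : ℂ) * dt (fun t x => u t x - uf t x) t x
      + ((ε ^ 2 / 2 : ℝ) : ℂ) * lap (fun x => u t x - uf t x) x
    = ((‖x‖ ^ 2 / 2 : ℝ) : ℂ) * (u t x - uf t x) + (lam : ℂ) * ((hartree 1 (u t) x : ℝ) : ℂ) * u t x := by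
    intro t x
    rw [dt_sub hu.js huf.js, lap_sub (hu.sch t).h1.sm (huf.sch t).h1.sm]
    have e1 := hu.eq t x
    have e2 := huf.eq t x
    push_cast at e1 e2 ⊢
    linear_combination e1 - e2
  have hw0 : ∀ t ∈ Set.Icc a b, nL (fun x => u t x - uf t x) ≤ K + K := fun t ht =>
    (nL_sub_le (hu.sch t).memLp (huf.sch t).memLp).trans
      (add_le_add ((MM_u u t).trans (hK t ht)) ((MM_u uf t).trans (hKf t ht)))
  have hw1 : ∀ t ∈ Set.Icc a b, ∀ k, nL (pd k (fun x => u t x - uf t x)) ≤ K + K := fun t ht k =>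
    ((hu.sch t).h1.pd_sub_le (huf.sch t).h1 k).trans
      (add_le_add ((MM_pd u t k).trans (hK t ht)) ((MM_pd uf t k).trans (hKf t ht)))
  set M := (K + K) + ε⁻¹ * (K + K) with hM
  have hG := fun (t : ℝ) (ht : t ∈ Set.Icc a b) => diff_full (v := v t)
    (Wt_smooth (ε := ε) (c := c t) (d := d t) (j := j) (h := h) (hu.sch t).h1.sm).continuous
    (hu.sch t).h1.sm.continuous (Wt_HB (hB t ht)) (hB t ht) (hvp t) ((Wt_mem (hu.sch t).memLp).sub (hu.sch t).memLp)
  have hz := l2_gron ((Wt_JS (ε := ε) (j := j) (h := h) hr hw).sub hw) hε (a := a) (b := b) (M := M + M)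
    (P := fun _ x => ‖x‖ ^ 2 / 2)
    (G := fun t x => (lam : ℂ) * (((hartree 1 (Wt ε (c t) (d t) j h (u t)) x : ℝ) : ℂ) * Wt ε (c t) (d t) j h (u t) x
      - ((hartree 1 (u t) x : ℝ) : ℂ) * u t x)) (c0 := fun τ => 3 * lam * v τ * (h * q)) (c1 := fun _ => 0)
    ?_ ?_ ?_ ?_ ?_ ?_ (by fun_prop) ?_ continuous_const (fun _ => le_rfl) ?_ ha ht
  · have e0 : nL (fun x => Wt ε (c a) (d a) j h (fun x => u a x - uf a x) x - (u a x - uf a x)) = 0 := by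
      have : (fun x => Wt ε (c a) (d a) j h (fun x => u a x - uf a x) x - (u a x - uf a x)) = fun x => 0 := by
        ext x
        unfold Wt
        rw [h0]; simp
      rw [this]; unfold nL; simp
    rw [e0, intervalIntegral.integral_zero, abs_zero, mul_zero, Real.exp_zero, mul_one, zero_add,
      intervalIntegral.integral_mul_const, abs_of_nonneg (mul_nonneg hI0 (by positivity))] at hz
    refine hz.trans (le_of_eq ?_)
    ring
  · intro t ht x
    have e1 := hwe t x
    have e2 := Wt_eq (j := j) (h := h) hε hr hw (R := fun t x => (lam : ℂ) * ((hartree 1 (u t) x : ℝ) : ℂ) * u t x) hwe t x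
    rw [dt_sub (Wt_JS hr hw) hw, lap_sub (Wt_smooth (hws t).h1.sm) (hws t).h1.sm]
    rw [Wt_hartree]
    have e3 : Wt ε (c t) (d t) j h (fun x => (lam : ℂ) * ((hartree 1 (u t) x : ℝ) : ℂ) * u t x) x =
      (lam : ℂ) * (((hartree 1 (u t) (x - (h * c t) • eb j) : ℝ) : ℂ) * Wt ε (c t) (d t) j h (u t) x) := by
      unfold Wt; ring
    rw [e3] at e2
    linear_combination e2 - e1
  · exact fun t ht => (Wt_mem (hws t).memLp).sub (hws t).memLp
  · exact fun t ht k => ((Wt_H1 (hws t).h1).sub (hws t).h1).d2 k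
  · intro t ht
    refine (nL_sub_le (Wt_mem (hws t).memLp) (hws t).memLp).trans (add_le_add ?_ ?_)
    · rw [Wt_nL (hws t).memLp]
      have : 0 ≤ ε⁻¹ * (K + K) := by positivity
      linarith [hw0 t ht]
    · have : 0 ≤ ε⁻¹ * (K + K) := by positivity
      linarith [hw0 t ht]
  · intro t ht k
    refine ((Wt_H1 (hws t).h1).pd_sub_le (hws t).h1 k).trans (add_le_add ?_ ?_)
    · exact pd_bd (hws t).h1 hε (hr.bd t) hh hh1 (hw0 t ht) (hw1 t ht) k
    · have : 0 ≤ ε⁻¹ * (K + K) := by positivity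
      linarith [hw1 t ht k]
  · exact fun t ht => (hG t ht).1.const_mul _
  · exact fun t => mul_nonneg (mul_nonneg (by positivity) (hvp t)) (by positivity)
  · intro t ht
    rw [nL_const_mul, Complex.norm_real, Real.norm_eq_abs, abs_of_nonneg hlam, zero_mul, add_zero]
    have e1 := (hG t ht).2
    have e2 := (Wt_diff (ε := ε) (c := c t) (d := d t) (j := j) (hu.sch t) hh.le).trans
      (mul_le_mul_of_nonneg_left (hq t ht) hh.le)
    calc _ ≤ lam * (3 * v t * (h * q)) := by
          refine mul_le_mul_of_nonneg_left (e1.trans ?_) hlam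
          exact mul_le_mul_of_nonneg_left e2 (mul_nonneg (by norm_num) (hvp t))
      _ = _ := by ring

end W4

/-- Time weight. -/
def gw (ε t : ℝ) : ℝ := (|Real.cos t| + ε * |Real.sin t|)⁻¹

lemma gw_den {ε : ℝ} (hε : 0 < ε) (t : ℝ) : 0 < |Real.cos t| + ε * |Real.sin t| := by
  by_contra hcon
  have h1 := abs_nonneg (Real.cos t)
  have h2 := mul_nonneg hε.le (abs_nonneg (Real.sin t))
  have h3 : |Real.cos t| = 0 := by linarith
  have h4 : ε * |Real.sin t| = 0 := by linarith
  have h5 : |Real.sin t| = 0 := by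
    rcases mul_eq_zero.1 h4 with h | h
    · exact absurd h hε.ne'
    · exact h
  have := Real.sin_sq_add_cos_sq t
  rw [abs_eq_zero.1 h3, abs_eq_zero.1 h5] at this
  norm_num at this

lemma gw_pos {ε : ℝ} (hε : 0 < ε) (t : ℝ) : 0 < gw ε t := inv_pos.2 (gw_den hε t)

lemma gw_cont {ε : ℝ} (hε : 0 < ε) : Continuous (gw ε) := by
  unfold gw
  exact Continuous.inv₀ (by fun_prop) fun t => (gw_den hε t).ne'

lemma gw_int {δ : ℝ} (hδ : 0 < δ) {T : ℝ} (hT : 0 < T) : ∃ C, 0 < C ∧ ∀ ε ∈ Set.Ioc (0 : ℝ) 1,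
    ∫ t in (0 : ℝ)..T, gw ε t ≤ C * ε ^ (-δ) := by
  obtain ⟨N, hN⟩ := exists_nat_ge (T / π)
  have hN' : T ≤ N * π := by rwa [div_le_iff₀ Real.pi_pos] at hN
  refine ⟨2 * T + 4 * (N * (2 * (3 ^ δ / δ))), by positivity, fun ε hε => ?_⟩
  have hε0 := hε.1
  set k : ℝ → ℝ := fun t => |Real.sin t| / Real.sqrt (ε ^ 2 + Real.cos t ^ 2) with hk
  have hsq : ∀ t, 0 < Real.sqrt (ε ^ 2 + Real.cos t ^ 2) := fun t => Real.sqrt_pos.2 (by positivity)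
  have hkc : Continuous k := Continuous.div (by fun_prop) (by fun_prop) fun t => (hsq t).ne'
  have hk0 : ∀ t, 0 ≤ k t := fun t => div_nonneg (abs_nonneg _) (hsq t).le
  have h1 : ∀ t, gw ε t ≤ 2 + 4 * k t := by
    intro t
    unfold gw
    rw [inv_le_iff_one_le_mul₀ (gw_den hε0 t)]
    rcases le_total (1 / 2) |Real.sin t| with h | h
    · have e1 : Real.sqrt (ε ^ 2 + Real.cos t ^ 2) ≤ ε + |Real.cos t| := by
        rw [Real.sqrt_le_left (by positivity)]
        nlinarith [sq_abs (Real.cos t), mul_nonneg hε0.le (abs_nonneg (Real.cos t))]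
      have e2 : (1 / 2) * Real.sqrt (ε ^ 2 + Real.cos t ^ 2) ≤ |Real.cos t| + ε * |Real.sin t| := by
        nlinarith [abs_nonneg (Real.cos t)]
      have e3 : 1 / 2 ≤ k t * Real.sqrt (ε ^ 2 + Real.cos t ^ 2) := by
        rw [hk]; simp only; rw [div_mul_cancel₀ _ (hsq t).ne']; exact h
      have e4 := mul_le_mul_of_nonneg_left e2 (hk0 t)
      nlinarith [gw_den hε0 t]
    · have e1 : 1 / 2 ≤ |Real.cos t| := by
        by_contra hcon
        push Not at hcon
        have := Real.sin_sq_add_cos_sq t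
        rw [← sq_abs (Real.sin t), ← sq_abs (Real.cos t)] at this
        nlinarith [abs_nonneg (Real.cos t), abs_nonneg (Real.sin t)]
      have e2 : 1 / 2 ≤ |Real.cos t| + ε * |Real.sin t| := by
        have := mul_nonneg hε0.le (abs_nonneg (Real.sin t))
        linarith
      nlinarith [hk0 t, mul_nonneg (hk0 t) (gw_den hε0 t).le]
  have h2 : ∫ t in (0 : ℝ)..π, k t = 2 * Real.arsinh (1 / ε) := by
    have hd : ∀ t ∈ Set.uIcc 0 π, HasDerivAt (fun t => Real.arsinh (-Real.cos t / ε)) (k t) t := by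
      intro t ht
      rw [Set.uIcc_of_le Real.pi_pos.le] at ht
      have := (((Real.hasDerivAt_cos t).neg.div_const ε)).arsinh
      refine this.congr_deriv ?_
      rw [hk]; simp only
      rw [abs_of_nonneg (Real.sin_nonneg_of_mem_Icc ht)]
      have e1 : Real.sqrt (1 + (-Real.cos t / ε) ^ 2) = Real.sqrt (ε ^ 2 + Real.cos t ^ 2) / ε := by
        rw [show 1 + (-Real.cos t / ε) ^ 2 = (ε ^ 2 + Real.cos t ^ 2) / ε ^ 2 by field_simp,
          Real.sqrt_div (by positivity), Real.sqrt_sq hε0.le]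
      simp only [Pi.neg_apply, smul_eq_mul, e1]
      have := hsq t
      field_simp
    rw [intervalIntegral.integral_eq_sub_of_hasDerivAt hd (hkc.intervalIntegrable _ _)]
    simp only [Real.cos_pi, Real.cos_zero, neg_neg, neg_div, Real.arsinh_neg]
    ring
  have h3 : ∫ t in (0 : ℝ)..(N * π), k t = N * (2 * Real.arsinh (1 / ε)) := by
    have hp : Function.Periodic k π := by
      intro t
      rw [hk]; simp only
      rw [Real.sin_add_pi, Real.cos_add_pi, abs_neg, neg_sq]
    have := hp.intervalIntegral_add_zsmul_eq N 0 (fun a b => hkc.intervalIntegrable a b)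
    simp only [zero_add, natCast_zsmul, nsmul_eq_mul] at this
    rw [this, h2]
  have h4 : Real.arsinh (1 / ε) ≤ 3 ^ δ / δ * ε ^ (-δ) := by
    have hx : 1 ≤ 1 / ε := by rw [le_div_iff₀ hε0]; linarith [hε.2]
    set x := 1 / ε with hxd
    have e1 : Real.sqrt (1 + x ^ 2) ≤ 2 * x := by
      rw [Real.sqrt_le_left (by linarith)]
      nlinarith
    unfold Real.arsinh
    calc Real.log (x + Real.sqrt (1 + x ^ 2)) ≤ Real.log (3 * x) := by
          refine Real.log_le_log ?_ (by linarith)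
          have := Real.sqrt_nonneg (1 + x ^ 2)
          linarith
      _ ≤ (3 * x) ^ δ / δ := Real.log_le_rpow_div (by linarith) hδ
      _ = _ := by
          rw [Real.mul_rpow (by norm_num) (by linarith), hxd, one_div, Real.inv_rpow hε0.le, Real.rpow_neg hε0.le]
          ring
  have h5 : 1 ≤ ε ^ (-δ) := Real.one_le_rpow_of_pos_of_le_one_of_nonpos hε0 hε.2 (by linarith)
  calc ∫ t in (0 : ℝ)..T, gw ε t ≤ ∫ t in (0 : ℝ)..T, (2 + 4 * k t) :=
        intervalIntegral.integral_mono_on hT.le ((gw_cont hε0).intervalIntegrable _ _)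
          ((by fun_prop : Continuous fun t => 2 + 4 * k t).intervalIntegrable _ _) fun t _ => h1 t
    _ = 2 * T + 4 * ∫ t in (0 : ℝ)..T, k t := by
        rw [intervalIntegral.integral_add (by simp) ((hkc.const_mul 4).intervalIntegrable _ _),
          intervalIntegral.integral_const_mul]
        simp; ring
    _ ≤ 2 * T + 4 * ∫ t in (0 : ℝ)..(N * π), k t := by
        have := intervalIntegral.integral_mono_interval (f := k) (μ := volume) (le_refl (0 : ℝ)) hT.le hN'
          (ae_of_all _ hk0) (hkc.intervalIntegrable _ _)
        linarith
    _ ≤ (2 * T) * ε ^ (-δ) + 4 * (N * (2 * (3 ^ δ / δ * ε ^ (-δ)))) := by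
        rw [h3]
        refine add_le_add ?_ ?_
        · exact le_mul_of_one_le_right (by linarith) h5
        · gcongr
    _ = _ := by ring

section boot
variable {n : ℕ} {lam ε : ℝ} {u : ℝ → Rn n → ℂ}

lemma hardy_op {φ : Rn n → ℂ} (hφ : Sch φ) (ε c d : ℝ) (j : Fin n) :
    |c| * ∫ y, |(conj (φ y) * pd j φ y).re| ≤ nL φ * nL (Op ε c d j φ) := by
  rw [← integral_const_mul]
  refine le_trans ?_ (nL_mul hφ.memLp (hφ.op ε c d j).memLp)
  refine integral_mono_of_nonneg (ae_of_all _ fun y => by positivity) (nL_mul_int hφ.memLp (hφ.op ε c d j).memLp)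
    (ae_of_all _ fun y => ?_)
  have e : c * (conj (φ y) * pd j φ y).re = (conj (φ y) * Op ε c d j φ y).re := by
    unfold Op
    simp only [Complex.mul_re, Complex.mul_im, Complex.conj_re, Complex.conj_im, Complex.sub_re, Complex.sub_im,
      Complex.ofReal_re, Complex.ofReal_im, Complex.I_re, Complex.I_im]
    ring
  simp only
  rw [← abs_mul, e]
  refine (Complex.abs_re_le_norm _).trans ?_
  rw [norm_mul, RCLike.norm_conj]

lemma hb_op (hn : 2 ≤ n) {φ : Rn n → ℂ} (hφ : Sch φ) (hε : 0 < ε) {m q t : ℝ} (hm : nL φ ≤ m)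
    (hJ : ∀ j, nL (Op ε (Real.cos t) (-Real.sin t) j φ) ≤ q)
    (hH : ∀ j, ε * nL (Op ε (Real.sin t) (Real.cos t) j φ) ≤ q) : HB φ (n * (4 * m * q) * gw ε t) := by
  refine (hardy hn hφ.h1).mono ?_
  have h0 : 0 ≤ m := (nL_nonneg _).trans hm
  have h1 : ∀ j, 2 * ∫ y, |(conj (φ y) * pd j φ y).re| ≤ 4 * m * q * gw ε t := by
    intro j
    have a1 := hardy_op hφ ε (Real.cos t) (-Real.sin t) j
    have a2 := hardy_op hφ ε (Real.sin t) (Real.cos t) j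
    have b1 : nL φ * nL (Op ε (Real.cos t) (-Real.sin t) j φ) ≤ m * q :=
      mul_le_mul hm (hJ j) (nL_nonneg _) h0
    have b2 : nL φ * (ε * nL (Op ε (Real.sin t) (Real.cos t) j φ)) ≤ m * q :=
      mul_le_mul hm (hH j) (mul_nonneg hε.le (nL_nonneg _)) h0
    have a3 := mul_le_mul_of_nonneg_left a2 hε.le
    unfold gw
    rw [← div_eq_mul_inv, le_div_iff₀ (gw_den hε t)]
    nlinarith
  calc _ ≤ ∑ j : Fin n, 4 * m * q * gw ε t := Finset.sum_le_sum fun j _ => h1 j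
    _ = _ := by rw [Finset.sum_const, Finset.card_univ, Fintype.card_fin, nsmul_eq_mul]; ring

lemma boot (hn : 2 ≤ n) (hlam : 0 ≤ lam) (hε : 0 < ε) (hu : Sol lam ε u) {T m a0 : ℝ} (hT : 0 ≤ T)
    (hm : nL (u 0) ≤ m) (ha0 : 0 ≤ a0)
    (hJ : ∀ j, nL (Op ε (Real.cos 0) (-Real.sin 0) j (u 0)) ≤ a0)
    (hH : ∀ j, ε * nL (Op ε (Real.sin 0) (Real.cos 0) j (u 0)) ≤ a0)
    (hsm : ε⁻¹ * ∫ τ in (0 : ℝ)..T, 2 * lam * (n * (4 * m * (2 * a0)) * gw ε τ) ≤ Real.log (4 / 3)) :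
    ∀ t ∈ Set.Icc 0 T, (∀ j, nL (Op ε (Real.cos t) (-Real.sin t) j (u t)) ≤ 2 * a0) ∧
      (∀ j, ε * nL (Op ε (Real.sin t) (Real.cos t) j (u t)) ≤ 2 * a0) := by
  obtain ⟨K, hK⟩ := MM_bdd hn hlam hε hu 0 T
  have hm0 : 0 ≤ m := (nL_nonneg _).trans hm
  have hlog : 0 < Real.log (4 / 3) := Real.log_pos (by norm_num)
  have hV := vK_nonneg (n := n) K
  set L := ε⁻¹ * (2 * lam * vK n K) with hL
  have hL0 : 0 ≤ L := by positivity
  set η := Real.log (4 / 3) / (L + 1) with hη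
  have hη0 : 0 < η := by positivity
  have hLη : L * η ≤ Real.log (4 / 3) := by
    rw [hη, mul_div_assoc', div_le_iff₀ (by positivity)]
    nlinarith
  set v : ℝ → ℝ := fun τ => n * (4 * m * (2 * a0)) * gw ε τ with hv
  have hvc : Continuous v := continuous_const.mul (gw_cont hε)
  have hvp : ∀ τ, 0 ≤ v τ := fun τ => mul_nonneg (by positivity) (gw_pos hε τ).le
  have hmass : ∀ t ∈ Set.Icc 0 T, nL (u t) ≤ m := fun t ht =>
    (mass_const hε hu hK le_rfl ht.1 ht.2).trans_le hm
  have key : ∀ i : ℕ, ∀ t ∈ Set.Icc 0 T, t ≤ i * η → (∀ j, nL (Op ε (Real.cos t) (-Real.sin t) j (u t)) ≤ 2 * a0) ∧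
      (∀ j, ε * nL (Op ε (Real.sin t) (Real.cos t) j (u t)) ≤ 2 * a0) := by
    intro i
    induction i with
    | zero =>
      intro t ht hti
      have : t = 0 := by
        simp only [Nat.cast_zero, zero_mul] at hti
        exact le_antisymm hti ht.1
      subst this
      exact ⟨fun j => (hJ j).trans (by linarith), fun j => (hH j).trans (by linarith)⟩
    | succ i ih =>
      intro t ht hti
      rcases le_or_gt t (i * η) with h | h
      · exact ih t ht h
      set s := (i : ℝ) * η with hs
      have hs0 : 0 ≤ s := by positivity
      have hsT : s ≤ T := h.le.trans ht.2
      have hts : t - s ≤ η := by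
        push_cast at hti
        have : ((i : ℝ) + 1) * η = s + η := by rw [hs]; ring
        linarith
      have hB1 : ∀ τ ∈ Set.Icc 0 s, HB (u τ) (v τ) := by
        intro τ hτ
        have hτT : τ ∈ Set.Icc 0 T := ⟨hτ.1, hτ.2.trans hsT⟩
        obtain ⟨p1, p2⟩ := ih τ hτT hτ.2
        exact hb_op hn (hu.sch τ) hε (hmass τ hτT) p1 p2
      have hE1 : Real.exp (ε⁻¹ * |∫ τ in (0 : ℝ)..s, 2 * lam * v τ|) ≤ 4 / 3 := by
        rw [← Real.le_log_iff_exp_le (by norm_num)]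
        refine le_trans ?_ hsm
        have hp : ∀ τ, 0 ≤ 2 * lam * v τ := fun τ => mul_nonneg (by positivity) (hvp τ)
        rw [abs_of_nonneg (intervalIntegral.integral_nonneg hs0 fun τ _ => hp τ)]
        refine mul_le_mul_of_nonneg_left ?_ (inv_nonneg.2 hε.le)
        exact intervalIntegral.integral_mono_interval (μ := volume) le_rfl hs0 hsT (ae_of_all _ hp)
          ((continuous_const.mul hvc).intervalIntegrable _ _)
      have hE2 : Real.exp (ε⁻¹ * |∫ τ in s..t, 2 * lam * vK n K|) ≤ 4 / 3 := by
        rw [← Real.le_log_iff_exp_le (by norm_num)]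
        refine le_trans (le_of_eq ?_) ((mul_le_mul_of_nonneg_left hts hL0).trans hLη)
        rw [intervalIntegral.integral_const, smul_eq_mul, abs_of_nonneg (mul_nonneg (by linarith) (by positivity)), hL]
        ring
      have gen : ∀ {c d : ℝ → ℝ}, Rot c d → ∀ j, nL (Op ε (c t) (d t) j (u t)) ≤ 2 * nL (Op ε (c 0) (d 0) j (u 0)) := by
        intro c d hr j
        have q1 := op_prop hlam hε hr hu (a := 0) (b := s) (K := K) (fun τ hτ => hK τ ⟨hτ.1, hτ.2.trans hsT⟩)
          hvc hvp hB1 ⟨le_rfl, hs0⟩ ⟨hs0, le_rfl⟩ j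
        have q2 := op_prop hlam hε hr hu (a := s) (b := t) (K := K)
          (fun τ hτ => hK τ ⟨hs0.trans hτ.1, hτ.2.trans ht.2⟩) (v := fun _ => vK n K) continuous_const
          (fun _ => hV) (fun τ hτ => hb_MM hn hu (hK τ ⟨hs0.trans hτ.1, hτ.2.trans ht.2⟩))
          ⟨le_rfl, h.le⟩ ⟨h.le, le_rfl⟩ j
        have N0 := nL_nonneg (Op ε (c 0) (d 0) j (u 0))
        have q3 := q1.trans (mul_le_mul_of_nonneg_left hE1 N0)
        have q4 := q2.trans (mul_le_mul q3 hE2 (Real.exp_nonneg _) (by positivity))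
        linarith
      constructor
      · intro j
        have := gen rotJ j
        linarith [hJ j]
      · intro j
        have := mul_le_mul_of_nonneg_left (gen rotH j) hε.le
        linarith [hH j]
  intro t ht
  obtain ⟨i, hi⟩ := exists_nat_ge (t / η)
  exact key i t ht (by rwa [div_le_iff₀ hη0] at hi)

end boot

lemma eE_le {n : ℕ} {F : Rn n → EuclideanSpace ℂ (Fin n)} {c : ℝ} (hc : 0 ≤ c)
    (hF : ∀ j, MemLp (fun x => F x j) 2 volume) (h : ∀ j, nL (fun x => F x j) ≤ c) :
    eLpNorm F 2 volume ≤ ENNReal.ofReal (n * c) := by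
  have h1 : ∀ x, ‖F x‖ ≤ ∑ j, ‖F x j‖ := by
    intro x
    rw [EuclideanSpace.norm_eq]
    refine Real.sqrt_le_iff.2 ⟨Finset.sum_nonneg fun j _ => norm_nonneg _, ?_⟩
    exact Finset.sum_sq_le_sq_sum_of_nonneg fun j _ => norm_nonneg _
  calc eLpNorm F 2 volume ≤ eLpNorm (∑ j, fun x => ‖F x j‖) 2 volume := by
        refine eLpNorm_mono_real fun x => ?_
        rw [Finset.sum_apply]
        exact h1 x
    _ ≤ ∑ j, eLpNorm (fun x => ‖F x j‖) 2 volume :=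
        eLpNorm_sum_le (fun j _ => (hF j).1.norm) (by norm_num)
    _ ≤ ∑ j : Fin n, ENNReal.ofReal c := by
        refine Finset.sum_le_sum fun j _ => ?_
        rw [eLpNorm_norm, ← nL_ofReal (hF j)]
        exact ENNReal.ofReal_le_ofReal (h j)
    _ = _ := by
        rw [Finset.sum_const, Finset.card_univ, Fintype.card_fin, nsmul_eq_mul,
          ENNReal.ofReal_mul (by positivity), ENNReal.ofReal_natCast]

lemma J_comp {n : ℕ} {ε : ℝ} (hε : 0 < ε) (t : ℝ) (φ : Rn n → ℂ) (j : Fin n) :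
    (fun x => JopE ε t φ x j) = fun x => (-Complex.I) * Op ε (Real.cos t) (-Real.sin t) j φ x := by
  funext x
  have : JopE ε t φ x j = ((x j / ε : ℝ) : ℂ) * ((Real.sin t : ℝ) : ℂ) * φ x
    - Complex.I * ((Real.cos t : ℝ) : ℂ) * pd j φ x := rfl
  rw [this]
  unfold Op
  push_cast
  linear_combination ((x j : ℂ) * (Complex.sin t / ε) * φ x) * Complex.I_sq

lemma H_comp {n : ℕ} {ε : ℝ} (hε : 0 < ε) (t : ℝ) (φ : Rn n → ℂ) (j : Fin n) :
    (fun x => HopE ε t φ x j) = fun x => (Complex.I * (ε : ℂ)) * Op ε (Real.sin t) (Real.cos t) j φ x := by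
  funext x
  have : HopE ε t φ x j = ((x j : ℝ) : ℂ) * ((Real.cos t : ℝ) : ℂ) * φ x
    + Complex.I * (ε : ℂ) * ((Real.sin t : ℝ) : ℂ) * pd j φ x := rfl
  rw [this]
  unfold Op
  have he : (ε : ℂ) ≠ 0 := by exact_mod_cast hε.ne'
  have e2 : (((Real.cos t / ε : ℝ) : ℂ)) * ε = ((Real.cos t : ℝ) : ℂ) := by
    push_cast; field_simp
  linear_combination ((((Real.cos t / ε : ℝ) : ℂ)) * ε * x j * φ x) * Complex.I_sq - (x j * φ x) * e2

lemma sol_of_H {n : ℕ} {α ε : ℝ} {f : Rn n → ℂ} {u : ℝ → Rn n → ℂ} (h : IsSolutionH n α 1 ε f u) :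
    Sol (ε ^ α) ε u := ⟨h.smooth, h.schwartz, h.eq⟩

lemma sol_of_lin {n : ℕ} {ε : ℝ} {u : ℝ → Rn n → ℂ} (h : IsLinSol n ε u) :
    Sol 0 ε u := ⟨h.smooth, h.schwartz, fun t x => by
      have := h.eq t x
      rw [Complex.ofReal_zero, zero_mul, zero_mul, add_zero]
      exact this⟩

set_option maxHeartbeats 800000 in
/-- in the very-weak-nonlinearity case γ = 1 < α, for every T > 0 and every
δ > 0 with α − 1 − δ > 0, for ε small enough,
sup_{0≤t≤T} ‖A^ε(t)(u^ε(t) − u^ε_free(t))‖_{L²} ≤ C ε^{α−1−δ}, where A^ε is either of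
the operators J^ε and H^ε. -/
theorem stmt7 (n : ℕ) (hn : 2 ≤ n) (α : ℝ) (hα : 1 < α) (f : SchwartzMap (Rn n) ℂ)
    (u ufree : ℝ → ℝ → Rn n → ℂ)
    (hu : ∀ ε ∈ Set.Ioc (0 : ℝ) 1, IsSolutionH n α 1 ε (⇑f) (u ε))
    (hfree : ∀ ε ∈ Set.Ioc (0 : ℝ) 1, IsLinSol n ε (ufree ε) ∧ ufree ε 0 = ⇑f) :
    ∀ T : ℝ, 0 < T → ∀ δ : ℝ, 0 < δ → 0 < α - 1 - δ →
      ∃ C : ℝ, 0 < C ∧ ∃ ε₀ ∈ Set.Ioc (0 : ℝ) 1,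
        ∀ ε ∈ Set.Ioc (0 : ℝ) ε₀, ∀ t ∈ Set.Icc (0 : ℝ) T,
          eLpNorm (JopE ε t (fun x => u ε t x - ufree ε t x)) 2 volume
            ≤ ENNReal.ofReal (C * ε ^ (α - 1 - δ))
          ∧ eLpNorm (HopE ε t (fun x => u ε t x - ufree ε t x)) 2 volume
            ≤ ENNReal.ofReal (C * ε ^ (α - 1 - δ)) := by
  intro T hT δ hδ hβ
  obtain ⟨C1, hC1, hgw⟩ := gw_int hδ hT
  set m := nL (⇑f) with hm
  have hm0 : 0 ≤ m := nL_nonneg _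
  set a0 := ∑ j : Fin n, (nL (pd j (⇑f)) + nL (fun x => ((x j : ℝ) : ℂ) * f x)) with ha0d
  have hterm : ∀ j : Fin n, nL (pd j (⇑f)) + nL (fun x => ((x j : ℝ) : ℂ) * f x) ≤ a0 := fun j =>
    Finset.single_le_sum (f := fun j : Fin n => nL (pd j (⇑f)) + nL (fun x => ((x j : ℝ) : ℂ) * f x))
      (fun j _ => add_nonneg (nL_nonneg _) (nL_nonneg _)) (Finset.mem_univ j)
  have ha0 : 0 ≤ a0 := Finset.sum_nonneg fun j _ => add_nonneg (nL_nonneg _) (nL_nonneg _)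
  have hmf : nL (⇑f) ≤ m := le_rfl
  clear_value a0 m
  set A : ℝ := n * (4 * m * (2 * a0)) with hA
  have hA0 : 0 ≤ A := by rw [hA]; positivity
  set D := 2 * A * C1 + 1 with hD
  have hD0 : 0 < D := by rw [hD]; positivity
  have hlog : 0 < Real.log (4 / 3) := Real.log_pos (by norm_num)
  set r := Real.log (4 / 3) / D with hr
  have hr0 : 0 < r := div_pos hlog hD0
  clear_value r D
  refine ⟨n * (6 * A * C1 * a0) + 1, by positivity, min 1 (r ^ (α - 1 - δ)⁻¹),
    ⟨lt_min one_pos (Real.rpow_pos_of_pos hr0 _), min_le_left _ _⟩, ?_⟩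
  intro ε hε t ht
  have hε0 : 0 < ε := hε.1
  have hε1 : ε ∈ Set.Ioc (0 : ℝ) 1 := ⟨hε.1, hε.2.trans (min_le_left _ _)⟩
  set P := ε ^ (α - 1 - δ) with hP
  have hP0 : 0 < P := Real.rpow_pos_of_pos hε0 _
  have hPr : P ≤ r := by
    have := Real.rpow_le_rpow hε0.le (hε.2.trans (min_le_right _ _)) hβ.le
    rwa [← Real.rpow_mul hr0.le, inv_mul_cancel₀ hβ.ne', Real.rpow_one] at this
  have hpow : ε⁻¹ * ε ^ α * ε ^ (-δ) = P := by
    rw [← Real.rpow_neg_one, ← Real.rpow_add hε0, ← Real.rpow_add hε0, hP]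
    congr 1; ring
  have hU := sol_of_H (hu ε hε1)
  have hF := sol_of_lin (hfree ε hε1).1
  have hu0 : u ε 0 = ⇑f := (hu ε hε1).3
  have hf0 : ufree ε 0 = ⇑f := (hfree ε hε1).2
  have hlam : 0 ≤ ε ^ α := (Real.rpow_pos_of_pos hε0 _).le
  set v : ℝ → ℝ := fun τ => A * gw ε τ with hv
  have hvc : Continuous v := continuous_const.mul (gw_cont hε0)
  have hvp : ∀ τ, 0 ≤ v τ := fun τ => mul_nonneg hA0 (gw_pos hε0 τ).le
  have hIk : ∀ k : ℝ, 0 ≤ k → ε⁻¹ * ∫ τ in (0 : ℝ)..T, k * ε ^ α * v τ ≤ k * A * C1 * P := by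
    intro k hk
    have e : ∫ τ in (0 : ℝ)..T, k * ε ^ α * v τ = k * ε ^ α * A * ∫ τ in (0 : ℝ)..T, gw ε τ := by
      rw [← intervalIntegral.integral_const_mul]
      congr 1; funext τ; simp only [hv]; ring
    rw [e, ← hpow]
    have hx : 0 ≤ ε⁻¹ * (k * ε ^ α * A) := by positivity
    have := mul_le_mul_of_nonneg_left (hgw ε hε1) hx
    linarith
  have hbt := boot hn hlam hε0 hU (T := T) (m := m) (a0 := a0) hT.le (by rw [hu0]; exact hmf) ha0
    (by
      intro j
      rw [hu0]
      have e : Op ε (Real.cos 0) (-Real.sin 0) j (⇑f) = pd j (⇑f) := by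
        funext x; unfold Op; simp
      rw [e]
      linarith [hterm j, nL_nonneg (fun x : Rn n => ((x j : ℝ) : ℂ) * f x)])
    (by
      intro j
      rw [hu0]
      have e : Op ε (Real.sin 0) (Real.cos 0) j (⇑f) = fun x => (-Complex.I * ((ε⁻¹ : ℝ) : ℂ)) * (((x j : ℝ) : ℂ) * f x) := by
        funext x; unfold Op; simp
      rw [e, nL_const_mul, norm_mul, norm_neg, Complex.norm_I, one_mul, Complex.norm_real, Real.norm_eq_abs,
        abs_of_pos (inv_pos.2 hε0), ← mul_assoc, mul_inv_cancel₀ hε0.ne', one_mul]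
      linarith [hterm j, nL_nonneg (pd j (⇑f))])
    (by
      refine (hIk 2 (by norm_num)).trans ?_
      have : D * P ≤ Real.log (4 / 3) := by
        have := mul_le_mul_of_nonneg_left hPr hD0.le
        rwa [hr, mul_div_cancel₀ _ hD0.ne'] at this
      rw [hD] at this
      linarith)
  obtain ⟨K1, hK1⟩ := MM_bdd hn hlam hε0 hU 0 T
  obtain ⟨K2, hK2⟩ := MM_bdd hn le_rfl hε0 hF 0 T
  have hB : ∀ s ∈ Set.Icc 0 T, HB (u ε s) (v s) := by
    intro s hs
    refine hb_op hn (hU.sch s) hε0 ?_ (hbt s hs).1 (hbt s hs).2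
    rw [mass_const hε0 hU hK1 le_rfl hs.1 hs.2, hu0]
    exact hmf
  have gen : ∀ {c d : ℝ → ℝ} {q : ℝ}, Rot c d → 0 ≤ q → ∀ j, (∀ s ∈ Set.Icc 0 T, nL (Op ε (c s) (d s) j (u ε s)) ≤ q) →
      nL (Op ε (c t) (d t) j (fun x => u ε t x - ufree ε t x)) ≤ 3 * A * C1 * P * q := by
    intro c d q hrot hq0 j hq
    refine (op_comp hlam hε0 hrot hU hF (K := max K1 K2) (fun s hs => (hK1 s hs).trans (le_max_left _ _))
      (fun s hs => (hK2 s hs).trans (le_max_right _ _)) hvc hvp hB j hq (hu0.trans hf0.symm) ht).trans ?_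
    refine mul_le_mul_of_nonneg_right (le_trans ?_ (hIk 3 (by norm_num))) hq0
    refine mul_le_mul_of_nonneg_left ?_ (inv_nonneg.2 hε0.le)
    exact intervalIntegral.integral_mono_interval (μ := volume) le_rfl ht.1 ht.2
      (ae_of_all _ fun τ => mul_nonneg (by positivity) (hvp τ))
      ((continuous_const.mul hvc).intervalIntegrable _ _)
  have hws : Sch (fun x => u ε t x - ufree ε t x) := (hU.sch t).sub (hF.sch t)
  set w : Rn n → ℂ := fun x => u ε t x - ufree ε t x with hw
  have hc0 : 0 ≤ 3 * A * C1 * P * (2 * a0) := by positivity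
  have hfin : ENNReal.ofReal (n * (3 * A * C1 * P * (2 * a0))) ≤ ENNReal.ofReal ((n * (6 * A * C1 * a0) + 1) * P) := by
    refine ENNReal.ofReal_le_ofReal ?_
    linarith
  refine ⟨(eE_le hc0 ?_ ?_).trans hfin, (eE_le hc0 ?_ ?_).trans hfin⟩
  · intro j
    rw [J_comp hε0]
    exact ((hws.op ε _ _ j).const_mul _).memLp
  · intro j
    rw [J_comp hε0, nL_const_mul, norm_neg, Complex.norm_I, one_mul]
    exact gen rotJ (by positivity) j fun s hs => (hbt s hs).1 j
  · intro j
    rw [H_comp hε0]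
    exact ((hws.op ε _ _ j).const_mul _).memLp
  · intro j
    rw [H_comp hε0, nL_const_mul, norm_mul, Complex.norm_I, one_mul, Complex.norm_real, Real.norm_eq_abs, abs_of_pos hε0]
    have := gen rotH (q := 2 * a0 / ε) (by positivity) j fun s hs => by
      rw [le_div_iff₀ hε0, mul_comm]; exact (hbt s hs).2 j
    have := mul_le_mul_of_nonneg_left this hε0.le
    refine this.trans (le_of_eq ?_)
    field_simp

end
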